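/- For i ∈ Σ_{n+1}, the following are equivalent: (1) the string cone C_i is simplicial, i.e. it is a full-dimensional cone in ℝ^N with exactly N facets; (2) there exists a sequence (σ_1, …, σ_n) ∈ {A, D}^n such that ind_{σ_k}(C_{σ_{k+1}} ∘ ⋯ ∘ C_{σ_n}(i)) = 0 for all k = n, n−1, …, 1; (3) C_i is unimodularly equivalent to the product of cones defined by t_1 ≥ 0; t_2 ≥ t_3 ≥ 0; …; t_{N−n+1} ≥ t_{N−n+2} ≥ ⋯ ≥ t_N ≥ 0 (for k = 1,…,n, the chain t_{k(k−1)/2+1} ≥ ⋯ ≥ t_{k(k−1)/2+k} ≥ 0). -/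

import Mathlib

open scoped Classical

noncomputable section

namespace StringPolytope

/-! ### Words, reduced words, two-moves -/

/-- the simple transposition `s_a = (a, a+1)` acting on `ℕ` (wires are `1, …, n+1`). -/
def sTrans (a : ℕ) : Equiv.Perm ℕ := Equiv.swap a (a + 1)

/-- product `s_{i₁} ⋯ s_{i_N}` of the simple transpositions of a word. -/
def wordProd (w : List ℕ) : Equiv.Perm ℕ := (w.map sTrans).prod

/-- the longest element `w₀` of the symmetric group on `{1, …, n+1}`,
sending `k ↦ n + 2 - k` there and fixing everything else. -/
def longestPerm (n : ℕ) : Equiv.Perm ℕ :=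
  Function.Involutive.toPerm
    (fun k => if 1 ≤ k ∧ k ≤ n + 1 then n + 2 - k else k)
    (by intro k; dsimp only; split_ifs <;> omega)

/-- `w ∈ Σ_{n+1}`: a reduced word of the longest element of `S_{n+1}`,
i.e. a word over `[n] = {1,…,n}` of length `N = n(n+1)/2` whose product is `w₀`. -/
def IsReduced (n : ℕ) (w : List ℕ) : Prop :=
  w.length = n * (n + 1) / 2 ∧ (∀ a ∈ w, 1 ≤ a ∧ a ≤ n) ∧ wordProd w = longestPerm n

/-- a single 2-move: exchange two adjacent letters `(a, b)` with `|a - b| > 1`. -/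
def TwoMoveStep (w w' : List ℕ) : Prop :=
  ∃ u v a b, (a + 1 < b ∨ b + 1 < a) ∧ w = u ++ a :: b :: v ∧ w' = u ++ b :: a :: v

/-- 2-move equivalence of words. -/
def TwoMoveEquiv : List ℕ → List ℕ → Prop := Relation.ReflTransGen TwoMoveStep

/-- `A_n = (1, 2, …, n)`. -/
def ascWord (n : ℕ) : List ℕ := (List.range n).map (· + 1)

/-- `D_n = (n, n-1, …, 1)`. -/
def descWord (n : ℕ) : List ℕ := (ascWord n).reverse

/-! ### The wiring diagram -/

/-- the letter `i_j` of `w` (1-based index `j`); the node `t_j` lies in column `i_j`. -/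
def letterAt (w : List ℕ) (j : ℕ) : ℕ := w.getD (j - 1) 0

/-- `1 ≤ j ≤ N`: `t_j` is an actual node of the diagram. -/
def ValidNode (w : List ℕ) (j : ℕ) : Prop := 1 ≤ j ∧ j ≤ w.length

/-- the column-to-wire assignment just above node `t_j`
(at the top of the diagram, wire `k` is in column `k`). -/
def stateAbove (w : List ℕ) (j : ℕ) : Equiv.Perm ℕ := wordProd (w.take (j - 1))

/-- the column-to-wire assignment just below node `t_j`. -/
def stateBelow (w : List ℕ) (j : ℕ) : Equiv.Perm ℕ := wordProd (w.take j)

/-- one of the two wires crossing at node `t_j` (the one leaving upward-left). -/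
def wireX (w : List ℕ) (j : ℕ) : ℕ := stateAbove w j (letterAt w j)

/-- the other wire crossing at node `t_j` (the one leaving upward-right). -/
def wireY (w : List ℕ) (j : ℕ) : ℕ := stateAbove w j (letterAt w j + 1)

/-- the node `t_j` lies on the wire `ℓ_r`. -/
def NodeOnWire (w : List ℕ) (j r : ℕ) : Prop := wireX w j = r ∨ wireY w j = r

/-- given one wire `r` at node `t_j`, the other wire crossing there. -/
def otherWire (w : List ℕ) (j r : ℕ) : ℕ := if wireX w j = r then wireY w j else wireX w j

/-- the column of wire `ℓ_r` at the height of node `t_j`. -/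
def wireCol (w : List ℕ) (j r : ℕ) : ℕ := (stateBelow w j).symm r

/-- node `t_j` lies strictly below the wire `ℓ_{n+1}`
(which runs from the bottom-left corner to the top-right corner). -/
def BelowWireLast (n : ℕ) (w : List ℕ) (j : ℕ) : Prop :=
  wireCol w j (n + 1) < letterAt w j

/-- node `t_j` lies strictly above the wire `ℓ_{n+1}`. -/
def AboveWireLast (n : ℕ) (w : List ℕ) (j : ℕ) : Prop :=
  letterAt w j + 1 < wireCol w j (n + 1)

/-- node `t_j` lies strictly below the wire `ℓ_1`
(which runs from the bottom-right corner to the top-left corner). -/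
def BelowWireOne (w : List ℕ) (j : ℕ) : Prop :=
  letterAt w j + 1 < wireCol w j 1

/-- node `t_j` lies strictly above the wire `ℓ_1`. -/
def AboveWireOne (w : List ℕ) (j : ℕ) : Prop :=
  wireCol w j 1 < letterAt w j

/-! ### Rigorous (Gleizer–Postnikov) paths

A path in `G(i, k)` is encoded by `k` together with the list of its switching
nodes, in order of travel.  Wires `ℓ_1, …, ℓ_k` are oriented upward
(decreasing node index) and the remaining wires downward. -/

/-- the (1-based indices of the) nodes lying on wire `ℓ_r`, in order of increasing index. -/
def nodesOn (w : List ℕ) (r : ℕ) : List ℕ :=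
  ((List.range w.length).map (· + 1)).filter (fun j => decide (NodeOnWire w j r))

/-- nodes on wire `ℓ_r` strictly between the nodes `t_a` and `t_b`. -/
def segList (w : List ℕ) (r a b : ℕ) : List ℕ :=
  (nodesOn w r).filter (fun j => decide (min a b < j ∧ j < max a b))

/-- nodes on wire `ℓ_r` strictly below the node `t_a`. -/
def tailList (w : List ℕ) (r a : ℕ) : List ℕ :=
  (nodesOn w r).filter (fun j => decide (a < j))

/-- a forbidden fragment of `G(i, k)`: the path passes straight through node `t_j`
travelling along the wire `ℓ_r`, where the other wire `ℓ_b` crossing there has the same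
orientation as `ℓ_r` and (`r < b` if both upward, `r > b` if both downward). -/
def Forbidden (w : List ℕ) (k j r : ℕ) : Prop :=
  (r ≤ k ∧ otherWire w j r ≤ k ∧ r < otherWire w j r) ∨
  (k < r ∧ k < otherWire w j r ∧ otherWire w j r < r)

/-- travelling in `G(i,k)`: currently on wire `ℓ_r` at node `t_a` (just switched there),
with future switching nodes `ms`; the travel is legal and ends at `L_{k+1}`. -/
def TravelOK (w : List ℕ) (k : ℕ) : ℕ → ℕ → List ℕ → Prop
  | r, a, [] => r = k + 1 ∧ ∀ j ∈ tailList w r a, ¬ Forbidden w k j r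
  | r, a, m :: ms =>
      ValidNode w m ∧ NodeOnWire w m r ∧
      (if r ≤ k then m < a else a < m) ∧
      (∀ j ∈ segList w r a m, ¬ Forbidden w k j r) ∧
      TravelOK w k (otherWire w m r) m ms

/-- all nodes visited after the switch at node `t_a` onto wire `ℓ_r`. -/
def visitTail (w : List ℕ) : ℕ → ℕ → List ℕ → List ℕ
  | r, a, [] => tailList w r a
  | r, a, m :: ms => segList w r a m ++ m :: visitTail w (otherWire w m r) m ms

/-- the list of all nodes visited by the path (switching nodes and straight passes). -/
def visitList (w : List ℕ) (k : ℕ) : List ℕ → List ℕ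
  | [] => []
  | m :: ms => tailList w k m ++ m :: visitTail w (otherWire w m k) m ms

/-- `(k, ms)` encodes a rigorous (Gleizer–Postnikov) path in `G(i, k)`:
it starts at `L_k` going up the wire `ℓ_k`, switches wires exactly at the nodes
listed in `ms`, respects the orientation, ends at `L_{k+1}`, contains no forbidden
fragment and passes through each node at most once. -/
def IsGPPath (n : ℕ) (w : List ℕ) (k : ℕ) (ms : List ℕ) : Prop :=
  1 ≤ k ∧ k ≤ n ∧
  (match ms with
   | [] => False
   | m :: rest =>
       ValidNode w m ∧ NodeOnWire w m k ∧
       (∀ j ∈ tailList w k m, ¬ Forbidden w k j k) ∧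
       TravelOK w k (otherWire w m k) m rest) ∧
  (visitList w k ms).Nodup

/-- the set `GP(i)` of all rigorous paths of `G(i)`. -/
def GP (n : ℕ) (w : List ℕ) : Set (ℕ × List ℕ) := {p | IsGPPath n w p.1 p.2}

/-- `|GP(i)|`, the number of rigorous paths. -/
def numGP (n : ℕ) (w : List ℕ) : ℕ := (GP n w).ncard

/-- the successive switches of a path: `(node, from-wire, to-wire)`. -/
def pathSwitches (w : List ℕ) : ℕ → List ℕ → List (ℕ × ℕ × ℕ)
  | _, [] => []
  | r, m :: ms => (m, r, otherWire w m r) :: pathSwitches w (otherWire w m r) ms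

/-- the wire-expression of a path: the successive wires travelled. -/
def wireSeq (w : List ℕ) : ℕ → List ℕ → List ℕ
  | r, [] => [r]
  | r, m :: ms => r :: wireSeq w (otherWire w m r) ms

/-- the peaks of a path: switching nodes where the path switches from an
upward wire to a downward wire. -/
def peaks (w : List ℕ) (k : ℕ) (ms : List ℕ) : List ℕ :=
  ((pathSwitches w k ms).filter (fun e => decide (e.2.1 ≤ k ∧ k < e.2.2))).map (·.1)

/-! ### String cone, `λ`-cone, string polytope -/

/-- `N = n(n+1)/2`, the number of nodes. -/
abbrev Dim (n : ℕ) : ℕ := n * (n + 1) / 2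

/-- the coefficient `a_j` of `t_j` in the string inequality of the path `(k, ms)`:
`+1` if the path switches at `t_j` from `ℓ_r` to `ℓ_s` with `r < s`,
`-1` if it switches with `r > s`, and `0` otherwise. -/
def coeff (w : List ℕ) (k : ℕ) (ms : List ℕ) (j : ℕ) : ℝ :=
  ((pathSwitches w k ms).map (fun e =>
    if e.1 = j then (if e.2.1 < e.2.2 then (1 : ℝ) else -1) else 0)).sum

/-- the (primitive inward normal) coefficient vector of the string inequality of a path. -/
def normalVec (n : ℕ) (w : List ℕ) (p : ℕ × List ℕ) : Fin (Dim n) → ℝ :=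
  fun j => coeff w p.1 p.2 ((j : ℕ) + 1)

/-- the left-hand side `∑ a_j t_j` of the string inequality of the path `p`. -/
def stringIneq (n : ℕ) (w : List ℕ) (p : ℕ × List ℕ) (t : Fin (Dim n) → ℝ) : ℝ :=
  ∑ j : Fin (Dim n), normalVec n w p j * t j

/-- the string cone `C_i ⊆ ℝ^N`. -/
def stringCone (n : ℕ) (w : List ℕ) : Set (Fin (Dim n) → ℝ) :=
  {t | ∀ p ∈ GP n w, 0 ≤ stringIneq n w p t}

/-- the polyhedron cut out by all string inequalities except the one of `p₀`. -/
def stringConeExcept (n : ℕ) (w : List ℕ) (p₀ : ℕ × List ℕ) : Set (Fin (Dim n) → ℝ) :=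
  {t | ∀ p ∈ GP n w, p ≠ p₀ → 0 ≤ stringIneq n w p t}

/-- the coefficient `a_k` in the `λ`-inequality of node `t_j`:
`1` if `t_k` is one column left or right of `t_j`, `-2` if in the same column. -/
def lamCoeff (w : List ℕ) (j k : ℕ) : ℝ :=
  if letterAt w k = letterAt w j then -2
  else if letterAt w k = letterAt w j + 1 ∨ letterAt w k + 1 = letterAt w j then 1
  else 0

/-- the `λ`-inequality of node `t_{j+1}`:
`t_j ≤ λ_{i_j} + ∑_{k > j} a_k t_k`. -/
def LamIneq (n : ℕ) (w : List ℕ) (lam : ℕ → ℤ) (j : Fin (Dim n)) (t : Fin (Dim n) → ℝ) : Prop :=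
  t j ≤ (lam (letterAt w ((j : ℕ) + 1)) : ℝ) +
    ∑ k : Fin (Dim n),
      (if (j : ℕ) < (k : ℕ) then lamCoeff w ((j : ℕ) + 1) ((k : ℕ) + 1) else 0) * t k

/-- the `λ`-cone `C_i^λ ⊆ ℝ^N`. -/
def lamCone (n : ℕ) (w : List ℕ) (lam : ℕ → ℤ) : Set (Fin (Dim n) → ℝ) :=
  {t | ∀ j, LamIneq n w lam j t}

/-- the polyhedron cut out by all `λ`-inequalities except the one of `j₀`. -/
def lamConeExcept (n : ℕ) (w : List ℕ) (lam : ℕ → ℤ) (j₀ : Fin (Dim n)) :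
    Set (Fin (Dim n) → ℝ) :=
  {t | ∀ j, j ≠ j₀ → LamIneq n w lam j t}

/-- the string polytope `Δ_i(λ) = C_i ∩ C_i^λ`. -/
def stringPolytope (n : ℕ) (w : List ℕ) (lam : ℕ → ℤ) : Set (Fin (Dim n) → ℝ) :=
  stringCone n w ∩ lamCone n w lam

/-- `λ = λ_1 ϖ_1 + ⋯ + λ_n ϖ_n` is a dominant integral weight: all `λ_j ≥ 0`. -/
def Dominant (n : ℕ) (lam : ℕ → ℤ) : Prop := ∀ j, 1 ≤ j → j ≤ n → 0 ≤ lam j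

/-- `λ` is a regular dominant integral weight: all `λ_j > 0`. -/
def RegularDominant (n : ℕ) (lam : ℕ → ℤ) : Prop := ∀ j, 1 ≤ j → j ≤ n → 0 < lam j

/-! ### Unimodular equivalence, Gelfand–Cetlin polytope, facets -/

/-- `P` and `Q` are unimodularly equivalent: `Q = M(P) + v` with `M ∈ GL(m, ℤ)`, `v ∈ ℤ^m`. -/
def UnimodEquiv {m : ℕ} (P Q : Set (Fin m → ℝ)) : Prop :=
  ∃ (M : Matrix (Fin m) (Fin m) ℤ) (v : Fin m → ℤ), IsUnit M.det ∧
    Q = (fun x i => (∑ j, (M i j : ℝ) * x j) + (v i : ℝ)) '' P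

/-- the entry `x_{k,j}` (`1 ≤ j ≤ k ≤ n+1`) of a Gelfand–Cetlin pattern, where the
top row is `x_{n+1,j} = λ_j + ⋯ + λ_n` and `x_{n+1,n+1} = 0`; the pair `(k, j)` is
encoded as the coordinate `k(k-1)/2 + (j-1)` of `ℝ^N`. -/
def gcX (n : ℕ) (lam : ℕ → ℤ) (x : Fin (Dim n) → ℝ) (k j : ℕ) : ℝ :=
  if k = n + 1 then (if j ≤ n then ∑ t ∈ Finset.Icc j n, (lam t : ℝ) else 0)
  else if h : k * (k - 1) / 2 + (j - 1) < Dim n then x ⟨k * (k - 1) / 2 + (j - 1), h⟩ else 0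

/-- the Gelfand–Cetlin polytope `GC(λ) ⊆ ℝ^N`. -/
def GCPolytope (n : ℕ) (lam : ℕ → ℤ) : Set (Fin (Dim n) → ℝ) :=
  {x | ∀ k j, 1 ≤ k → k ≤ n → 1 ≤ j → j ≤ k →
      gcX n lam x k j ≤ gcX n lam x (k + 1) j ∧
      gcX n lam x (k + 1) (j + 1) ≤ gcX n lam x k j}

/-- a face of a convex set: a convex extreme subset. -/
def IsFaceSet {m : ℕ} (S F : Set (Fin m → ℝ)) : Prop := IsExtreme ℝ S F ∧ Convex ℝ F

/-- a facet: a maximal proper face. -/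
def IsFacet {m : ℕ} (S F : Set (Fin m → ℝ)) : Prop :=
  IsFaceSet S F ∧ F ≠ S ∧ ∀ G, IsFaceSet S G → G ≠ S → F ⊆ G → F = G

/-- the number of facets. -/
def numFacets {m : ℕ} (S : Set (Fin m → ℝ)) : ℕ := {F | IsFacet S F}.ncard

/-- combinatorial equivalence: an inclusion-preserving bijection between face lattices. -/
def CombEquiv {m : ℕ} (S T : Set (Fin m → ℝ)) : Prop :=
  ∃ e : {F // IsFaceSet S F} ≃ {F // IsFaceSet T F},
    ∀ F G : {F // IsFaceSet S F}, F.1 ⊆ G.1 ↔ (e F).1 ⊆ (e G).1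

/-! ### Indices, contractions and extensions -/

/-- the `D`-index `ind_D(i) = |i_D^+|` for a decomposition `i ∼ i_D^- D_n i_D^+`
(independent of the decomposition). -/
def indD (n : ℕ) (w : List ℕ) : ℕ :=
  sInf {s | ∃ u v : List ℕ, v.length = s ∧ TwoMoveEquiv w (u ++ descWord n ++ v)}

/-- the `A`-index `ind_A(i) = |i_A^+|` for a decomposition `i ∼ i_A^- A_n i_A^+`. -/
def indA (n : ℕ) (w : List ℕ) : ℕ :=
  sInf {s | ∃ u v : List ℕ, v.length = s ∧ TwoMoveEquiv w (u ++ ascWord n ++ v)}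

/-- `w'` is a `D`-contraction `C_D(w) = i_D^- (i_D^+ - 1)` of `w ∈ Σ_{n+1}`. -/
def IsContractionD (n : ℕ) (w w' : List ℕ) : Prop :=
  ∃ u v : List ℕ, TwoMoveEquiv w (u ++ descWord n ++ v) ∧ w' = u ++ v.map (· - 1)

/-- `w'` is an `A`-contraction `C_A(w) = (i_A^- - 1) i_A^+` of `w ∈ Σ_{n+1}`. -/
def IsContractionA (n : ℕ) (w w' : List ℕ) : Prop :=
  ∃ u v : List ℕ, TwoMoveEquiv w (u ++ ascWord n ++ v) ∧ w' = u.map (· - 1) ++ v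

/-- the `D`-extension `E_D(s) : Σ_{n+1} → Σ_{n+2}`,
`i = i^-(s) i^+(s) ↦ i^-(s) D_{n+1} (i^+(s) + 1)` where `|i^+(s)| = s`. -/
def extD (n : ℕ) (s : ℕ) (w : List ℕ) : List ℕ :=
  w.take (w.length - s) ++ descWord (n + 1) ++ (w.drop (w.length - s)).map (· + 1)

/-- the `A`-extension `E_A(s) : Σ_{n+1} → Σ_{n+2}`,
`i = i^-(s) i^+(s) ↦ (i^-(s) + 1) A_{n+1} i^+(s)`. -/
def extA (n : ℕ) (s : ℕ) (w : List ℕ) : List ℕ :=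
  (w.take (w.length - s)).map (· + 1) ++ ascWord (n + 1) ++ w.drop (w.length - s)

/-- there exists `(σ_1, …, σ_n) ∈ {A, D}^n` (here `true = D`, `false = A`) such that
`ind_{σ_k}(C_{σ_{k+1}} ∘ ⋯ ∘ C_{σ_n}(i)) = 0` for all `k = n, …, 1`. -/
def SimplicialWord (n : ℕ) (w : List ℕ) : Prop :=
  ∃ (σ : ℕ → Bool) (c : ℕ → List ℕ), c n = w ∧
    ∀ k, 1 ≤ k → k ≤ n →
      (if σ k then IsContractionD k (c k) (c (k - 1)) ∧ indD k (c k) = 0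
       else IsContractionA k (c k) (c (k - 1)) ∧ indA k (c k) = 0)


/-- the `D`-coindex `coind_D(i) = |i_D^-|`. -/
def coindD (n : ℕ) (w : List ℕ) : ℕ :=
  sInf {s | ∃ u v : List ℕ, u.length = s ∧ TwoMoveEquiv w (u ++ descWord n ++ v)}

/-- the `A`-coindex `coind_A(i) = |i_A^-|`. -/
def coindA (n : ℕ) (w : List ℕ) : ℕ :=
  sInf {s | ∃ u v : List ℕ, u.length = s ∧ TwoMoveEquiv w (u ++ ascWord n ++ v)}

/-- the `a`-th (0-based) coordinate of a point of `ℝ^N`. -/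
def entry (n : ℕ) (t : Fin (Dim n) → ℝ) (a : ℕ) : ℝ :=
  if h : a < Dim n then t ⟨a, h⟩ else 0

/-- the product of cones
`t_1 ≥ 0`, `t_2 ≥ t_3 ≥ 0`, …, `t_{N-n+1} ≥ ⋯ ≥ t_N ≥ 0` (in `ℝ^N`, 1-based:
for `k = 1, …, n` the chain `t_{k(k-1)/2+1} ≥ ⋯ ≥ t_{k(k-1)/2+k} ≥ 0`). -/
def chainCone (n : ℕ) : Set (Fin (Dim n) → ℝ) :=
  {t | ∀ k j, 1 ≤ k → k ≤ n → 1 ≤ j → j ≤ k →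
    (if j = k then 0 else entry n t (k * (k - 1) / 2 + j)) ≤
      entry n t (k * (k - 1) / 2 + (j - 1))}

/-! ### Trails -/

/-- pairs of wires crossing, reading a word from a given state -/
def pr : Equiv.Perm ℕ → List ℕ → List (ℕ × ℕ)
  | _, [] => []
  | π, a :: w => (π a, π (a + 1)) :: pr (π * sTrans a) w

/-- reading the word only creates inversions -/
def Red : Equiv.Perm ℕ → List ℕ → Prop
  | _, [] => True
  | π, a :: w => π a < π (a + 1) ∧ Red (π * sTrans a) w

/-- one step of a trail -/
def StepF (r s : ℕ) (F G : Set ℕ) (d : ℤ) : Prop :=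
  (d = 0 ∧ G = F ∧ (s ∈ F → r ∈ F)) ∨
  (d = 1 ∧ r ∈ F ∧ s ∉ F ∧ G = insert s (F \ {r})) ∨
  (d = -1 ∧ r ∉ F ∧ s ∈ F ∧ G = insert r (F \ {s}))

/-- trails -/
inductive FT : List (ℕ × ℕ) → Set ℕ → Set ℕ → List ℤ → Prop
  | nil (F : Set ℕ) : FT [] F F []
  | cons {r s : ℕ} {L : List (ℕ × ℕ)} {F G F' : Set ℕ} {d : ℤ} {ds : List ℤ}
      (h : StepF r s F G d) (t : FT L G F' ds) : FT ((r, s) :: L) F F' (d :: ds)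

/-- final set of a trail -/
def EndS (k : ℕ) : Set ℕ := {r | r < k ∨ r = k + 1}

/-- all trail vectors of a word -/
def DL (n : ℕ) (w : List ℕ) : Set (List ℤ) :=
  {ds | ∃ k, 1 ≤ k ∧ k ≤ n ∧ FT (pr 1 w) (Set.Iic k) (EndS k) ds}

@[simp] lemma wordProd_nil : wordProd [] = 1 := rfl

@[simp] lemma wordProd_cons (a : ℕ) (w : List ℕ) :
    wordProd (a :: w) = sTrans a * wordProd w := by simp [wordProd]

@[simp] lemma wordProd_append (u v : List ℕ) :
    wordProd (u ++ v) = wordProd u * wordProd v := by simp [wordProd]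

lemma pr_append (π : Equiv.Perm ℕ) (u v : List ℕ) :
    pr π (u ++ v) = pr π u ++ pr (π * wordProd u) v := by
  induction u generalizing π with
  | nil => simp [pr]
  | cons a u ih => simp [pr, ih, mul_assoc]

lemma pr_length (π : Equiv.Perm ℕ) (u : List ℕ) : (pr π u).length = u.length := by
  induction u generalizing π with
  | nil => simp [pr]
  | cons a u ih => simp [pr, ih]

lemma Red_append (π : Equiv.Perm ℕ) (u v : List ℕ) :
    Red π (u ++ v) ↔ Red π u ∧ Red (π * wordProd u) v := by
  induction u generalizing π with
  | nil => simp [Red]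
  | cons a u ih => simp [Red, ih, mul_assoc, and_assoc]

lemma FT.append {L L' : List (ℕ × ℕ)} {F G H : Set ℕ} {ds ds' : List ℤ}
    (h : FT L F G ds) (h' : FT L' G H ds') : FT (L ++ L') F H (ds ++ ds') := by
  induction h with
  | nil F => simpa using h'
  | cons hs t ih => exact FT.cons hs (ih h')

lemma FT.length {L : List (ℕ × ℕ)} {F G : Set ℕ} {ds : List ℤ}
    (h : FT L F G ds) : ds.length = L.length := by
  induction h with
  | nil F => rfl
  | cons hs t ih => simp [ih]

lemma FT.split {L L' : List (ℕ × ℕ)} {F H : Set ℕ} {ds : List ℤ}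
    (h : FT (L ++ L') F H ds) :
    ∃ G d1 d2, ds = d1 ++ d2 ∧ FT L F G d1 ∧ FT L' G H d2 := by
  induction L generalizing F ds with
  | nil => exact ⟨F, [], ds, rfl, FT.nil F, h⟩
  | cons p L ih =>
    cases h with
    | cons hs t =>
      obtain ⟨G, d1, d2, rfl, h1, h2⟩ := ih t
      exact ⟨G, _ :: d1, d2, rfl, FT.cons hs h1, h2⟩

lemma FT.nil_iff {F G : Set ℕ} {ds : List ℤ} : FT [] F G ds ↔ F = G ∧ ds = [] := by
  constructor
  · intro h; cases h; simp
  · rintro ⟨rfl, rfl⟩; exact FT.nil F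

lemma FT.cons_iff {r s : ℕ} {L : List (ℕ × ℕ)} {F H : Set ℕ} {ds : List ℤ} :
    FT ((r, s) :: L) F H ds ↔ ∃ d ds' G, ds = d :: ds' ∧ StepF r s F G d ∧ FT L G H ds' := by
  constructor
  · intro h
    cases h with
    | cons hs t => exact ⟨_, _, _, rfl, hs, t⟩
  · rintro ⟨d, ds', G, rfl, hs, t⟩; exact FT.cons hs t

/-- following without deviation -/
lemma FT.follow {L : List (ℕ × ℕ)} {F : Set ℕ}
    (h : ∀ p ∈ L, p.2 ∈ F → p.1 ∈ F) : FT L F F (List.replicate L.length 0) := by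
  induction L with
  | nil => exact FT.nil F
  | cons p L ih =>
    obtain ⟨r, s⟩ := p
    refine FT.cons (G := F) (Or.inl ⟨rfl, rfl, ?_⟩) (ih ?_)
    · exact h (r, s) (by simp)
    · intro p hp; exact h p (by simp [hp])

lemma sTrans_apply (a x : ℕ) :
    sTrans a x = if x = a then a + 1 else if x = a + 1 then a else x := by
  unfold sTrans; rw [Equiv.swap_apply_def]

lemma sTrans_left (a : ℕ) : sTrans a a = a + 1 := by simp [sTrans_apply]
lemma sTrans_right (a : ℕ) : sTrans a (a + 1) = a := by simp [sTrans_apply]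
lemma sTrans_of_ne {a x : ℕ} (h : x ≠ a) (h' : x ≠ a + 1) : sTrans a x = x := by
  simp [sTrans_apply, h, h']

@[simp] lemma sTrans_symm (a : ℕ) : (sTrans a).symm = sTrans a := by simp [sTrans]
@[simp] lemma sTrans_inv (a : ℕ) : (sTrans a)⁻¹ = sTrans a := by simp [sTrans]
@[simp] lemma sTrans_mul_self (a : ℕ) : sTrans a * sTrans a = 1 := by simp [sTrans]

lemma mul_sTrans_symm (π : Equiv.Perm ℕ) (a x : ℕ) :
    (π * sTrans a).symm x = sTrans a (π.symm x) := by
  have : (π * sTrans a)⁻¹ x = sTrans a (π⁻¹ x) := by rw [mul_inv_rev]; simp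
  exact this

lemma mem_pr {π : Equiv.Perm ℕ} {w : List ℕ} {p : ℕ × ℕ} :
    p ∈ pr π w ↔ ∃ u a v, w = u ++ a :: v ∧ p = ((π * wordProd u) a, (π * wordProd u) (a + 1)) := by
  induction w generalizing π with
  | nil => simp [pr]
  | cons b w ih =>
    simp only [pr, List.mem_cons, ih]
    constructor
    · rintro (rfl | ⟨u, a, v, rfl, rfl⟩)
      · exact ⟨[], b, w, rfl, by simp⟩
      · exact ⟨b :: u, a, v, rfl, by simp [mul_assoc]⟩
    · rintro ⟨u, a, v, h, rfl⟩
      cases u with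
      | nil => simp at h; left; simp [h.1]
      | cons c u =>
        simp at h; right
        exact ⟨u, a, v, h.2, by simp [h.1, mul_assoc]⟩

lemma Red.pr_lt {π : Equiv.Perm ℕ} {w : List ℕ} (h : Red π w) :
    ∀ p ∈ pr π w, p.1 < p.2 := by
  intro p hp
  obtain ⟨u, a, v, rfl, rfl⟩ := mem_pr.1 hp
  rw [Red_append] at h
  exact h.2.1

/-- inversions stay -/
lemma sTrans_lt_of_lt {a p q : ℕ} (h : p < q) (hne : ¬ (p = a ∧ q = a + 1)) :
    sTrans a p < sTrans a q := by
  simp only [sTrans_apply]; split_ifs <;> omega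

lemma Red.inv_stay {π : Equiv.Perm ℕ} {w : List ℕ} (h : Red π w) {x y : ℕ} (hxy : x < y)
    (hp : π.symm y < π.symm x) : (π * wordProd w).symm y < (π * wordProd w).symm x := by
  induction w generalizing π with
  | nil => simpa using hp
  | cons a w ih =>
    have := ih h.2 (by
      rw [mul_sTrans_symm, mul_sTrans_symm]
      apply sTrans_lt_of_lt hp
      rintro ⟨h1, h2⟩
      have h3 := h.1
      rw [← h2] at h3
      rw [← h1] at h3
      simp at h3; omega)
    simpa [mul_assoc] using this

lemma exists_cross {π : Equiv.Perm ℕ} {w : List ℕ} {x y : ℕ}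
    (hp : π.symm x < π.symm y)
    (hq : (π * wordProd w).symm y < (π * wordProd w).symm x) :
    ∃ u a v, w = u ++ a :: v ∧ (π * wordProd u) a = x ∧ (π * wordProd u) (a + 1) = y := by
  induction w generalizing π with
  | nil => simp at hq; omega
  | cons a w ih =>
    by_cases hc : π.symm x = a ∧ π.symm y = a + 1
    · refine ⟨[], a, w, rfl, ?_, ?_⟩
      · simp [← hc.1]
      · simp [← hc.2]
    · obtain ⟨u, b, v, rfl, h1, h2⟩ := ih (π := π * sTrans a)
        (by rw [mul_sTrans_symm, mul_sTrans_symm]; exact sTrans_lt_of_lt hp hc)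
        (by simpa [mul_assoc] using hq)
      exact ⟨a :: u, b, v, rfl, by simpa [mul_assoc] using h1, by simpa [mul_assoc] using h2⟩

lemma longestPerm_apply (n k : ℕ) :
    longestPerm n k = if 1 ≤ k ∧ k ≤ n + 1 then n + 2 - k else k := rfl

lemma longestPerm_symm (n : ℕ) : (longestPerm n).symm = longestPerm n := rfl

/-- words with letters in `[1,n]` fix everything outside -/
lemma wordProd_fix {n : ℕ} {w : List ℕ} (h : ∀ a ∈ w, 1 ≤ a ∧ a ≤ n) {x : ℕ}
    (hx : x = 0 ∨ n + 1 < x) : wordProd w x = x := by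
  induction w with
  | nil => simp
  | cons a w ih =>
    have h1 := h a (by simp)
    rw [wordProd_cons, Equiv.Perm.mul_apply, ih (fun b hb => h b (by simp [hb])),
      sTrans_of_ne] <;> omega

lemma wordProd_range {n : ℕ} {w : List ℕ} (h : ∀ a ∈ w, 1 ≤ a ∧ a ≤ n) {x : ℕ}
    (hx : 1 ≤ x ∧ x ≤ n + 1) : 1 ≤ wordProd w x ∧ wordProd w x ≤ n + 1 := by
  by_contra hc
  have h1 : wordProd w x = 0 ∨ n + 1 < wordProd w x := by omega
  have h2 := wordProd_fix h h1
  have := (wordProd w).injective h2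
  omega

lemma wordProd_symm_fix {n : ℕ} {w : List ℕ} (h : ∀ a ∈ w, 1 ≤ a ∧ a ≤ n) {x : ℕ}
    (hx : x = 0 ∨ n + 1 < x) : (wordProd w).symm x = x := by
  rw [Equiv.symm_apply_eq, wordProd_fix h hx]

lemma wordProd_symm_range {n : ℕ} {w : List ℕ} (h : ∀ a ∈ w, 1 ≤ a ∧ a ≤ n) {x : ℕ}
    (hx : 1 ≤ x ∧ x ≤ n + 1) : 1 ≤ (wordProd w).symm x ∧ (wordProd w).symm x ≤ n + 1 := by
  by_contra hc
  have h1 : (wordProd w).symm x = 0 ∨ n + 1 < (wordProd w).symm x := by omega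
  have h2 := wordProd_fix h h1
  rw [Equiv.apply_symm_apply] at h2
  omega

/-- inversion set -/
def InvV (n : ℕ) (π : Equiv.Perm ℕ) : Finset (ℕ × ℕ) :=
  (Finset.range (n + 2) ×ˢ Finset.range (n + 2)).filter
    (fun p => p.1 < p.2 ∧ π.symm p.2 < π.symm p.1)

lemma InvV_step (n : ℕ) (π : Equiv.Perm ℕ) (a : ℕ) :
    InvV n (π * sTrans a) ⊆ insert (π a, π (a + 1)) (InvV n π) := by
  intro p hp
  simp only [InvV, Finset.mem_filter, Finset.mem_insert, mul_sTrans_symm] at hp ⊢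
  obtain ⟨h1, h2, h3⟩ := hp
  by_cases hc : π.symm p.1 = a ∧ π.symm p.2 = a + 1
  · left; ext
    · simp [← hc.1]
    · simp [← hc.2]
  · right
    refine ⟨h1, h2, ?_⟩
    by_contra h4
    have h5 : π.symm p.1 ≠ π.symm p.2 := fun h => by
      have := π.symm.injective h; omega
    have := sTrans_lt_of_lt (a := a) (show π.symm p.1 < π.symm p.2 by omega) hc
    omega

lemma InvV_step' (n : ℕ) (π : Equiv.Perm ℕ) (a : ℕ) (h : ¬ π a < π (a + 1)) :
    InvV n (π * sTrans a) ⊆ InvV n π := by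
  intro p hp
  have := InvV_step n π a hp
  rw [Finset.mem_insert] at this
  rcases this with rfl | h1
  · simp only [InvV, Finset.mem_filter] at hp
    exact absurd hp.2.1 h
  · exact h1

lemma InvV_card_le (n : ℕ) (π : Equiv.Perm ℕ) (w : List ℕ) :
    (InvV n (π * wordProd w)).card ≤ (InvV n π).card + w.length := by
  induction w generalizing π with
  | nil => simp
  | cons a w ih =>
    have h1 := ih (π * sTrans a)
    have h2 := (Finset.card_le_card (InvV_step n π a)).trans (Finset.card_insert_le _ _)
    simp only [wordProd_cons, List.length_cons, ← mul_assoc]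
    omega

lemma InvV_red (n : ℕ) (π : Equiv.Perm ℕ) (w : List ℕ)
    (h : (InvV n π).card + w.length ≤ (InvV n (π * wordProd w)).card) : Red π w := by
  induction w generalizing π with
  | nil => trivial
  | cons a w ih =>
    have h2 := (Finset.card_le_card (InvV_step n π a)).trans (Finset.card_insert_le _ _)
    have h1 := InvV_card_le n (π * sTrans a) w
    simp only [wordProd_cons, List.length_cons, ← mul_assoc] at h
    refine ⟨?_, ih _ (by omega)⟩
    by_contra hc
    have := Finset.card_le_card (InvV_step' n π a hc)
    omega

lemma InvV_one (n : ℕ) : (InvV n 1).card = 0 := by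
  rw [Finset.card_eq_zero]
  ext p
  simp only [InvV, Finset.mem_filter, Finset.notMem_empty, iff_false]
  rintro ⟨_, h1, h2⟩
  change p.2 < p.1 at h2
  omega

lemma InvV_longest (n : ℕ) : n * (n + 1) / 2 ≤ (InvV n (longestPerm n)).card := by
  have h : ((Finset.range (n + 2)).sigma (fun y => Finset.range (y - 1))).card
      = n * (n + 1) / 2 := by
    rw [Finset.card_sigma]
    simp only [Finset.card_range]
    rw [Finset.sum_range_succ']
    simp only [Nat.add_sub_cancel, Finset.sum_range_id]
    simp [mul_comm]
  rw [← h]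
  apply Finset.card_le_card_of_injOn (fun p => (p.2 + 1, p.1))
  · rintro ⟨y, x⟩ hp
    simp only [Finset.mem_coe, Finset.mem_sigma, Finset.mem_range] at hp
    have h0 : x < y - 1 := hp.2
    have : (x + 1, y) ∈ InvV n (longestPerm n) := by
      unfold InvV
      rw [Finset.mem_filter, Finset.mem_product, Finset.mem_range, Finset.mem_range]
      simp only [longestPerm_symm, longestPerm_apply]
      refine ⟨⟨by omega, by omega⟩, by omega, ?_⟩
      split_ifs <;> omega
    exact this
  · rintro ⟨y, x⟩ _ ⟨y', x'⟩ _ h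
    simp at h
    obtain ⟨rfl, rfl⟩ := h
    rfl

lemma IsReduced.red {n : ℕ} {w : List ℕ} (h : IsReduced n w) : Red 1 w := by
  apply InvV_red n
  rw [one_mul, h.2.2, InvV_one, h.1, zero_add]
  exact InvV_longest n

/-! ### Height-indexed trails and the functions `Y` -/

/-- state at height `h` -/
def St (w : List ℕ) (h : ℕ) : Equiv.Perm ℕ := wordProd (w.take h)

/-- letter read at height `h` -/
def lt (w : List ℕ) (h : ℕ) : ℕ := w.getD h 0

lemma St_succ {w : List ℕ} {h : ℕ} (hh : h < w.length) :
    St w (h + 1) = St w h * sTrans (lt w h) := by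
  unfold St lt
  rw [List.take_succ_eq_append_getElem hh, wordProd_append]
  simp [hh]

lemma St_zero (w : List ℕ) : St w 0 = 1 := by simp [St]

lemma St_length (w : List ℕ) : St w w.length = wordProd w := by simp [St]

lemma pr_getD {π : Equiv.Perm ℕ} {w : List ℕ} {h : ℕ} (hh : h < w.length) :
    (pr π w).getD h (0, 0) = ((π * St w h) (lt w h), (π * St w h) (lt w h + 1)) := by
  induction w generalizing π h with
  | nil => simp at hh
  | cons a w ih =>
    cases h with
    | zero => simp [pr, St, lt]
    | succ h =>
      simp only [List.length_cons, Nat.add_lt_add_iff_right] at hh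
      simp only [pr, List.getD_cons_succ]
      rw [ih hh]
      simp [St, lt, mul_assoc]

lemma FT_iff {L : List (ℕ × ℕ)} {F G : Set ℕ} {ds : List ℤ} :
    FT L F G ds ↔ ∃ Fs : ℕ → Set ℕ, Fs 0 = F ∧ Fs L.length = G ∧ ds.length = L.length ∧
      ∀ h < L.length, StepF (L.getD h (0, 0)).1 (L.getD h (0, 0)).2 (Fs h) (Fs (h + 1))
        (ds.getD h 0) := by
  induction L generalizing F ds with
  | nil =>
    rw [FT.nil_iff]
    constructor
    · rintro ⟨rfl, rfl⟩; exact ⟨fun _ => F, rfl, rfl, rfl, by simp⟩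
    · rintro ⟨Fs, rfl, h, h1, -⟩
      exact ⟨h, by simpa using h1⟩
  | cons p L ih =>
    obtain ⟨r, s⟩ := p
    rw [FT.cons_iff]
    constructor
    · rintro ⟨d, ds', H, rfl, hs, t⟩
      obtain ⟨Fs, h0, h1, h2, h3⟩ := ih.1 t
      refine ⟨fun h => if h = 0 then F else Fs (h - 1), by simp, by simp [h1], by simp [h2], ?_⟩
      intro h hh
      cases h with
      | zero => simpa [h0] using hs
      | succ h => simpa using h3 h (by simpa using hh)
    · rintro ⟨Fs, h0, h1, h2, h3⟩
      cases ds with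
      | nil => simp at h2
      | cons d ds =>
        refine ⟨d, ds, Fs 1, rfl, ?_, ?_⟩
        · simpa [h0] using h3 0 (by simp)
        · rw [ih]
          refine ⟨fun h => Fs (h + 1), rfl, by simpa using h1, by simpa using h2, ?_⟩
          intro h hh
          simpa using h3 (h + 1) (by simpa using hh)

/-- height indexed trail of a word -/
def HT (w : List ℕ) (Fs : ℕ → Set ℕ) (d : ℕ → ℤ) : Prop :=
  ∀ h < w.length, StepF (St w h (lt w h)) (St w h (lt w h + 1)) (Fs h) (Fs (h + 1)) (d h)

lemma FT_pr_iff {w : List ℕ} {F G : Set ℕ} {ds : List ℤ} :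
    FT (pr 1 w) F G ds ↔ ∃ Fs : ℕ → Set ℕ, Fs 0 = F ∧ Fs w.length = G ∧ ds.length = w.length ∧
      HT w Fs (fun h => ds.getD h 0) := by
  rw [FT_iff]
  simp only [pr_length]
  refine exists_congr fun Fs => and_congr_right fun _ => and_congr_right fun _ =>
    and_congr_right fun _ => forall_congr' fun h => forall_congr' fun hh => ?_
  rw [pr_getD hh, one_mul]

/-- indicator -/
def ind (p : Prop) : ℤ := if p then 1 else 0

/-- local difference -/
def XX (π : Equiv.Perm ℕ) (F : Set ℕ) (k c : ℕ) : ℤ := ind (π c ∈ F) - ind (π c ≤ k)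

/-- partial sums of the differences -/
def Yp (π : Equiv.Perm ℕ) (F : Set ℕ) (k g : ℕ) : ℤ := ∑ c ∈ Finset.range (g + 1), XX π F k c

lemma Yp_succ (π : Equiv.Perm ℕ) (F : Set ℕ) (k g : ℕ) :
    Yp π F k (g + 1) = Yp π F k g + XX π F k (g + 1) := by
  unfold Yp; rw [Finset.sum_range_succ]

lemma StepF.mem_of_ne {r s : ℕ} {F G : Set ℕ} {d : ℤ} (hs : StepF r s F G d) {x : ℕ}
    (h1 : x ≠ r) (h2 : x ≠ s) : x ∈ G ↔ x ∈ F := by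
  rcases hs with ⟨-, rfl, -⟩ | ⟨-, -, -, rfl⟩ | ⟨-, -, -, rfl⟩
  · rfl
  · simp [h1, h2]
  · simp [h1, h2]

lemma StepF.inds {r s : ℕ} {F G : Set ℕ} {d : ℤ} (hs : StepF r s F G d) (hrs : r ≠ s) :
    (d = 0 ∧ ind (r ∈ G) = ind (r ∈ F) ∧ ind (s ∈ G) = ind (s ∈ F) ∧ ind (s ∈ F) ≤ ind (r ∈ F)) ∨
    (d = 1 ∧ ind (r ∈ F) = 1 ∧ ind (s ∈ F) = 0 ∧ ind (r ∈ G) = 0 ∧ ind (s ∈ G) = 1) ∨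
    (d = -1 ∧ ind (r ∈ F) = 0 ∧ ind (s ∈ F) = 1 ∧ ind (r ∈ G) = 1 ∧ ind (s ∈ G) = 0) := by
  rcases hs with ⟨rfl, rfl, h⟩ | ⟨rfl, h1, h2, rfl⟩ | ⟨rfl, h1, h2, rfl⟩
  · left
    refine ⟨rfl, rfl, rfl, ?_⟩
    unfold ind
    split_ifs <;> simp_all
  · right; left
    simp [ind, h1, h2, hrs]
  · right; right
    simp [ind, h1, h2, hrs.symm]

lemma ind_cases (p : Prop) : ind p = 0 ∨ ind p = 1 := by unfold ind; split_ifs <;> simp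

lemma Ystep_ne {π : Equiv.Perm ℕ} {a k : ℕ} {F G : Set ℕ} {d : ℤ}
    (hs : StepF (π a) (π (a + 1)) F G d) {g : ℕ} (hg : g ≠ a) :
    Yp (π * sTrans a) G k g = Yp π F k g := by
  have hX : ∀ c, c ≠ a → c ≠ a + 1 → XX (π * sTrans a) G k c = XX π F k c := by
    intro c h1 h2
    unfold XX
    rw [Equiv.Perm.mul_apply, sTrans_of_ne h1 h2,
      hs.mem_of_ne (fun h => h1 (π.injective h)) (fun h => h2 (π.injective h))]
  have hlt : ∀ g, g < a → Yp (π * sTrans a) G k g = Yp π F k g := by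
    intro g hg
    unfold Yp
    apply Finset.sum_congr rfl
    intro c hc
    rw [Finset.mem_range] at hc
    apply hX <;> omega
  rcases Nat.lt_or_ge g a with h | h
  · exact hlt g h
  have h0 : Yp (π * sTrans a) G k (a + 1) = Yp π F k (a + 1) := by
    have e1 : XX (π * sTrans a) G k a + XX (π * sTrans a) G k (a + 1)
        = XX π F k a + XX π F k (a + 1) := by
      unfold XX
      simp only [Equiv.Perm.mul_apply, sTrans_left, sTrans_right]
      have := hs.inds (fun h => by have := π.injective h; omega)
      omega
    rw [Yp_succ, Yp_succ]
    rcases Nat.eq_zero_or_pos a with rfl | ha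
    · simp only [Yp, Finset.sum_range_one, zero_add] at e1 ⊢
      exact e1
    · obtain ⟨b, rfl⟩ : ∃ b, a = b + 1 := ⟨a - 1, by omega⟩
      rw [Yp_succ, Yp_succ, hlt b (by omega)]
      omega
  have : ∀ m, Yp (π * sTrans a) G k (a + 1 + m) = Yp π F k (a + 1 + m) := by
    intro m
    induction m with
    | zero => exact h0
    | succ m ih => rw [← add_assoc, Yp_succ, Yp_succ, ih, hX _ (by omega) (by omega)]
  have h3 := this (g - (a + 1))
  rwa [show a + 1 + (g - (a + 1)) = g by omega] at h3

lemma Ystep_aux {π : Equiv.Perm ℕ} {a k : ℕ} {F G : Set ℕ} {d : ℤ} (ha : 1 ≤ a)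
    (hs : StepF (π a) (π (a + 1)) F G d) :
    Yp (π * sTrans a) G k a = Yp π F k (a - 1) + ind (π (a + 1) ∈ G) - ind (π (a + 1) ≤ k) ∧
    Yp π F k a = Yp π F k (a - 1) + ind (π a ∈ F) - ind (π a ≤ k) ∧
    Yp π F k (a + 1) = Yp π F k a + ind (π (a + 1) ∈ F) - ind (π (a + 1) ≤ k) := by
  obtain ⟨b, rfl⟩ : ∃ b, a = b + 1 := ⟨a - 1, by omega⟩
  refine ⟨?_, ?_, ?_⟩
  · rw [Yp_succ, Ystep_ne hs (by omega)]
    unfold XX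
    simp only [Equiv.Perm.mul_apply, sTrans_left, Nat.add_sub_cancel]
    omega
  · rw [Yp_succ]; unfold XX; simp only [Nat.add_sub_cancel]; omega
  · rw [Yp_succ]; unfold XX; omega

lemma Ystep_d {π : Equiv.Perm ℕ} {a : ℕ} (k : ℕ) {F G : Set ℕ} {d : ℤ} (ha : 1 ≤ a)
    (hs : StepF (π a) (π (a + 1)) F G d) :
    d = Yp (π * sTrans a) G k a + Yp π F k a - Yp π F k (a - 1) - Yp π F k (a + 1) := by
  obtain ⟨h1, h2, h3⟩ := Ystep_aux (k := k) ha hs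
  have := hs.inds (fun h => by have := π.injective h; omega)
  omega

lemma ind_le_mono {r s k : ℕ} (h : r < s) : ind (s ≤ k) ≤ ind (r ≤ k) := by
  unfold ind; split_ifs <;> omega

lemma Ystep_nonneg {π : Equiv.Perm ℕ} {a k : ℕ} {F G : Set ℕ} {d : ℤ} (ha : 1 ≤ a)
    (hs : StepF (π a) (π (a + 1)) F G d) (hlt : π a < π (a + 1))
    (h0 : ∀ g, 0 ≤ Yp π F k g) : ∀ g, 0 ≤ Yp (π * sTrans a) G k g := by
  intro g
  by_cases hg : g = a
  · subst hg
    obtain ⟨h1, h2, h3⟩ := Ystep_aux (k := k) ha hs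
    have := hs.inds (fun h => by have := π.injective h; omega)
    have := h0 (g - 1)
    have := h0 g
    have := h0 (g + 1)
    have := ind_le_mono (k := k) hlt
    have := ind_cases (π g ≤ k)
    have := ind_cases (π (g + 1) ≤ k)
    have := ind_cases (π g ∈ F)
    have := ind_cases (π (g + 1) ∈ F)
    omega
  · rw [Ystep_ne hs hg]; exact h0 g

lemma Ystep_upper {π : Equiv.Perm ℕ} {a k : ℕ} {F G : Set ℕ} {d : ℤ} (ha : 1 ≤ a)
    (hs : StepF (π a) (π (a + 1)) F G d) (hlt : π a < π (a + 1)) {M : ℤ}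
    (h0 : ∀ g, Yp (π * sTrans a) G k g ≤ M) : ∀ g, Yp π F k g ≤ M := by
  intro g
  by_cases hg : g = a
  · subst hg
    obtain ⟨h1, h2, h3⟩ := Ystep_aux (k := k) ha hs
    have := hs.inds (fun h => by have := π.injective h; omega)
    have h4 := h0 (g - 1)
    rw [Ystep_ne hs (by omega)] at h4
    have := h0 g
    have h5 := h0 (g + 1)
    rw [Ystep_ne hs (by omega)] at h5
    have := ind_le_mono (k := k) hlt
    have := ind_cases (π g ≤ k)
    have := ind_cases (π (g + 1) ≤ k)
    have := ind_cases (π g ∈ F)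
    have := ind_cases (π (g + 1) ∈ F)
    omega
  · have := h0 g; rwa [Ystep_ne hs hg] at this

/-- `Y` at height `h` -/
def Yc (w : List ℕ) (k : ℕ) (Fs : ℕ → Set ℕ) (h g : ℕ) : ℤ := Yp (St w h) (Fs h) k g

lemma Yp_Iic (π : Equiv.Perm ℕ) (k g : ℕ) : Yp π (Set.Iic k) k g = 0 := by
  unfold Yp XX; simp

lemma Red.lt_at {w : List ℕ} (h : Red 1 w) {j : ℕ} (hj : j < w.length) :
    St w j (lt w j) < St w j (lt w j + 1) := by
  have h1 := h.pr_lt ((pr 1 w).getD j (0, 0)) (by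
    rw [List.getD_eq_getElem _ _ (by rw [pr_length]; exact hj)]
    exact List.getElem_mem _)
  rw [pr_getD hj, one_mul] at h1
  exact h1

lemma lt_mem {w : List ℕ} {j : ℕ} (hj : j < w.length) : lt w j ∈ w := by
  unfold lt
  rw [List.getD_eq_getElem _ _ hj]
  exact List.getElem_mem _

lemma IsReduced.letter {n : ℕ} {w : List ℕ} (h : IsReduced n w) {j : ℕ} (hj : j < w.length) :
    1 ≤ lt w j ∧ lt w j ≤ n := h.2.1 _ (lt_mem hj)

lemma HT.Yc_nonneg {n : ℕ} {w : List ℕ} (hw : IsReduced n w) {Fs : ℕ → Set ℕ} {d : ℕ → ℤ} {k : ℕ}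
    (h : HT w Fs d) (h0 : Fs 0 = Set.Iic k) {j : ℕ} (hj : j ≤ w.length) :
    ∀ g, 0 ≤ Yc w k Fs j g := by
  induction j with
  | zero => intro g; unfold Yc; rw [h0, Yp_Iic]
  | succ j ih =>
    have hj' : j < w.length := hj
    have := Ystep_nonneg (k := k) (hw.letter hj').1 (h j hj') (hw.red.lt_at hj')
      (ih hj'.le)
    unfold Yc
    rwa [St_succ hj']

lemma HT.Yc_upper {n : ℕ} {w : List ℕ} (hw : IsReduced n w) {Fs : ℕ → Set ℕ} {d : ℕ → ℤ} {k : ℕ}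
    (h : HT w Fs d) {M : ℤ} (h0 : ∀ g, Yc w k Fs w.length g ≤ M) {j : ℕ} (hj : j ≤ w.length) :
    ∀ g, Yc w k Fs j g ≤ M := by
  induction hj using Nat.decreasingInduction with
  | self => exact h0
  | of_succ j hj' ih =>
    unfold Yc at ih
    rw [St_succ hj'] at ih
    exact Ystep_upper (k := k) (hw.letter hj').1 (h j hj') (hw.red.lt_at hj') ih

lemma Yp_End {n k : ℕ} (h1 : 1 ≤ k) (h2 : k ≤ n) (g : ℕ) :
    Yp (longestPerm n) (EndS k) k g = if g = n + 1 - k then 1 else 0 := by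
  have hX : ∀ c, XX (longestPerm n) (EndS k) k c
      = if c = n + 1 - k then 1 else if c = n + 2 - k then -1 else 0 := by
    intro c
    unfold XX ind EndS
    simp only [longestPerm_apply, Set.mem_ofPred_eq]
    split_ifs <;> omega
  induction g with
  | zero =>
    unfold Yp
    simp only [zero_add, Finset.sum_range_one, hX]
    split_ifs <;> omega
  | succ g ih =>
    rw [Yp_succ, ih, hX]
    split_ifs <;> omega

lemma eq_Iic_of_Yp {π : Equiv.Perm ℕ} {F : Set ℕ} {k : ℕ} (h : ∀ g, Yp π F k g = 0) :
    F = Set.Iic k := by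
  have hX : ∀ c, XX π F k c = 0 := by
    intro c
    cases c with
    | zero => have := h 0; unfold Yp at this; simpa using this
    | succ c =>
      have h1 := h (c + 1)
      rw [Yp_succ, h c] at h1
      omega
  ext x
  have := hX (π.symm x)
  unfold XX ind at this
  rw [Equiv.apply_symm_apply] at this
  rw [Set.mem_Iic]
  split_ifs at this <;> simp_all

lemma HT.base {n : ℕ} {w : List ℕ} (hw : IsReduced n w) {Fs : ℕ → Set ℕ} {d : ℕ → ℤ} {k : ℕ}
    (h : HT w Fs d) (h0 : Fs 0 = Set.Iic k) (h1 : Fs w.length = Set.Iic k) {j : ℕ}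
    (hj : j ≤ w.length) : Fs j = Set.Iic k := by
  apply eq_Iic_of_Yp (π := St w j)
  intro g
  have e1 := h.Yc_nonneg hw h0 hj g
  have e2 := h.Yc_upper (k := k) hw (M := 0) (by intro g; unfold Yc; rw [h1, Yp_Iic]) hj g
  unfold Yc at e1 e2
  omega

lemma Yp_eq_imp {π : Equiv.Perm ℕ} {F G : Set ℕ} {k : ℕ} (h : ∀ g, Yp π F k g = Yp π G k g) :
    F = G := by
  have hX : ∀ c, XX π F k c = XX π G k c := by
    intro c
    cases c with
    | zero => have := h 0; unfold Yp at this; simpa using this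
    | succ c =>
      have h1 := h (c + 1)
      rw [Yp_succ, Yp_succ, h c] at h1
      omega
  ext x
  have := hX (π.symm x)
  unfold XX ind at this
  rw [Equiv.apply_symm_apply] at this
  split_ifs at this <;> simp_all

/-! ### Linear functionals separating trail vectors -/

/-- the vector of a trail -/
def vec (N : ℕ) (ds : List ℤ) : Fin N → ℝ := fun j => ((ds.getD j 0 : ℤ) : ℝ)

lemma vec_inj {N : ℕ} {ds ds' : List ℤ} (h1 : ds.length = N) (h2 : ds'.length = N)
    (h : vec N ds = vec N ds') : ds = ds' := by
  apply List.ext_getElem (h1.trans h2.symm)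
  intro i hi hi'
  have := congrFun h ⟨i, by omega⟩
  simp only [vec, Int.cast_inj] at this
  rwa [List.getD_eq_getElem _ _ hi, List.getD_eq_getElem _ _ hi'] at this

/-- the functionals computing `Y` from the trail vector -/
def YL (w : List ℕ) (N : ℕ) : ℕ → ℕ → ((Fin N → ℝ) →ₗ[ℝ] ℝ)
  | 0, _ => 0
  | h + 1, g =>
    if g = lt w h then
      (if hh : h < N then LinearMap.proj ⟨h, hh⟩ else 0) - YL w N h g + YL w N h (g - 1)
        + YL w N h (g + 1)
    else YL w N h g

lemma YL_eq {n : ℕ} {w : List ℕ} (hw : IsReduced n w) {k : ℕ} {Fs : ℕ → Set ℕ} {ds : List ℤ}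
    (h : HT w Fs (fun h => ds.getD h 0)) (h0 : Fs 0 = Set.Iic k) {N : ℕ} (hN : w.length = N)
    {j : ℕ} (hj : j ≤ N) (g : ℕ) : YL w N j g (vec N ds) = (Yc w k Fs j g : ℝ) := by
  induction j generalizing g with
  | zero => unfold Yc YL; rw [h0, Yp_Iic]; simp
  | succ j ih =>
    have hj' : j < w.length := by omega
    have ih' := ih (by omega)
    unfold YL
    by_cases hg : g = lt w j
    · rw [if_pos hg, dif_pos (show j < N by omega)]
      simp only [LinearMap.add_apply, LinearMap.sub_apply, LinearMap.proj_apply, ih']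
      have hd := Ystep_d k (hw.letter hj').1 (h j hj')
      have hd' : ((ds.getD j 0 : ℤ) : ℝ) = _ := congrArg (Int.cast : ℤ → ℝ) hd
      unfold vec Yc
      simp only []
      rw [hd', St_succ hj', hg]
      push_cast
      ring
    · rw [if_neg hg, ih']
      unfold Yc
      rw [St_succ hj', Ystep_ne (h j hj') hg]

lemma DL_iff {n : ℕ} {w : List ℕ} {ds : List ℤ} :
    ds ∈ DL n w ↔ ∃ k, 1 ≤ k ∧ k ≤ n ∧ ∃ Fs : ℕ → Set ℕ, Fs 0 = Set.Iic k ∧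
      Fs w.length = EndS k ∧ ds.length = w.length ∧ HT w Fs (fun h => ds.getD h 0) := by
  unfold DL
  simp only [Set.mem_ofPred_eq, FT_pr_iff]

lemma DL_length {n : ℕ} {w : List ℕ} {ds : List ℤ} (h : ds ∈ DL n w) : ds.length = w.length := by
  obtain ⟨k, -, -, Fs, -, -, h, -⟩ := DL_iff.1 h; exact h

lemma StepF.d_mem {r s : ℕ} {F G : Set ℕ} {d : ℤ} (h : StepF r s F G d) :
    d = 0 ∨ d = 1 ∨ d = -1 := by
  rcases h with ⟨h, -⟩ | ⟨h, -⟩ | ⟨h, -⟩ <;> simp [h]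

lemma DL_finite (n : ℕ) (w : List ℕ) : (DL n w).Finite := by
  apply Set.Finite.of_finite_image (f := vec w.length)
  · apply Set.Finite.subset (Set.Finite.pi (fun _ : Fin w.length =>
      (Set.finite_singleton (0 : ℝ)).union ((Set.finite_singleton (1 : ℝ)).union
        (Set.finite_singleton (-1 : ℝ)))))
    rintro _ ⟨ds, hds, rfl⟩
    rw [Set.mem_univ_pi]
    intro j
    obtain ⟨k, -, -, Fs, -, -, -, h⟩ := DL_iff.1 hds
    have h1 : ds.getD j 0 = 0 ∨ ds.getD j 0 = 1 ∨ ds.getD j 0 = -1 := (h j j.2).d_mem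
    simp only [Set.mem_union, Set.mem_singleton_iff, vec]
    rcases h1 with h | h | h <;> rw [h] <;> simp
  · intro ds h ds' h' he
    exact vec_inj (DL_length h) (DL_length h') he

/-- all `Y` values of trails are `0` or `1` -/
lemma HT.Yc01 {n : ℕ} {w : List ℕ} (hw : IsReduced n w) {Fs : ℕ → Set ℕ} {d : ℕ → ℤ} {k : ℕ}
    (hk1 : 1 ≤ k) (hk2 : k ≤ n)
    (h : HT w Fs d) (h0 : Fs 0 = Set.Iic k) (h1 : Fs w.length = EndS k) {j : ℕ}
    (hj : j ≤ w.length) (g : ℕ) : Yc w k Fs j g = 0 ∨ Yc w k Fs j g = 1 := by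
  have e1 := h.Yc_nonneg hw h0 hj g
  have e2 := h.Yc_upper (k := k) hw (M := 1) (by
    intro g; unfold Yc; rw [h1, St_length, hw.2.2, Yp_End hk1 hk2]; split_ifs <;> omega) hj g
  omega

lemma Yc_eq_of {w : List ℕ} {k : ℕ} {Fs Fs' : ℕ → Set ℕ}
    {d d' : ℕ → ℤ} (h : HT w Fs d) (h' : HT w Fs' d') (h0 : Fs 0 = Set.Iic k)
    (h0' : Fs' 0 = Set.Iic k)
    (he : ∀ j < w.length, Yc w k Fs (j + 1) (lt w j) = Yc w k Fs' (j + 1) (lt w j)) :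
    ∀ j ≤ w.length, ∀ g, Yc w k Fs j g = Yc w k Fs' j g := by
  intro j hj
  induction j with
  | zero => intro g; unfold Yc; rw [h0, h0']
  | succ j ih =>
    intro g
    have hj' : j < w.length := hj
    by_cases hg : g = lt w j
    · rw [hg]; exact he j hj'
    · have := ih hj'.le g
      unfold Yc at this ⊢
      rw [St_succ hj', Ystep_ne (h j hj') hg, Ystep_ne (h' j hj') hg]
      exact this

lemma d_eq_of {n : ℕ} {w : List ℕ} (hw : IsReduced n w) {k : ℕ} {Fs Fs' : ℕ → Set ℕ}
    {d d' : ℕ → ℤ} (h : HT w Fs d) (h' : HT w Fs' d')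
    (he : ∀ j ≤ w.length, ∀ g, Yc w k Fs j g = Yc w k Fs' j g) :
    ∀ j < w.length, d j = d' j := by
  intro j hj
  rw [Ystep_d k (hw.letter hj).1 (h j hj), Ystep_d k (hw.letter hj).1 (h' j hj)]
  have e1 := he j hj.le
  have e2 := he (j + 1) hj (lt w j)
  unfold Yc at e1 e2
  rw [St_succ hj] at e2
  rw [e1, e1, e1, e2]

lemma Yc_end {n : ℕ} {w : List ℕ} (hw : IsReduced n w) {k : ℕ} {Fs : ℕ → Set ℕ}
    (hk1 : 1 ≤ k) (hk2 : k ≤ n) (h1 : Fs w.length = EndS k) (g : ℕ) :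
    Yc w k Fs w.length g = if g = n + 1 - k then 1 else 0 := by
  unfold Yc; rw [h1, St_length, hw.2.2, Yp_End hk1 hk2]

lemma sep_star {n : ℕ} {w : List ℕ} (hw : IsReduced n w) {N : ℕ} (hN : w.length = N) :
    ∃ Ψ : (Fin N → ℝ) →ₗ[ℝ] ℝ, ∀ ds ∈ DL n w, 0 < Ψ (vec N ds) := by
  refine ⟨∑ g ∈ Finset.Icc 1 n, YL w N N g, ?_⟩
  intro ds hds
  obtain ⟨k, hk1, hk2, Fs, h0, h1, hl, h⟩ := DL_iff.1 hds
  rw [LinearMap.sum_apply]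
  simp only [YL_eq hw h h0 hN le_rfl]
  subst hN
  simp only [Yc_end hw hk1 hk2 h1]
  push_cast
  rw [Finset.sum_ite_eq' , if_pos]
  · norm_num
  · rw [Finset.mem_Icc]; omega

lemma sep_zero {n : ℕ} {w : List ℕ} (hw : IsReduced n w) {N : ℕ} (hN : w.length = N)
    {ds0 : List ℤ} (hds0 : ds0 ∈ DL n w) :
    ∃ Ψ : (Fin N → ℝ) →ₗ[ℝ] ℝ, Ψ (vec N ds0) = 0 ∧
      ∀ ds ∈ DL n w, ds ≠ ds0 → 0 < Ψ (vec N ds) := by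
  obtain ⟨k0, hk1, hk2, Fs0, h0, h1, hl, h⟩ := DL_iff.1 hds0
  let y0 : ℕ → ℝ := fun j => (Yc w k0 Fs0 (j + 1) (lt w j) : ℝ)
  let S : ℝ := ∑ j ∈ Finset.range N, y0 j
  have hy0 : ∀ j < N, y0 j = 0 ∨ y0 j = 1 := by
    intro j hj
    rcases h.Yc01 hw hk1 hk2 h0 h1 (show j + 1 ≤ w.length by omega) (lt w j) with e | e
    · left; simp [y0, e]
    · right; simp [y0, e]
  let Ψ : (Fin N → ℝ) →ₗ[ℝ] ℝ :=
    ∑ j ∈ Finset.range N, (1 - 2 * y0 j) • YL w N (j + 1) (lt w j)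
    + ∑ g ∈ Finset.Icc 1 n, (if g = n + 1 - k0 then S else S + 1) • YL w N N g
  have key : ∀ ds ∈ DL n w, ∃ k Fs, 1 ≤ k ∧ k ≤ n ∧ Fs 0 = Set.Iic k ∧ Fs w.length = EndS k ∧
      HT w Fs (fun h => ds.getD h 0) ∧ Ψ (vec N ds) =
        ∑ j ∈ Finset.range N, (1 - 2 * y0 j) * (Yc w k Fs (j + 1) (lt w j) : ℝ)
        + (if k = k0 then S else S + 1) := by
    intro ds hds
    obtain ⟨k, hk1', hk2', Fs, h0', h1', hl', h'⟩ := DL_iff.1 hds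
    refine ⟨k, Fs, hk1', hk2', h0', h1', h', ?_⟩
    simp only [Ψ, LinearMap.add_apply, LinearMap.sum_apply, LinearMap.smul_apply, smul_eq_mul]
    congr 1
    · apply Finset.sum_congr rfl
      intro j hj
      rw [Finset.mem_range] at hj
      rw [YL_eq hw h' h0' hN (by omega)]
    · simp only [YL_eq hw h' h0' hN le_rfl]
      subst hN
      simp only [Yc_end hw hk1' hk2' h1']
      push_cast
      simp only [mul_ite, mul_one, mul_zero]
      rw [Finset.sum_ite_eq', if_pos (by rw [Finset.mem_Icc]; omega)]
      split_ifs <;> first | rfl | omega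
  refine ⟨Ψ, ?_, ?_⟩
  · obtain ⟨k, Fs, a1, a2, a3, a4, a5, a6⟩ := key ds0 hds0
    rw [a6]
    have hkk : k = k0 := by
      have e1 := YL_eq hw a5 a3 hN le_rfl (n + 1 - k)
      have e2 := YL_eq hw h h0 hN le_rfl (n + 1 - k)
      rw [e1] at e2
      subst hN
      rw [Yc_end hw hk1 hk2 h1, Yc_end hw a1 a2 a4] at e2
      simp only [if_true] at e2
      split_ifs at e2 with hh
      · omega
      · simp at e2
    subst hkk
    rw [if_pos rfl, ← Finset.sum_add_distrib]
    apply Finset.sum_eq_zero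
    intro j hj
    rw [Finset.mem_range] at hj
    have e1 := YL_eq hw a5 a3 hN (show j + 1 ≤ N by omega) (lt w j)
    have e2 := YL_eq hw h h0 hN (show j + 1 ≤ N by omega) (lt w j)
    rw [e1] at e2
    rw [e2]
    change (1 - 2 * y0 j) * y0 j + y0 j = 0
    rcases hy0 j hj with e | e <;> rw [e] <;> norm_num
  · intro ds hds hne
    obtain ⟨k, Fs, a1, a2, a3, a4, a5, a6⟩ := key ds hds
    rw [a6]
    have hy : ∀ j < N, (Yc w k Fs (j + 1) (lt w j) : ℝ) = 0 ∨
        (Yc w k Fs (j + 1) (lt w j) : ℝ) = 1 := by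
      intro j hj
      rcases a5.Yc01 hw a1 a2 a3 a4 (show j + 1 ≤ w.length by omega) (lt w j) with e | e
      · left; simp [e]
      · right; simp [e]
    have hterm : ∀ j ∈ Finset.range N,
        0 ≤ (1 - 2 * y0 j) * (Yc w k Fs (j + 1) (lt w j) : ℝ) + y0 j := by
      intro j hj
      rw [Finset.mem_range] at hj
      rcases hy0 j hj with e | e <;> rcases hy j hj with e' | e' <;> rw [e, e'] <;> norm_num
    by_cases hkk : k = k0
    · rw [if_pos hkk, ← Finset.sum_add_distrib]
      apply Finset.sum_pos' hterm
      by_contra hc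
      push Not at hc
      apply hne
      subst hkk
      apply vec_inj ((DL_length hds).trans hN) (hl.trans hN)
      funext j
      unfold vec
      rw [Int.cast_inj]
      apply d_eq_of hw a5 h (Yc_eq_of a5 h a3 h0 ?_) j (by have := j.2; omega)
      intro j hj
      have e0 := hc j (by rw [Finset.mem_range]; omega)
      have : (Yc w k Fs (j + 1) (lt w j) : ℝ) = y0 j := by
        rcases hy0 j (by omega) with e | e <;> rcases hy j (by omega) with e' | e' <;>
          rw [e, e'] at e0 <;> rw [e, e'] <;> norm_num at e0
      simp only [y0] at this
      exact_mod_cast this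
    · rw [if_neg hkk, ← add_assoc, ← Finset.sum_add_distrib]
      have := Finset.sum_nonneg hterm
      linarith

/-! ### Polyhedral cones -/

/-- dot product -/
def dt {m : ℕ} (v t : Fin m → ℝ) : ℝ := ∑ j, v j * t j

/-- cone with given normals -/
def coneOf {m : ℕ} (V : Set (Fin m → ℝ)) : Set (Fin m → ℝ) := {t | ∀ v ∈ V, 0 ≤ dt v t}

lemma dt_add {m : ℕ} (v s t : Fin m → ℝ) : dt v (s + t) = dt v s + dt v t := by
  simp [dt, mul_add, Finset.sum_add_distrib]

lemma dt_smul {m : ℕ} (v t : Fin m → ℝ) (c : ℝ) : dt v (c • t) = c * dt v t := by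
  simp only [dt, Finset.mul_sum, Pi.smul_apply, smul_eq_mul]
  exact Finset.sum_congr rfl fun j _ => by ring

lemma dt_continuous {m : ℕ} (v : Fin m → ℝ) : Continuous (dt v) := by
  unfold dt; fun_prop

lemma dt_sum {m : ℕ} {ι : Type*} (s : Finset ι) (v : Fin m → ℝ) (f : ι → Fin m → ℝ) :
    dt v (∑ i ∈ s, f i) = ∑ i ∈ s, dt v (f i) := by
  induction s using Finset.induction_on with
  | empty => simp [dt]
  | insert a s ha ih => rw [Finset.sum_insert ha, Finset.sum_insert ha, dt_add, ih]

lemma coneOf_interior {m : ℕ} {V : Set (Fin m → ℝ)} (hV : V.Finite)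
    (h : ∃ t, ∀ v ∈ V, 0 < dt v t) : (interior (coneOf V)).Nonempty := by
  obtain ⟨t, ht⟩ := h
  refine ⟨t, ?_⟩
  rw [mem_interior]
  refine ⟨⋂ v ∈ V, {t | 0 < dt v t}, ?_, ?_, ?_⟩
  · intro s hs v hv
    simp only [Set.mem_iInter] at hs
    exact (hs v hv).le
  · exact hV.isOpen_biInter fun v _ => isOpen_lt continuous_const (dt_continuous v)
  · simp only [Set.mem_iInter]
    exact fun v hv => ht v hv

lemma coneOf_numFacets {m : ℕ} {V : Set (Fin m → ℝ)} (hV : V.Finite) (hne : V.Nonempty)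
    (h : ∃ t, ∀ v ∈ V, 0 < dt v t)
    (h0 : ∀ v0 ∈ V, ∃ t, dt v0 t = 0 ∧ ∀ v ∈ V, v ≠ v0 → 0 < dt v t) :
    numFacets (coneOf V) = V.ncard := by
  obtain ⟨ts, hts⟩ := h
  let Fc : (Fin m → ℝ) → Set (Fin m → ℝ) := fun v => {t | t ∈ coneOf V ∧ dt v t = 0}
  have hface : ∀ v ∈ V, IsFaceSet (coneOf V) (Fc v) := by
    intro v hv
    constructor
    · rw [isExtreme_iff]
      refine ⟨fun t ht => ht.1, ?_⟩
      rintro x hx y hy z hz ⟨a, b, ha, hb, hab, rfl⟩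
      refine ⟨hx, ?_⟩
      have h1 := hz.2
      rw [dt_add, dt_smul, dt_smul] at h1
      have h2 := hx v hv
      have h3 := hy v hv
      nlinarith [mul_nonneg ha.le h2, mul_nonneg hb.le h3]
    · intro x hx y hy a b ha hb hab
      refine ⟨?_, ?_⟩
      · intro u hu
        rw [dt_add, dt_smul, dt_smul]
        have h2 := hx.1 u hu
        have h3 := hy.1 u hu
        positivity
      · rw [dt_add, dt_smul, dt_smul, hx.2, hy.2]; simp
  have hts' : ts ∈ coneOf V := fun v hv => (hts v hv).le
  have hproper : ∀ v ∈ V, Fc v ≠ coneOf V := by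
    intro v hv he
    rw [← he] at hts'
    have := hts v hv
    linarith [hts'.2]
  have hsub : ∀ G, IsFaceSet (coneOf V) G → G ≠ coneOf V → ∃ v ∈ V, G ⊆ Fc v := by
    intro G hG hne'
    by_contra hc
    push Not at hc
    have hGs : G ⊆ coneOf V := hG.1.1
    have hex : ∀ v ∈ V, ∃ g ∈ G, 0 < dt v g := by
      intro v hv
      obtain ⟨g, hg, hg'⟩ := Set.not_subset.1 (hc v hv)
      refine ⟨g, hg, lt_of_le_of_ne (hGs hg v hv) ?_⟩
      intro he
      exact hg' ⟨hGs hg, he.symm⟩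
    choose! gg hgg hgp using hex
    apply hne'
    apply Set.Subset.antisymm hGs
    intro x hx
    have hcard : 0 < hV.toFinset.card := by
      rw [Finset.card_pos]
      exact hV.toFinset_nonempty.2 hne
    have hcR : (0 : ℝ) < hV.toFinset.card := by exact_mod_cast hcard
    set gb : Fin m → ℝ := ∑ v ∈ hV.toFinset, ((hV.toFinset.card : ℝ)⁻¹) • gg v with hgb
    have hgbG : gb ∈ G := by
      apply hG.2.sum_mem
      · intro i _; positivity
      · rw [Finset.sum_const, nsmul_eq_mul]; field_simp
      · intro i hi; exact hgg i (hV.mem_toFinset.1 hi)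
    have hgbp : ∀ v ∈ V, 0 < dt v gb := by
      intro v hv
      rw [hgb, dt_sum]
      apply Finset.sum_pos'
      · intro i hi
        rw [dt_smul]
        have := hGs (hgg i (hV.mem_toFinset.1 hi)) v hv
        positivity
      · refine ⟨v, hV.mem_toFinset.2 hv, ?_⟩
        rw [dt_smul]
        have := hgp v hv
        positivity
    have hev : ∀ᶠ e in nhdsWithin (0 : ℝ) (Set.Ioi 0), ∀ v ∈ V,
        0 < dt v (gb + e • (gb + (-1 : ℝ) • x)) := by
      rw [Filter.eventually_all_finite hV]
      intro v hv
      apply Filter.Eventually.filter_mono nhdsWithin_le_nhds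
      have hcont : Continuous fun e : ℝ => dt v (gb + e • (gb + (-1 : ℝ) • x)) := by
        unfold dt
        fun_prop
      have := hcont.tendsto 0
      simp only [zero_smul, add_zero] at this
      exact this.eventually (lt_mem_nhds (hgbp v hv))
    obtain ⟨e, he, he0⟩ := (hev.and self_mem_nhdsWithin).exists
    have he0' : 0 < e := he0
    have hy : gb + e • (gb + (-1 : ℝ) • x) ∈ coneOf V := fun v hv => (he v hv).le
    have hext := hG.1.2
    refine hext hx hy hgbG ?_
    refine ⟨e / (1 + e), 1 / (1 + e), by positivity, by positivity, by field_simp; ring, ?_⟩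
    ext i
    simp only [Pi.add_apply, Pi.smul_apply, smul_eq_mul]
    field_simp
    ring
  have hinj : Set.InjOn Fc V := by
    intro v hv v' hv' he
    by_contra hne'
    obtain ⟨t, ht1, ht2⟩ := h0 v hv
    have h1 : t ∈ Fc v := ⟨fun u hu => by
      by_cases h : u = v
      · rw [h, ht1]
      · exact (ht2 u hu h).le, ht1⟩
    rw [he] at h1
    have := ht2 v' hv' (Ne.symm hne')
    linarith [h1.2]
  have hmono : ∀ v ∈ V, ∀ v' ∈ V, Fc v ⊆ Fc v' → v = v' := by
    intro v hv v' hv' he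
    by_contra hne'
    obtain ⟨t, ht1, ht2⟩ := h0 v hv
    have h1 : t ∈ Fc v := ⟨fun u hu => by
      by_cases h : u = v
      · rw [h, ht1]
      · exact (ht2 u hu h).le, ht1⟩
    have h2 := he h1
    have := ht2 v' hv' (Ne.symm hne')
    linarith [h2.2]
  have heq : {F | IsFacet (coneOf V) F} = Fc '' V := by
    ext F
    constructor
    · rintro ⟨h1, h2, h3⟩
      obtain ⟨v, hv, hs⟩ := hsub F h1 h2
      exact ⟨v, hv, (h3 _ (hface v hv) (hproper v hv) hs).symm⟩
    · rintro ⟨v, hv, rfl⟩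
      refine ⟨hface v hv, hproper v hv, ?_⟩
      intro G hG hG' hs
      obtain ⟨v', hv', hs'⟩ := hsub G hG hG'
      have := hmono v hv v' hv' (hs.trans hs')
      subst this
      exact Set.Subset.antisymm hs hs'
  unfold numFacets
  rw [heq, hinj.ncard_image]

/-! ### Completing trails -/

/-- the set `[1,k]` with `q` replaced by `p` -/
def Fqp (k q p : ℕ) : Set ℕ := {x | (x ≤ k ∧ x ≠ q) ∨ x = p}

lemma mem_Fqp {k q p x : ℕ} : x ∈ Fqp k q p ↔ (x ≤ k ∧ x ≠ q) ∨ x = p := Iff.rfl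

lemma mem_EndS {k x : ℕ} : x ∈ EndS k ↔ x < k ∨ x = k + 1 := Iff.rfl

lemma Fqp_eq_End (k : ℕ) : Fqp k k (k + 1) = EndS k := by
  ext x; rw [mem_Fqp, mem_EndS]; omega

lemma eq_iff_pos (π : Equiv.Perm ℕ) (a x : ℕ) : π a = x ↔ π.symm x = a := by
  rw [Equiv.symm_apply_eq]; exact eq_comm

lemma completion {n k : ℕ} (hk1 : 1 ≤ k) (hk2 : k ≤ n) {w : List ℕ} :
    ∀ {π : Equiv.Perm ℕ} {q p : ℕ}, Red π w → π * wordProd w = longestPerm n →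
    q ≤ k → k < p → π.symm p < π.symm q → π.symm q ≤ π.symm k →
    π.symm (k + 1) ≤ π.symm p → ∃ ds, FT (pr π w) (Fqp k q p) (EndS k) ds := by
  induction w with
  | nil =>
    intro π q p hR hend hq hp h1 h2 h3
    simp only [wordProd_nil, mul_one] at hend
    subst hend
    simp only [longestPerm_symm, longestPerm_apply] at h1 h2 h3
    have hq' : q = k := by split_ifs at h1 h2 h3 <;> omega
    have hp' : p = k + 1 := by split_ifs at h1 h2 h3 <;> omega
    subst hq' hp'
    exact ⟨[], by rw [Fqp_eq_End]; exact FT.nil _⟩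
  | cons a w ih =>
    intro π q p hR hend hq hp h1 h2 h3
    have hlt := hR.1
    have hend' : π * sTrans a * wordProd w = longestPerm n := by
      rw [mul_assoc, ← wordProd_cons, hend]
    have ipos : ∀ x y, π.symm x = π.symm y ↔ x = y := fun x y => π.symm.injective.eq_iff
    have rpos : π.symm (π a) = a := by simp
    have spos : π.symm (π (a + 1)) = a + 1 := by simp
    have fq1 := eq_iff_pos π a q
    have fq2 := eq_iff_pos π (a + 1) q
    have fp1 := eq_iff_pos π a p
    have fp2 := eq_iff_pos π (a + 1) p
    have fk1 := eq_iff_pos π a k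
    have fk2 := eq_iff_pos π (a + 1) k
    have fl1 := eq_iff_pos π a (k + 1)
    have fl2 := eq_iff_pos π (a + 1) (k + 1)
    have gqk := ipos q k
    have gpl := ipos p (k + 1)
    -- generic continuation
    have go : ∀ (q' p' : ℕ) (d : ℤ), StepF (π a) (π (a + 1)) (Fqp k q p) (Fqp k q' p') d →
        q' ≤ k → k < p' → sTrans a (π.symm p') < sTrans a (π.symm q') →
        sTrans a (π.symm q') ≤ sTrans a (π.symm k) →
        sTrans a (π.symm (k + 1)) ≤ sTrans a (π.symm p') →
        ∃ ds, FT (pr π (a :: w)) (Fqp k q p) (EndS k) ds := by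
      intro q' p' d hs e1 e2 e3 e4 e5
      obtain ⟨ds, hds⟩ := ih (π := π * sTrans a) (q := q') (p := p') hR.2 hend' e1 e2
        (by simpa only [mul_sTrans_symm] using e3) (by simpa only [mul_sTrans_symm] using e4)
        (by simpa only [mul_sTrans_symm] using e5)
      exact ⟨d :: ds, FT.cons hs hds⟩
    by_cases c1 : π a = q ∧ π (a + 1) ≤ k
    · apply go (π (a + 1)) p (-1) (Or.inr (Or.inr ⟨rfl, ?_, ?_, ?_⟩))
      · omega
      · omega
      · rw [spos]; simp only [sTrans_apply]; split_ifs <;> omega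
      · rw [spos]; simp only [sTrans_apply]; split_ifs <;> omega
      · simp only [sTrans_apply]; split_ifs <;> omega
      · rw [mem_Fqp]; omega
      · rw [mem_Fqp]; omega
      · ext x; simp only [mem_Fqp, Set.mem_insert_iff, Set.mem_sdiff, Set.mem_singleton_iff]; omega
    by_cases c2 : π (a + 1) = p ∧ k < π a
    · apply go q (π a) (-1) (Or.inr (Or.inr ⟨rfl, ?_, ?_, ?_⟩))
      · omega
      · omega
      · rw [rpos]; simp only [sTrans_apply]; split_ifs <;> omega
      · simp only [sTrans_apply]; split_ifs <;> omega
      · rw [rpos]; simp only [sTrans_apply]; split_ifs <;> omega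
      · rw [mem_Fqp]; omega
      · rw [mem_Fqp]; omega
      · ext x; simp only [mem_Fqp, Set.mem_insert_iff, Set.mem_sdiff, Set.mem_singleton_iff]; omega
    apply go q p 0 (Or.inl ⟨rfl, rfl, ?_⟩) hq hp
    · simp only [sTrans_apply]; split_ifs <;> omega
    · simp only [sTrans_apply]; split_ifs <;> omega
    · simp only [sTrans_apply]; split_ifs <;> omega
    · rw [mem_Fqp, mem_Fqp]; omega

lemma base_follow {π : Equiv.Perm ℕ} {w : List ℕ} (h : Red π w) (k : ℕ) :
    FT (pr π w) (Set.Iic k) (Set.Iic k) (List.replicate w.length 0) := by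
  have := FT.follow (L := pr π w) (F := Set.Iic k) (by
    intro p hp h1
    have := h.pr_lt p hp
    rw [Set.mem_Iic] at *
    omega)
  rwa [pr_length] at this

/-- between `r` and `s` there is a descent -/
lemma exists_k {P : ℕ → Prop} {r s : ℕ} (hrs : r < s) (hr : P r) (hs : ¬ P s) :
    ∃ k, r ≤ k ∧ k < s ∧ P k ∧ ¬ P (k + 1) := by
  induction s, hrs using Nat.le_induction with
  | base => exact ⟨r, le_rfl, by omega, hr, hs⟩
  | succ s hs' ih =>
    by_cases h : P s
    · exact ⟨s, by omega, by omega, h, hs⟩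
    · obtain ⟨k, h1, h2, h3, h4⟩ := ih h
      exact ⟨k, h1, by omega, h3, h4⟩

/-- leading position -/
def Lead (j : ℕ) (ds : List ℤ) : Prop := ∃ e, ds = List.replicate j 0 ++ 1 :: e

/-- trail deviating first at a node, with chosen `k` -/
lemma trail_from {n : ℕ} {u v : List ℕ} {a k : ℕ} (hw : IsReduced n (u ++ a :: v))
    (hk1 : 1 ≤ k) (hk2 : k ≤ n)
    (hr : wordProd u a ≤ k) (hs : k < wordProd u (a + 1))
    {ds : List ℤ} (h : FT (pr (wordProd u * sTrans a) v) (Fqp k (wordProd u a) (wordProd u (a + 1)))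
      (EndS k) ds) :
    (List.replicate u.length 0 ++ 1 :: ds) ∈ DL n (u ++ a :: v) ∧
    FT (pr 1 (u ++ a :: v)) (Set.Iic k) (EndS k) (List.replicate u.length 0 ++ 1 :: ds) := by
  have hR := hw.red
  rw [Red_append, one_mul] at hR
  have : FT (pr 1 (u ++ a :: v)) (Set.Iic k) (EndS k) (List.replicate u.length 0 ++ 1 :: ds) := by
    rw [pr_append, one_mul]
    apply FT.append (base_follow hR.1 k)
    apply FT.cons (G := Fqp k (wordProd u a) (wordProd u (a + 1))) _ h
    right; left
    refine ⟨rfl, hr, by rw [Set.mem_Iic]; omega, ?_⟩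
    ext x; simp only [mem_Fqp, Set.mem_insert_iff, Set.mem_sdiff, Set.mem_singleton_iff, Set.mem_Iic]
    omega
  exact ⟨⟨k, hk1, hk2, this⟩, this⟩

lemma IsReduced.suffix {n : ℕ} {u v : List ℕ} (hw : IsReduced n (u ++ v)) :
    Red (wordProd u) v ∧ wordProd u * wordProd v = longestPerm n := by
  have hR := hw.red
  rw [Red_append, one_mul] at hR
  exact ⟨hR.2, by rw [← wordProd_append]; exact hw.2.2⟩

lemma state_bounds {n : ℕ} {u v : List ℕ} {a : ℕ} (hw : IsReduced n (u ++ a :: v)) :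
    1 ≤ wordProd u a ∧ wordProd u a < wordProd u (a + 1) ∧ wordProd u (a + 1) ≤ n + 1 := by
  have h1 : ∀ b ∈ u, 1 ≤ b ∧ b ≤ n := fun b hb => hw.2.1 b (by simp [hb])
  have h2 := hw.2.1 a (by simp)
  have h3 := wordProd_range h1 (x := a) (by omega)
  have h4 := wordProd_range h1 (x := a + 1) (by omega)
  have h5 := hw.suffix.1.1
  omega

/-- canonical trails with prescribed `k` -/
lemma canonical_k {n : ℕ} {u v : List ℕ} {a k : ℕ} (hw : IsReduced n (u ++ a :: v))
    (hk1 : 1 ≤ k) (hk2 : k ≤ n)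
    (hr : wordProd u a ≤ k) (hs : k < wordProd u (a + 1))
    (hp : a + 1 ≤ (wordProd u * sTrans a).symm k) (hp' : (wordProd u * sTrans a).symm (k + 1) ≤ a) :
    ∃ ds, FT (pr 1 (u ++ a :: v)) (Set.Iic k) (EndS k) (List.replicate u.length 0 ++ 1 :: ds) := by
  have h1 := hw.suffix
  have e1 : (wordProd u * sTrans a).symm (wordProd u a) = a + 1 := by
    rw [mul_sTrans_symm]; simp [sTrans_left]
  have e2 : (wordProd u * sTrans a).symm (wordProd u (a + 1)) = a := by
    rw [mul_sTrans_symm]; simp [sTrans_right]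
  obtain ⟨ds, hds⟩ := completion hk1 hk2 (π := wordProd u * sTrans a) (w := v)
    (q := wordProd u a) (p := wordProd u (a + 1)) h1.1.2 (by rw [mul_assoc, ← wordProd_cons, h1.2])
    hr hs (by rw [e1, e2]; omega) (by rw [e1]; exact hp) (by rw [e2]; exact hp')
  exact ⟨ds, (trail_from hw hk1 hk2 hr hs hds).2⟩

lemma canonical {n : ℕ} {u v : List ℕ} {a : ℕ} (hw : IsReduced n (u ++ a :: v)) :
    ∃ ds, (List.replicate u.length 0 ++ 1 :: ds) ∈ DL n (u ++ a :: v) := by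
  obtain ⟨b1, b2, b3⟩ := state_bounds hw
  obtain ⟨k, h1, h2, h3, h4⟩ := exists_k (P := fun k => a + 1 ≤ (wordProd u * sTrans a).symm k)
    b2 (by rw [mul_sTrans_symm]; simp [sTrans_left]) (by rw [mul_sTrans_symm]; simp [sTrans_right])
  obtain ⟨ds, hds⟩ := canonical_k hw (by omega) (by omega) h1 h2 h3 (by omega)
  exact ⟨ds, k, by omega, by omega, hds⟩

lemma canonical_lead {n : ℕ} {w : List ℕ} (hw : IsReduced n w) {j : ℕ} (hj : j < w.length) :
    ∃ ds ∈ DL n w, Lead j ds := by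
  have e : w = w.take j ++ w[j] :: w.drop (j + 1) := by simp
  have hlen : (w.take j).length = j := by simp; omega
  rw [e] at hw
  obtain ⟨ds, hds⟩ := canonical hw
  rw [hlen, ← e] at hds
  exact ⟨_, hds, ds, rfl⟩

lemma Lead.unique {i j : ℕ} {ds : List ℤ} (h : Lead i ds) (h' : Lead j ds) : i = j := by
  obtain ⟨e, he⟩ := h
  obtain ⟨e', he'⟩ := h'
  by_contra hne
  rcases Nat.lt_or_gt_of_ne hne with h | h
  · have h1 : ds[i]? = some 1 := by rw [he]; simp
    have h2 : ds[i]? = some 0 := by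
      rw [he', List.getElem?_append_left (by simpa using h)]; simp [h]
    simp [h1] at h2
  · have h1 : ds[j]? = some 1 := by rw [he']; simp
    have h2 : ds[j]? = some 0 := by
      rw [he, List.getElem?_append_left (by simpa using h)]; simp [h]
    simp [h1] at h2

/-- choice of canonical trails -/
lemma exists_can {n : ℕ} {w : List ℕ} (hw : IsReduced n w) :
    ∃ f : Fin w.length → List ℤ, Function.Injective f ∧ ∀ j, f j ∈ DL n w ∧ Lead j (f j) := by
  choose f hf using fun j : Fin w.length => canonical_lead hw j.2
  refine ⟨f, ?_, hf⟩
  intro i j h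
  have h1 := (hf i).2
  rw [h] at h1
  exact Fin.ext (h1.unique (hf j).2)

lemma DL_ncard_ge {n : ℕ} {w : List ℕ} (hw : IsReduced n w) : w.length ≤ (DL n w).ncard := by
  obtain ⟨f, hf, hf'⟩ := exists_can hw
  have h1 : Set.range f ⊆ DL n w := by rintro _ ⟨j, rfl⟩; exact (hf' j).1
  have h2 := Set.ncard_le_ncard h1 (DL_finite n w)
  rwa [← Set.image_univ, hf.injOn.ncard_image, Set.ncard_univ, Nat.card_fin] at h2

lemma DL_eq_range {n : ℕ} {w : List ℕ} (hN : (DL n w).ncard = w.length)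
    {f : Fin w.length → List ℤ} (hf : Function.Injective f)
    (hf' : ∀ j, f j ∈ DL n w ∧ Lead j (f j)) : DL n w = Set.range f := by
  have h1 : Set.range f ⊆ DL n w := by rintro _ ⟨j, rfl⟩; exact (hf' j).1
  refine (Set.eq_of_subset_of_ncard_le h1 ?_ (DL_finite n w)).symm
  rw [hN, ← Set.image_univ, hf.injOn.ncard_image, Set.ncard_univ, Nat.card_fin]

lemma lead_unique {n : ℕ} {w : List ℕ} (hw : IsReduced n w) (hN : (DL n w).ncard = w.length)
    {j : ℕ} {ds ds' : List ℤ} (h : ds ∈ DL n w) (h' : ds' ∈ DL n w) (hl : Lead j ds)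
    (hl' : Lead j ds') : ds = ds' := by
  obtain ⟨f, hf, hf'⟩ := exists_can hw
  rw [DL_eq_range hN hf hf'] at h h'
  obtain ⟨i, rfl⟩ := h
  obtain ⟨i', rfl⟩ := h'
  have e1 := (hf' i).2.unique hl
  have e2 := (hf' i').2.unique hl'
  rw [Fin.ext (e1.trans e2.symm)]

/-! ### Two-moves and mirror images -/

lemma StepF_iff {r s : ℕ} (hrs : r ≠ s) {F G : Set ℕ} {d : ℤ} :
    StepF r s F G d ↔ (∀ x, x ≠ r → x ≠ s → (x ∈ G ↔ x ∈ F)) ∧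
      ((d = 0 ∧ (r ∈ G ↔ r ∈ F) ∧ (s ∈ G ↔ s ∈ F) ∧ (s ∈ F → r ∈ F)) ∨
       (d = 1 ∧ r ∈ F ∧ s ∉ F ∧ r ∉ G ∧ s ∈ G) ∨
       (d = -1 ∧ r ∉ F ∧ s ∈ F ∧ r ∈ G ∧ s ∉ G)) := by
  constructor
  · intro h
    refine ⟨fun x h1 h2 => h.mem_of_ne h1 h2, ?_⟩
    rcases h with ⟨rfl, rfl, h⟩ | ⟨rfl, h1, h2, rfl⟩ | ⟨rfl, h1, h2, rfl⟩
    · exact Or.inl ⟨rfl, Iff.rfl, Iff.rfl, h⟩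
    · right; left; simp [h1, h2, hrs]
    · right; right; simp [h1, h2, hrs.symm]
  · rintro ⟨h0, ⟨rfl, h1, h2, h3⟩ | ⟨rfl, h1, h2, h3, h4⟩ | ⟨rfl, h1, h2, h3, h4⟩⟩
    · left
      refine ⟨rfl, ?_, h3⟩
      ext x
      by_cases e1 : x = r
      · rw [e1, h1]
      by_cases e2 : x = s
      · rw [e2, h2]
      exact h0 x e1 e2
    · right; left
      refine ⟨rfl, h1, h2, ?_⟩
      ext x
      by_cases e1 : x = r
      · subst e1; simp [h3, hrs]
      by_cases e2 : x = s
      · subst e2; simp [h4]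
      rw [h0 x e1 e2]; simp [e1, e2]
    · right; right
      refine ⟨rfl, h1, h2, ?_⟩
      ext x
      by_cases e1 : x = r
      · subst e1; simp [h3]
      by_cases e2 : x = s
      · subst e2; simp [h4, hrs.symm]
      rw [h0 x e1 e2]; simp [e1, e2]

lemma StepF_swap {r s r' s' : ℕ} (h1 : r ≠ s) (h2 : r' ≠ s') (h3 : r ≠ r') (h4 : r ≠ s')
    (h5 : s ≠ r') (h6 : s ≠ s') {F G H : Set ℕ} {d d' : ℤ}
    (h : StepF r s F G d) (h' : StepF r' s' G H d') :
    ∃ G', StepF r' s' F G' d' ∧ StepF r s G' H d := by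
  rw [StepF_iff h1] at h
  rw [StepF_iff h2] at h'
  have e1 := h.1 r' h3.symm h5.symm
  have e2 := h.1 s' h4.symm h6.symm
  have e3 := h'.1 r h3 h4
  have e4 := h'.1 s h5 h6
  refine ⟨{x | if x = r' ∨ x = s' then x ∈ H else x ∈ F}, ?_, ?_⟩
  · rw [StepF_iff h2]
    refine ⟨?_, ?_⟩
    · intro x hx hx'
      simp [hx, hx']
    · simp only [Set.mem_ofPred_eq, true_or, or_true, if_true]
      rw [e1, e2] at h'
      exact h'.2
  · rw [StepF_iff h1]
    refine ⟨?_, ?_⟩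
    · intro x hx hx'
      simp only [Set.mem_ofPred_eq]
      split_ifs with hc
      · rfl
      · rw [not_or] at hc
        rw [h'.1 x hc.1 hc.2, h.1 x hx hx']
    · simp only [Set.mem_ofPred_eq, h3, h4, h5, h6, or_self, if_false]
      rw [e3, e4]
      exact h.2

lemma sTrans_comm {a b : ℕ} (h : a + 1 < b ∨ b + 1 < a) :
    sTrans a * sTrans b = sTrans b * sTrans a := by
  ext x
  simp only [Equiv.Perm.mul_apply, sTrans_apply]
  split_ifs <;> omega

lemma TwoMoveStep.symm {w w' : List ℕ} (h : TwoMoveStep w w') : TwoMoveStep w' w := by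
  obtain ⟨u, v, a, b, h, h1, h2⟩ := h
  exact ⟨u, v, b, a, h.symm, h2, h1⟩

lemma TwoMoveStep.wordProd_eq {w w' : List ℕ} (h : TwoMoveStep w w') :
    wordProd w' = wordProd w := by
  obtain ⟨u, v, a, b, h, rfl, rfl⟩ := h
  simp only [wordProd_append, wordProd_cons]
  rw [← mul_assoc (sTrans a), sTrans_comm h, mul_assoc]

lemma TwoMoveStep.perm {w w' : List ℕ} (h : TwoMoveStep w w') : w.Perm w' := by
  obtain ⟨u, v, a, b, h, rfl, rfl⟩ := h
  exact List.Perm.append_left _ (List.Perm.swap _ _ _)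

lemma TwoMoveStep.reduced {n : ℕ} {w w' : List ℕ} (h : TwoMoveStep w w') (hw : IsReduced n w) :
    IsReduced n w' := by
  refine ⟨?_, ?_, ?_⟩
  · rw [← h.perm.length_eq]; exact hw.1
  · intro a ha; exact hw.2.1 a (h.perm.mem_iff.2 ha)
  · rw [h.wordProd_eq]; exact hw.2.2

lemma TwoMoveEquiv.reduced {n : ℕ} {w w' : List ℕ} (h : TwoMoveEquiv w w') (hw : IsReduced n w) :
    IsReduced n w' := by
  induction h with
  | refl => exact hw
  | tail _ hs ih => exact hs.reduced ih

lemma TwoMoveEquiv.symm {w w' : List ℕ} (h : TwoMoveEquiv w w') : TwoMoveEquiv w' w := by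
  induction h with
  | refl => exact Relation.ReflTransGen.refl
  | tail _ hs ih => exact Relation.ReflTransGen.head hs.symm ih

lemma TwoMoveEquiv.trans {w w' w'' : List ℕ} (h : TwoMoveEquiv w w') (h' : TwoMoveEquiv w' w'') :
    TwoMoveEquiv w w'' := Relation.ReflTransGen.trans h h'

lemma TwoMoveEquiv.rfl' {w : List ℕ} : TwoMoveEquiv w w := Relation.ReflTransGen.refl

lemma TwoMoveEquiv.append_left (u : List ℕ) {w w' : List ℕ} (h : TwoMoveEquiv w w') :
    TwoMoveEquiv (u ++ w) (u ++ w') := by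
  refine Relation.ReflTransGen.lift (fun x => u ++ x) ?_ _ _ h
  rintro x y ⟨u', v, a, b, h, rfl, rfl⟩
  exact ⟨u ++ u', v, a, b, h, by simp, by simp⟩

lemma TwoMoveEquiv.append_right (v : List ℕ) {w w' : List ℕ} (h : TwoMoveEquiv w w') :
    TwoMoveEquiv (w ++ v) (w' ++ v) := by
  refine Relation.ReflTransGen.lift (fun x => x ++ v) ?_ _ _ h
  rintro x y ⟨u, v', a, b, h, rfl, rfl⟩
  exact ⟨u, v' ++ v, a, b, h, by simp, by simp⟩

/-- exchanging entries `m` and `m+1` -/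
def swapAt (m : ℕ) (ds : List ℤ) : List ℤ :=
  ds.take m ++ match ds.drop m with
    | x :: y :: t => y :: x :: t
    | l => l

lemma swapAt_append (d1 d2 : List ℤ) (x y : ℤ) :
    swapAt d1.length (d1 ++ x :: y :: d2) = d1 ++ y :: x :: d2 := by
  simp [swapAt]

lemma swapAt_step {n : ℕ} {u v : List ℕ} {a b : ℕ} (h : a + 1 < b ∨ b + 1 < a) {ds : List ℤ}
    (hds : ds ∈ DL n (u ++ a :: b :: v)) :
    swapAt u.length ds ∈ DL n (u ++ b :: a :: v) ∧
      swapAt u.length (swapAt u.length ds) = ds := by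
  obtain ⟨k, hk1, hk2, hf⟩ := hds
  rw [pr_append] at hf
  obtain ⟨G, d1, d2, rfl, h1, h2⟩ := hf.split
  have hl : d1.length = u.length := by rw [h1.length, pr_length]
  simp only [pr, one_mul] at h2
  rw [FT.cons_iff] at h2
  obtain ⟨x, d3, G1, rfl, s1, h2⟩ := h2
  rw [FT.cons_iff] at h2
  obtain ⟨y, d4, G2, rfl, s2, h2⟩ := h2
  rw [← hl, swapAt_append, swapAt_append]
  refine ⟨⟨k, hk1, hk2, ?_⟩, rfl⟩
  rw [pr_append]
  apply FT.append h1
  simp only [pr, one_mul]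
  set π := wordProd u
  have i : ∀ x y, x ≠ y → π x ≠ π y := fun x y h h' => h (π.injective h')
  have e1 : (π * sTrans a) b = π b := by
    rw [Equiv.Perm.mul_apply, sTrans_of_ne] <;> omega
  have e2 : (π * sTrans a) (b + 1) = π (b + 1) := by
    rw [Equiv.Perm.mul_apply, sTrans_of_ne] <;> omega
  have e3 : (π * sTrans b) a = π a := by
    rw [Equiv.Perm.mul_apply, sTrans_of_ne] <;> omega
  have e4 : (π * sTrans b) (a + 1) = π (a + 1) := by
    rw [Equiv.Perm.mul_apply, sTrans_of_ne] <;> omega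
  rw [e1, e2] at s2
  obtain ⟨G', t1, t2⟩ := StepF_swap (i _ _ (by omega)) (i _ _ (by omega)) (i _ _ (by omega))
    (i _ _ (by omega)) (i _ _ (by omega)) (i _ _ (by omega)) s1 s2
  refine FT.cons t1 ?_
  rw [e3, e4]
  refine FT.cons t2 ?_
  rw [mul_assoc, ← sTrans_comm h, ← mul_assoc]
  exact h2

lemma TwoMoveStep.ncard_le {n : ℕ} {w w' : List ℕ} (h : TwoMoveStep w w') :
    (DL n w).ncard ≤ (DL n w').ncard := by
  obtain ⟨u, v, a, b, h, rfl, rfl⟩ := h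
  refine Set.ncard_le_ncard_of_injOn (swapAt u.length) (fun ds hds => (swapAt_step h hds).1)
    ?_ (DL_finite _ _)
  intro ds hds ds' hds' he
  rw [← (swapAt_step h hds).2, he, (swapAt_step h hds').2]

lemma TwoMoveEquiv.ncard_eq {n : ℕ} {w w' : List ℕ} (h : TwoMoveEquiv w w') :
    (DL n w).ncard = (DL n w').ncard := by
  induction h with
  | refl => rfl
  | tail _ hs ih => rw [ih]; exact le_antisymm hs.ncard_le hs.symm.ncard_le

/-- mirror image of a word -/
def mir (n : ℕ) (w : List ℕ) : List ℕ := w.map (fun a => n + 1 - a)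

lemma mir_append (n : ℕ) (u v : List ℕ) : mir n (u ++ v) = mir n u ++ mir n v := by simp [mir]

lemma mir_mir {n : ℕ} {w : List ℕ} (h : ∀ a ∈ w, 1 ≤ a ∧ a ≤ n) : mir n (mir n w) = w := by
  unfold mir
  rw [List.map_map]
  conv_rhs => rw [← List.map_id w]
  apply List.map_congr_left
  intro a ha
  have := h a ha
  simp; omega

lemma mir_letters {n : ℕ} {w : List ℕ} (h : ∀ a ∈ w, 1 ≤ a ∧ a ≤ n) :
    ∀ a ∈ mir n w, 1 ≤ a ∧ a ≤ n := by
  intro a ha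
  simp only [mir, List.mem_map] at ha
  obtain ⟨b, hb, rfl⟩ := ha
  have := h b hb
  omega

lemma longest_mul_self (n : ℕ) : longestPerm n * longestPerm n = 1 := by
  ext x
  simp only [Equiv.Perm.mul_apply, longestPerm_apply, Equiv.Perm.one_apply]
  split_ifs <;> omega

lemma sTrans_mir {n a : ℕ} (h : 1 ≤ a ∧ a ≤ n) :
    sTrans (n + 1 - a) = longestPerm n * sTrans a * longestPerm n := by
  ext x
  simp only [Equiv.Perm.mul_apply, longestPerm_apply, sTrans_apply]
  split_ifs <;> omega

lemma wordProd_mir {n : ℕ} {w : List ℕ} (h : ∀ a ∈ w, 1 ≤ a ∧ a ≤ n) :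
    wordProd (mir n w) = longestPerm n * wordProd w * longestPerm n := by
  induction w with
  | nil => simp [mir, longest_mul_self]
  | cons a w ih =>
    have e : mir n (a :: w) = (n + 1 - a) :: mir n w := rfl
    rw [e, wordProd_cons, wordProd_cons, ih (fun b hb => h b (by simp [hb])),
      sTrans_mir (h a (by simp))]
    simp only [mul_assoc]
    rw [← mul_assoc (longestPerm n) (longestPerm n), longest_mul_self, one_mul]

lemma IsReduced.mir {n : ℕ} {w : List ℕ} (h : IsReduced n w) : IsReduced n (mir n w) := by
  refine ⟨?_, mir_letters h.2.1, ?_⟩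
  · simp [StringPolytope.mir, h.1]
  · rw [wordProd_mir h.2.1, h.2.2, longest_mul_self, one_mul]

lemma pr_mir {n : ℕ} {w : List ℕ} (h : ∀ a ∈ w, 1 ≤ a ∧ a ≤ n) (π : Equiv.Perm ℕ) :
    pr (longestPerm n * π * longestPerm n) (mir n w)
      = (pr π w).map (fun p => (longestPerm n p.2, longestPerm n p.1)) := by
  induction w generalizing π with
  | nil => rfl
  | cons a w ih =>
    have ha := h a (by simp)
    have e : mir n (a :: w) = (n + 1 - a) :: mir n w := rfl
    rw [e]
    simp only [pr, List.map_cons]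
    congr 1
    · simp only [Equiv.Perm.mul_apply]
      have e1 : longestPerm n (n + 1 - a) = a + 1 := by
        rw [longestPerm_apply, if_pos (by omega)]; omega
      have e2 : longestPerm n (n + 1 - a + 1) = a := by
        rw [longestPerm_apply, if_pos (by omega)]; omega
      rw [e1, e2]
    · rw [← ih (fun b hb => h b (by simp [hb])), sTrans_mir ha]
      congr 1
      simp only [mul_assoc]
      rw [← mul_assoc (longestPerm n) (longestPerm n), longest_mul_self, one_mul]

/-- mirror image of a set -/
def mirS (n : ℕ) (F : Set ℕ) : Set ℕ := {x | x = 0 ∨ (x ≤ n + 1 ∧ longestPerm n x ∉ F)}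

lemma mem_mirS {n x : ℕ} {F : Set ℕ} :
    x ∈ mirS n F ↔ x = 0 ∨ (x ≤ n + 1 ∧ longestPerm n x ∉ F) := Iff.rfl

lemma longest_longest (n x : ℕ) : longestPerm n (longestPerm n x) = x := by
  rw [← Equiv.Perm.mul_apply, longest_mul_self]; rfl

lemma mem_mirS_longest {n r : ℕ} {F : Set ℕ} (h : 1 ≤ r ∧ r ≤ n + 1) :
    longestPerm n r ∈ mirS n F ↔ r ∉ F := by
  rw [mem_mirS, longest_longest]
  have e : longestPerm n r = n + 2 - r := by rw [longestPerm_apply, if_pos h]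
  rw [e]
  constructor
  · rintro (h' | h')
    · omega
    · exact h'.2
  · intro h'; right; exact ⟨by omega, h'⟩

lemma StepF.mir {n r s : ℕ} {F G : Set ℕ} {d : ℤ} (h : StepF r s F G d) (hrs : r ≠ s)
    (hr : 1 ≤ r ∧ r ≤ n + 1) (hs : 1 ≤ s ∧ s ≤ n + 1) :
    StepF (longestPerm n s) (longestPerm n r) (mirS n F) (mirS n G) d := by
  rw [StepF_iff hrs] at h
  rw [StepF_iff (fun e => hrs ((longestPerm n).injective e).symm)]
  refine ⟨?_, ?_⟩
  · intro x h1 h2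
    rw [mem_mirS, mem_mirS, h.1]
    · rintro rfl; exact h2 (longest_longest n x).symm
    · rintro rfl; exact h1 (longest_longest n x).symm
  · simp only [mem_mirS_longest hr, mem_mirS_longest hs]
    rcases h.2 with ⟨h0, h1, h2, h3⟩ | ⟨h0, h1, h2, h3, h4⟩ | ⟨h0, h1, h2, h3, h4⟩
    · exact Or.inl ⟨h0, not_congr h2, not_congr h1, fun a b => a (h3 b)⟩
    · exact Or.inr (Or.inl ⟨h0, h2, fun a => a h1, fun a => a h4, h3⟩)
    · exact Or.inr (Or.inr ⟨h0, fun a => a h2, h1, h4, fun a => a h3⟩)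

lemma FT.mir {n : ℕ} {L : List (ℕ × ℕ)} {F G : Set ℕ} {ds : List ℤ} (h : FT L F G ds)
    (hL : ∀ p ∈ L, p.1 ≠ p.2 ∧ (1 ≤ p.1 ∧ p.1 ≤ n + 1) ∧ (1 ≤ p.2 ∧ p.2 ≤ n + 1)) :
    FT (L.map (fun p => (longestPerm n p.2, longestPerm n p.1))) (mirS n F) (mirS n G) ds := by
  induction h with
  | nil F => exact FT.nil _
  | cons hs t ih =>
    have := hL _ List.mem_cons_self
    exact FT.cons (hs.mir this.1 this.2.1 this.2.2) (ih fun p hp => hL p (by simp [hp]))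

lemma DL_mir_sub {n : ℕ} {w : List ℕ} (h : ∀ a ∈ w, 1 ≤ a ∧ a ≤ n) :
    DL n w ⊆ DL n (mir n w) := by
  rintro ds ⟨k, hk1, hk2, hf⟩
  refine ⟨n + 1 - k, by omega, by omega, ?_⟩
  have hf' := hf.mir (n := n) (by
    intro p hp
    obtain ⟨u, a, v, rfl, rfl⟩ := mem_pr.1 hp
    have h1 : ∀ b ∈ u, 1 ≤ b ∧ b ≤ n := fun b hb => h b (by simp [hb])
    have h2 := h a (by simp)
    rw [one_mul]
    refine ⟨fun e => ?_, wordProd_range h1 (by omega), wordProd_range h1 (by omega)⟩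
    have := (wordProd u).injective e
    omega)
  rw [← pr_mir h, mul_one, longest_mul_self] at hf'
  have e1 : mirS n (Set.Iic k) = Set.Iic (n + 1 - k) := by
    ext x
    rw [mem_mirS, Set.mem_Iic, Set.mem_Iic, longestPerm_apply]
    split_ifs <;> omega
  have e2 : mirS n (EndS k) = EndS (n + 1 - k) := by
    ext x
    rw [mem_mirS, mem_EndS, mem_EndS, longestPerm_apply]
    split_ifs <;> omega
  rwa [e1, e2] at hf'

lemma DL_mir {n : ℕ} {w : List ℕ} (h : ∀ a ∈ w, 1 ≤ a ∧ a ≤ n) :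
    DL n (mir n w) = DL n w := by
  apply Set.Subset.antisymm _ (DL_mir_sub h)
  have := DL_mir_sub (mir_letters h)
  rwa [mir_mir h] at this

lemma TwoMoveEquiv.mir {n : ℕ} {w w' : List ℕ} (h : TwoMoveEquiv w w')
    (hw : ∀ a ∈ w, 1 ≤ a ∧ a ≤ n) :
    TwoMoveEquiv (mir n w) (mir n w') ∧ ∀ a ∈ w', 1 ≤ a ∧ a ≤ n := by
  induction h with
  | refl => exact ⟨Relation.ReflTransGen.refl, hw⟩
  | tail _ hs ih =>
    refine ⟨ih.1.tail ?_, fun a ha => ih.2 a (hs.perm.mem_iff.2 ha)⟩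
    have h2 := ih.2
    obtain ⟨u, v, a, b, h, rfl, rfl⟩ := hs
    have ha := h2 a (by simp)
    have hb := h2 b (by simp)
    exact ⟨StringPolytope.mir n u, StringPolytope.mir n v, n + 1 - a, n + 1 - b, by omega,
      by simp [StringPolytope.mir], by simp [StringPolytope.mir]⟩

lemma ascWord_succ (n : ℕ) : ascWord (n + 1) = ascWord n ++ [n + 1] := by
  simp [ascWord, List.range_succ]

lemma descWord_succ (n : ℕ) : descWord (n + 1) = (n + 1) :: descWord n := by
  simp [descWord, ascWord_succ]

lemma mem_ascWord {n a : ℕ} : a ∈ ascWord n ↔ 1 ≤ a ∧ a ≤ n := by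
  simp only [ascWord, List.mem_map, List.mem_range]
  constructor
  · rintro ⟨b, hb, rfl⟩; omega
  · intro h; exact ⟨a - 1, by omega, by omega⟩

lemma mem_descWord {n a : ℕ} : a ∈ descWord n ↔ 1 ≤ a ∧ a ≤ n := by
  rw [descWord, List.mem_reverse, mem_ascWord]

lemma ascWord_length (n : ℕ) : (ascWord n).length = n := by simp [ascWord]
lemma descWord_length (n : ℕ) : (descWord n).length = n := by simp [descWord, ascWord]

lemma mir_asc (n : ℕ) : mir n (ascWord n) = descWord n := by
  apply List.ext_getElem
  · simp [mir, ascWord, descWord]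
  · intro i h1 h2
    simp [mir, ascWord, descWord, List.getElem_reverse]
    simp [mir, ascWord] at h1
    omega

lemma mir_desc (n : ℕ) : mir n (descWord n) = ascWord n := by
  rw [← mir_asc, mir_mir (fun a ha => mem_ascWord.1 ha)]

/-! ### Words ending with `D_n` -/

lemma wordProd_desc (n x : ℕ) : wordProd (descWord n) x =
    if x = 1 then n + 1 else if 2 ≤ x ∧ x ≤ n + 1 then x - 1 else x := by
  induction n with
  | zero =>
    have : descWord 0 = [] := rfl
    rw [this]; simp; split_ifs <;> omega
  | succ n ih =>
    rw [descWord_succ, wordProd_cons, Equiv.Perm.mul_apply, ih, sTrans_apply]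
    split_ifs <;> omega

lemma wordProd_desc_symm (n x : ℕ) : (wordProd (descWord n)).symm x =
    if x = n + 1 then 1 else if 1 ≤ x ∧ x ≤ n then x + 1 else x := by
  rw [Equiv.symm_apply_eq, wordProd_desc]
  split_ifs <;> omega

lemma longest_desc (m : ℕ) :
    longestPerm (m + 1) = longestPerm m * wordProd (descWord (m + 1)) := by
  ext x
  rw [Equiv.Perm.mul_apply, wordProd_desc]
  simp only [longestPerm_apply]
  split_ifs <;> omega

/-- the position of the last wire moves left -/
lemma pos_last_le {n : ℕ} {w : List ℕ} : ∀ {π : Equiv.Perm ℕ}, Red π w →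
    (∀ a ∈ w, 1 ≤ a ∧ a ≤ n) → (∀ x, 1 ≤ x → x ≤ n + 1 → π x ≤ n + 1) →
    (π * wordProd w).symm (n + 1) ≤ π.symm (n + 1) := by
  induction w with
  | nil => intro π _ _ _; simp
  | cons a w ih =>
    intro π hR hl hT
    have ha := hl a (by simp)
    have h1 := ih hR.2 (fun b hb => hl b (by simp [hb])) (by
      intro x hx hx'
      rw [Equiv.Perm.mul_apply]
      apply hT
      · rw [sTrans_apply]; split_ifs <;> omega
      · rw [sTrans_apply]; split_ifs <;> omega)
    rw [mul_assoc, ← wordProd_cons] at h1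
    refine h1.trans ?_
    rw [mul_sTrans_symm, sTrans_apply]
    split_ifs with e1 e2
    · exfalso
      have e3 := (eq_iff_pos π a (n + 1)).2 e1
      have e4 := hR.1
      have e5 := hT (a + 1) (by omega) (by omega)
      omega
    · omega
    · exact le_rfl

lemma top_wordProd {n : ℕ} {u : List ℕ} (h : ∀ a ∈ u, 1 ≤ a ∧ a ≤ n) :
    ∀ x, 1 ≤ x → x ≤ n + 1 → wordProd u x ≤ n + 1 :=
  fun _ hx hx' => (wordProd_range h ⟨hx, hx'⟩).2

lemma mul_symm_apply' (π ρ : Equiv.Perm ℕ) (x : ℕ) : (π * ρ).symm x = ρ.symm (π.symm x) := rfl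

/-- in `u D_n v` the last wire is at column `n+1` after `u` -/
lemma pos_last_u {n : ℕ} {u v : List ℕ} (hw : IsReduced n (u ++ descWord n ++ v)) :
    (wordProd u).symm (n + 1) = n + 1 := by
  have hu : ∀ a ∈ u, 1 ≤ a ∧ a ≤ n := fun a ha => hw.2.1 a (by simp [ha])
  have h1 := wordProd_symm_range hu (x := n + 1) (by omega)
  by_contra hne
  rw [List.append_assoc] at hw
  have hs := hw.suffix.1
  rw [Red_append] at hs
  have h2 := pos_last_le hs.1 (fun a ha => mem_descWord.1 ha) (top_wordProd hu)
  rw [mul_symm_apply', wordProd_desc_symm] at h2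
  split_ifs at h2 <;> omega

/-- no letter is read to the right of the last wire -/
def NB (n : ℕ) : Equiv.Perm ℕ → List ℕ → Prop
  | _, [] => True
  | π, a :: w => ¬ (π.symm (n + 1) < a) ∧ NB n (π * sTrans a) w

lemma NB_append (n : ℕ) (π : Equiv.Perm ℕ) (u v : List ℕ) :
    NB n π (u ++ v) ↔ NB n π u ∧ NB n (π * wordProd u) v := by
  induction u generalizing π with
  | nil => simp [NB]
  | cons a u ih => simp [NB, ih, mul_assoc, and_assoc]

lemma NB_equiv {n : ℕ} {w w' : List ℕ} (h : TwoMoveEquiv w w') (hw : NB n 1 w) : NB n 1 w' := by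
  induction h with
  | refl => exact hw
  | tail _ hs ih =>
    obtain ⟨u, v, a, b, hab, rfl, rfl⟩ := hs
    rw [NB_append] at ih ⊢
    refine ⟨ih.1, ?_⟩
    obtain ⟨-, h1, h2, h3⟩ := ih
    refine ⟨?_, ?_, ?_⟩
    · rw [mul_sTrans_symm, sTrans_apply] at h2
      split_ifs at h2 <;> omega
    · rw [mul_sTrans_symm, sTrans_apply]
      split_ifs <;> omega
    · rw [mul_assoc, sTrans_comm hab.symm, ← mul_assoc]; exact h3

lemma NB_of_letters {n : ℕ} {u : List ℕ} : ∀ {π : Equiv.Perm ℕ}, (∀ a ∈ u, a < n) →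
    π.symm (n + 1) = n + 1 → NB n π u := by
  induction u with
  | nil => intro π _ _; trivial
  | cons a u ih =>
    intro π h h1
    have ha := h a (by simp)
    refine ⟨by omega, ih (fun b hb => h b (by simp [hb])) ?_⟩
    rw [mul_sTrans_symm, h1, sTrans_of_ne (by omega) (by omega)]

lemma NB_desc {n q : ℕ} {π : Equiv.Perm ℕ} (h : π.symm (n + 1) = q + 1) : NB n π (descWord q) := by
  induction q generalizing π with
  | zero => exact trivial
  | succ q ih =>
    rw [descWord_succ]
    refine ⟨by omega, ih ?_⟩
    rw [mul_sTrans_symm, h, sTrans_right]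

/-- letters of `u` are `< n` -/
lemma letters_lt {n : ℕ} {u v : List ℕ} (hw : IsReduced n (u ++ v))
    (hp : (wordProd u).symm (n + 1) = n + 1) : ∀ a ∈ u, a < n := by
  intro a ha
  have hu : ∀ a ∈ u, 1 ≤ a ∧ a ≤ n := fun a ha => hw.2.1 a (by simp [ha])
  by_contra hcon
  have : a = n := by have := hu a ha; omega
  subst this
  obtain ⟨u1, u2, rfl⟩ := List.append_of_mem ha
  have hR := hw.red
  rw [Red_append, Red_append, one_mul] at hR
  have h2 := hR.1.2
  have hlt : wordProd u1 a < wordProd u1 (a + 1) := h2.1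
  have h3 := (wordProd_range (fun b hb => hu b (by simp [hb])) (w := u1) (x := a + 1) (by omega))
  have h4 := (wordProd_symm_range (fun b hb => hu b (by simp [hb])) (w := u1) (x := a + 1) (by omega))
  set x := wordProd u1 a with hx
  have h5 : (wordProd u1 * sTrans a).symm x = a + 1 := by
    rw [mul_sTrans_symm, hx, Equiv.symm_apply_apply, sTrans_left]
  have h6 : (wordProd u1 * sTrans a).symm (a + 1) < (wordProd u1 * sTrans a).symm x := by
    have : (wordProd u1 * sTrans a).symm (a + 1) ≠ (wordProd u1 * sTrans a).symm x := by
      intro h; have := (wordProd u1 * sTrans a).symm.injective h; omega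
    have h7 : (wordProd u1 * sTrans a).symm (a + 1) ≤ a + 1 := by
      rw [mul_sTrans_symm, sTrans_apply]; split_ifs <;> omega
    omega
  have h8 := h2.2.inv_stay (by omega) h6
  rw [mul_assoc, ← wordProd_cons, ← wordProd_append, hp] at h8
  have h9 := (wordProd_symm_range hu (x := x) (by
    have := (wordProd_range (fun b hb => hu b (by simp [hb])) (w := u1) (x := a)
      (by have := hu a (by simp); omega)); omega))
  omega

lemma reduced_u {m : ℕ} {u : List ℕ} (hw : IsReduced (m + 1) (u ++ descWord (m + 1))) :
    IsReduced m u ∧ wordProd u = longestPerm m := by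
  have h1 : wordProd u = longestPerm m := by
    have := hw.2.2
    rw [wordProd_append, longest_desc] at this
    exact mul_right_cancel this
  have hp : (wordProd u).symm (m + 1 + 1) = m + 1 + 1 := pos_last_u (v := []) (by simpa using hw)
  have h2 := letters_lt hw hp
  refine ⟨⟨?_, ?_, h1⟩, h1⟩
  · have := hw.1
    rw [List.length_append, descWord_length] at this
    have e : (m + 1) * (m + 1 + 1) = m * (m + 1) + 2 * (m + 1) := by ring
    omega
  · intro a ha
    have := h2 a ha
    have := hw.2.1 a (by simp [ha])
    omega

lemma v_nil {n : ℕ} {w u v u' : List ℕ} (hw : IsReduced n w)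
    (h : TwoMoveEquiv w (u ++ descWord n ++ v)) (h' : TwoMoveEquiv w (u' ++ descWord n)) :
    v = [] := by
  have r1 := h.reduced hw
  have r2 := h'.reduced hw
  have p1 := pos_last_u r1
  have p2 := pos_last_u (u := u') (v := []) (by simpa using r2)
  have l2 := letters_lt r2 p2
  have n2 : NB n 1 (u' ++ descWord n) := by
    rw [NB_append, one_mul]
    exact ⟨NB_of_letters l2 rfl, NB_desc p2⟩
  have n1 := NB_equiv (h'.symm.trans h) n2
  rw [NB_append, one_mul] at n1
  have n3 := n1.2
  cases v with
  | nil => rfl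
  | cons a v =>
    exfalso
    have e1 : (wordProd (u ++ descWord n)).symm (n + 1) = 1 := by
      rw [wordProd_append, mul_symm_apply', p1, wordProd_desc_symm, if_pos rfl]
    have ha := r1.2.1 a (by simp)
    have e2 := n3.1
    rw [e1] at e2
    have : a = 1 := by omega
    subst this
    obtain ⟨b1, b2, b3⟩ := state_bounds r1
    have := (eq_iff_pos (wordProd (u ++ descWord n)) 1 (n + 1)).2 e1
    omega

lemma pr_desc (q : ℕ) : ∀ (π : Equiv.Perm ℕ),
    pr π (descWord q) = (descWord q).map (fun c => (π c, π (q + 1))) := by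
  induction q with
  | zero => intro π; rfl
  | succ q ih =>
    intro π
    rw [descWord_succ, pr, ih, List.map_cons]
    congr 1
    apply List.map_congr_left
    intro c hc
    rw [mem_descWord] at hc
    rw [Equiv.Perm.mul_apply, Equiv.Perm.mul_apply, sTrans_left, sTrans_of_ne (by omega) (by omega)]

lemma desc_eq (q : ℕ) : descWord q = (List.range' 1 q).map (fun i => q + 1 - i) := by
  apply List.ext_getElem
  · simp [descWord_length]
  · intro i h1 h2
    simp [descWord, ascWord]
    rw [descWord_length] at h1
    omega

lemma pr_last (m : ℕ) : pr (longestPerm m) (descWord (m + 1)) =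
    (List.range' 1 (m + 1)).map (fun i => (i, m + 2)) := by
  rw [pr_desc]
  conv_lhs => rw [desc_eq]
  rw [List.map_map]
  apply List.map_congr_left
  intro c hc
  rw [List.mem_range'_1] at hc
  simp only [Function.comp, longestPerm_apply]
  ext
  · simp only; split_ifs <;> omega
  · simp

/-- the deviation inside `D_n` -/
def gk (k j : ℕ) : ℤ := if j = k then 1 else if j = k + 1 then -1 else 0

lemma tail_analysis {n k : ℕ} (hk1 : 1 ≤ k) (hk2 : k ≤ n) (j : ℕ) : ∀ (i : ℕ) (F : Set ℕ) (ds : List ℤ),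
    1 ≤ i → i + j = n + 1 →
    FT ((List.range' i j).map (fun i => (i, n + 1))) F (EndS k) ds →
    (k < n ∧ F = EndS k ∧ ds = List.replicate j 0) ∨
    (i ≤ k ∧ F = Set.Iic k ∧ ds = (List.range' i j).map (gk k)) ∨
    (i = k + 1 ∧ F = {x | x < k ∨ x = n + 1} ∧ ds = (List.range' i j).map (gk k)) ∨
    (n + 1 ∈ F ∧ ∀ x < i, x ∈ F) := by
  induction j with
  | zero =>
    intro i F ds hi hij h
    simp only [List.range'_zero, List.map_nil, FT.nil_iff] at h
    obtain ⟨rfl, rfl⟩ := h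
    rcases Nat.lt_or_eq_of_le hk2 with hk | hk
    · left; exact ⟨hk, rfl, rfl⟩
    · right; right; left; subst hk
      exact ⟨by omega, rfl, rfl⟩
  | succ j ih =>
    intro i F ds hi hij h
    rw [List.range'_succ, List.map_cons, FT.cons_iff] at h
    obtain ⟨d, ds', G, rfl, hs, ht⟩ := h
    have hin : i ≠ n + 1 := by omega
    rw [StepF_iff hin] at hs
    obtain ⟨hs0, hs⟩ := hs
    rcases ih (i + 1) G ds' (by omega) (by omega) ht with ⟨c1, rfl, rfl⟩ | ⟨c1, rfl, rfl⟩ |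
      ⟨c1, rfl, rfl⟩ | ⟨c1, c2⟩
    · simp only [mem_EndS] at hs hs0
      rcases hs with ⟨rfl, q1, q2, q3⟩ | ⟨rfl, q1, q2, q3, q4⟩ | ⟨rfl, q1, q2, q3, q4⟩
      · left
        refine ⟨c1, ?_, rfl⟩
        ext x; rw [mem_EndS]
        by_cases e1 : x = i
        · subst e1; exact q1.symm
        · by_cases e2 : x = n + 1
          · subst e2; exact q2.symm
          · exact (hs0 x e1 e2).symm
      · exfalso; omega
      · by_cases e : i = k + 1
        · right; right; left
          refine ⟨e, ?_, ?_⟩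
          · ext x; rw [Set.mem_ofPred_eq]
            by_cases e1 : x = i
            · subst e1; constructor
              · intro h; exact absurd h q1
              · intro h; omega
            · by_cases e2 : x = n + 1
              · subst e2; simp [q2]
              · rw [← hs0 x e1 e2]; omega
          · rw [List.range'_succ, List.map_cons]
            congr 1
            · unfold gk; rw [if_neg (by omega), if_pos e]
            · symm; rw [List.eq_replicate_iff]
              refine ⟨by simp, ?_⟩
              intro b hb
              obtain ⟨c, hc, rfl⟩ := List.mem_map.1 hb
              rw [List.mem_range'_1] at hc
              unfold gk; rw [if_neg (by omega), if_neg (by omega)]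
        · right; right; right
          refine ⟨q2, ?_⟩
          intro x hx
          rw [← hs0 x (by omega) (by omega)]
          omega
    · simp only [Set.mem_Iic] at hs hs0
      rcases hs with ⟨rfl, q1, q2, q3⟩ | ⟨rfl, q1, q2, q3, q4⟩ | ⟨rfl, q1, q2, q3, q4⟩
      · right; left
        refine ⟨by omega, ?_, ?_⟩
        · ext x; rw [Set.mem_Iic]
          by_cases e1 : x = i
          · subst e1; exact q1.symm
          · by_cases e2 : x = n + 1
            · subst e2; exact q2.symm
            · exact (hs0 x e1 e2).symm
        · rw [List.range'_succ, List.map_cons]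
          congr 1
          unfold gk; rw [if_neg (by omega), if_neg (by omega)]
      · exfalso; omega
      · right; right; right
        refine ⟨q2, ?_⟩
        intro x hx
        rw [← hs0 x (by omega) (by omega)]
        omega
    · simp only [Set.mem_ofPred_eq] at hs hs0
      rcases hs with ⟨rfl, q1, q2, q3⟩ | ⟨rfl, q1, q2, q3, q4⟩ | ⟨rfl, q1, q2, q3, q4⟩
      · exfalso
        have h1 := q2.1 (by simp)
        have h2 := q1.2 (q3 h1)
        omega
      · right; left
        refine ⟨by omega, ?_, ?_⟩
        · ext x; rw [Set.mem_Iic]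
          by_cases e1 : x = i
          · subst e1; constructor
            · intro _; omega
            · intro _; exact q1
          · by_cases e2 : x = n + 1
            · subst e2; constructor
              · intro h; exact absurd h q2
              · intro h; omega
            · rw [← hs0 x e1 e2]; omega
        · rw [List.range'_succ, List.map_cons]
          congr 1
          unfold gk; rw [if_pos (by omega)]
      · exfalso; omega
    · right; right; right
      rcases hs with ⟨rfl, q1, q2, q3⟩ | ⟨rfl, q1, q2, q3, q4⟩ | ⟨rfl, q1, q2, q3, q4⟩
      · refine ⟨q2.1 c1, ?_⟩
        intro x hx
        rw [← hs0 x (by omega) (by omega)]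
        exact c2 x (by omega)
      · exact absurd (c2 i (by omega)) q3
      · exact absurd c1 q4

lemma FT_avoid {L : List (ℕ × ℕ)} {F G : Set ℕ} {ds : List ℤ} (h : FT L F G ds) {x : ℕ}
    (hx : ∀ p ∈ L, p.1 ≠ p.2 ∧ x ≠ p.1 ∧ x ≠ p.2) : x ∈ G ↔ x ∈ F := by
  induction h with
  | nil F => exact Iff.rfl
  | cons hs t ih =>
    have h1 := hx _ (List.mem_cons_self)
    rw [ih (fun p hp => hx p (List.mem_cons_of_mem _ hp))]
    rw [StepF_iff h1.1] at hs
    exact hs.1 x h1.2.1 h1.2.2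

lemma FT_base {n k : ℕ} {w : List ℕ} (hw : IsReduced n w) {ds : List ℤ}
    (h : FT (pr 1 w) (Set.Iic k) (Set.Iic k) ds) : ds = List.replicate w.length 0 := by
  obtain ⟨Fs, h0, h1, hl, hT⟩ := FT_pr_iff.1 h
  rw [List.eq_replicate_iff]
  refine ⟨hl, ?_⟩
  intro b hb
  obtain ⟨j, hj, rfl⟩ := List.mem_iff_getElem.1 hb
  have hj' : j < w.length := by omega
  have e1 := hT.base hw h0 h1 hj'.le
  have e2 := hT.base hw h0 h1 (j := j + 1) hj'
  have := hT j hj'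
  rw [e1, e2, StepF_iff (hw.red.lt_at hj').ne] at this
  simp only [List.getD_eq_getElem _ _ hj] at this
  rcases this.2 with h | h | h
  · exact h.1
  · exact absurd h.2.1 h.2.2.2.1
  · exact absurd h.2.2.2.1 h.2.1

lemma pr_u_bound {m : ℕ} {u : List ℕ} (hu : IsReduced m u) :
    ∀ p ∈ pr 1 u, p.1 ≠ p.2 ∧ m + 2 ≠ p.1 ∧ m + 2 ≠ p.2 := by
  intro p hp
  obtain ⟨x, a, y, rfl, rfl⟩ := mem_pr.1 hp
  obtain ⟨b1, b2, b3⟩ := state_bounds hu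
  simp only [one_mul]
  omega

lemma DL_desc_sub {m : ℕ} {u : List ℕ} (hw : IsReduced (m + 1) (u ++ descWord (m + 1))) :
    DL (m + 1) (u ++ descWord (m + 1)) ⊆
      (fun ds => ds ++ List.replicate (m + 1) 0) '' DL m u ∪
      (fun k => List.replicate u.length 0 ++ (List.range' 1 (m + 1)).map (gk k)) '' Set.Icc 1 (m + 1) := by
  obtain ⟨hu, hup⟩ := reduced_u hw
  rintro ds ⟨k, hk1, hk2, hF⟩
  rw [pr_append, one_mul, hup, pr_last] at hF
  obtain ⟨G, d1, d2, rfl, f1, f2⟩ := hF.split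
  have hG : m + 2 ∉ G := by
    rw [FT_avoid f1 (pr_u_bound hu), Set.mem_Iic]; omega
  rcases tail_analysis hk1 hk2 (m + 1) 1 G d2 le_rfl (by omega) f2 with ⟨c1, rfl, rfl⟩ |
    ⟨c1, rfl, rfl⟩ | ⟨c1, c2, c3⟩ | ⟨c1, c2⟩
  · left
    exact ⟨d1, ⟨k, hk1, by omega, f1⟩, rfl⟩
  · right
    refine ⟨k, ⟨hk1, hk2⟩, ?_⟩
    have := FT_base hu f1
    subst this
    rfl
  · omega
  · exact absurd c1 hG

lemma ncard_desc_le {m : ℕ} {u : List ℕ} (hw : IsReduced (m + 1) (u ++ descWord (m + 1))) :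
    (DL (m + 1) (u ++ descWord (m + 1))).ncard ≤ (DL m u).ncard + (m + 1) := by
  have h1 := DL_desc_sub hw
  have f1 : ((fun ds => ds ++ List.replicate (m + 1) (0 : ℤ)) '' DL m u).Finite :=
    (DL_finite m u).image _
  have f2 : ((fun k => List.replicate u.length 0 ++ (List.range' 1 (m + 1)).map (gk k)) ''
    Set.Icc 1 (m + 1)).Finite := (Set.finite_Icc _ _).image _
  have h2 := Set.ncard_le_ncard h1 (f1.union f2)
  have h3 := Set.ncard_union_le ((fun ds => ds ++ List.replicate (m + 1) (0 : ℤ)) '' DL m u)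
    ((fun k => List.replicate u.length 0 ++ (List.range' 1 (m + 1)).map (gk k)) '' Set.Icc 1 (m + 1))
  have h4 := Set.ncard_image_le (f := fun ds => ds ++ List.replicate (m + 1) (0 : ℤ)) (DL_finite m u)
  have h5 := Set.ncard_image_le
    (f := fun k => List.replicate u.length 0 ++ (List.range' 1 (m + 1)).map (gk k))
    (Set.finite_Icc 1 (m + 1))
  rw [← Finset.coe_Icc, Set.ncard_coe_finset, Nat.card_Icc] at h5
  rw [← Finset.coe_Icc] at h2 h3
  omega

lemma ncard_desc_ge {m : ℕ} {u : List ℕ} (hw : IsReduced (m + 1) (u ++ descWord (m + 1))) :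
    (DL m u).ncard + (m + 1) ≤ (DL (m + 1) (u ++ descWord (m + 1))).ncard := by
  obtain ⟨hu, hup⟩ := reduced_u hw
  choose f hf using fun j : Fin (m + 1) => canonical_lead hw (j := u.length + j)
    (by rw [List.length_append, descWord_length]; omega)
  have hinj : Function.Injective f := by
    intro i j h
    have h1 := (hf i).2
    rw [h] at h1
    have := h1.unique (hf j).2
    exact Fin.ext (by omega)
  have hsub : (fun ds => ds ++ List.replicate (m + 1) (0 : ℤ)) '' DL m u ∪ Set.range f ⊆
      DL (m + 1) (u ++ descWord (m + 1)) := by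
    rintro _ (⟨ds, ⟨k, hk1, hk2, hF⟩, rfl⟩ | ⟨j, rfl⟩)
    · refine ⟨k, hk1, by omega, ?_⟩
      rw [pr_append, one_mul, hup]
      refine hF.append ?_
      have := FT.follow (L := pr (longestPerm m) (descWord (m + 1))) (F := EndS k) (by
        rw [pr_last]
        intro p hp
        obtain ⟨c, hc, rfl⟩ := List.mem_map.1 hp
        intro h
        rw [mem_EndS] at h
        simp only at h
        omega)
      rwa [pr_length, descWord_length] at this
    · exact (hf j).1
  have h1 := Set.ncard_le_ncard hsub (DL_finite _ _)
  rw [Set.ncard_union_eq ?_ ((DL_finite m u).image _) (Set.finite_range f)] at h1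
  · have hi : Set.InjOn (fun ds => ds ++ List.replicate (m + 1) (0 : ℤ)) (DL m u) :=
      fun a _ b _ h => List.append_cancel_right h
    rw [hi.ncard_image,
      ← Set.image_univ, hinj.injOn.ncard_image, Set.ncard_univ, Nat.card_fin] at h1
    exact h1
  · rw [Set.disjoint_left]
    rintro _ ⟨ds, hds, rfl⟩ ⟨j, hj⟩
    obtain ⟨e, he⟩ := (hf j).2
    rw [he] at hj
    have h1 := congrArg (fun l => l[u.length + (j : ℕ)]?) hj
    have h2 := DL_length hds
    simp only at h1
    rw [List.getElem?_append_right (by simp), List.getElem?_append_right (by omega)] at h1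
    simp [h2, List.getElem?_replicate] at h1

lemma stepD {m : ℕ} {w w' : List ℕ} (hw : IsReduced (m + 1) w) (h : IsContractionD (m + 1) w w')
    (h0 : indD (m + 1) w = 0) :
    IsReduced m w' ∧ (DL (m + 1) w).ncard ≤ (DL m w').ncard + (m + 1) := by
  obtain ⟨u, v, h1, rfl⟩ := h
  have hne : {s | ∃ u v : List ℕ, v.length = s ∧
      TwoMoveEquiv w (u ++ descWord (m + 1) ++ v)}.Nonempty := ⟨_, u, v, rfl, h1⟩
  have h2 := Nat.sInf_mem hne
  unfold indD at h0
  rw [h0] at h2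
  obtain ⟨u', v', hv', h2⟩ := h2
  rw [List.length_eq_zero_iff] at hv'
  subst hv'
  rw [List.append_nil] at h2
  have := v_nil hw h1 h2
  subst this
  rw [List.append_nil] at h1
  simp only [List.map_nil, List.append_nil]
  have r := h1.reduced hw
  refine ⟨(reduced_u r).1, ?_⟩
  rw [h1.ncard_eq]
  exact ncard_desc_le r

lemma indA_mir {n : ℕ} {w : List ℕ} (hw : IsReduced n w) (h : ∃ u, TwoMoveEquiv w (u ++ ascWord n)) :
    ∃ u, TwoMoveEquiv (mir n w) (u ++ descWord n) := by
  obtain ⟨u, h⟩ := h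
  have := (h.mir hw.2.1).1
  rw [mir_append, mir_asc] at this
  exact ⟨_, this⟩

lemma stepA {m : ℕ} {w w' : List ℕ} (hw : IsReduced (m + 1) w) (h : IsContractionA (m + 1) w w')
    (h0 : indA (m + 1) w = 0) :
    IsReduced m w' ∧ (DL (m + 1) w).ncard ≤ (DL m w').ncard + (m + 1) := by
  obtain ⟨u, v, h1, rfl⟩ := h
  have hne : {s | ∃ u v : List ℕ, v.length = s ∧
      TwoMoveEquiv w (u ++ ascWord (m + 1) ++ v)}.Nonempty := ⟨_, u, v, rfl, h1⟩
  have h2 := Nat.sInf_mem hne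
  unfold indA at h0
  rw [h0] at h2
  obtain ⟨u', v', hv', h2⟩ := h2
  rw [List.length_eq_zero_iff] at hv'
  subst hv'
  rw [List.append_nil] at h2
  obtain ⟨u'', h3⟩ := indA_mir hw ⟨u', h2⟩
  have h4 := h1.mir hw.2.1
  have hl := h4.2
  have h4 := h4.1
  rw [mir_append, mir_append, mir_asc] at h4
  have hc : IsContractionD (m + 1) (mir (m + 1) w) (mir m (u.map (· - 1) ++ v)) := by
    refine ⟨_, _, h4, ?_⟩
    rw [mir_append]
    congr 1
    · simp only [mir, List.map_map]
      apply List.map_congr_left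
      intro a ha
      have := hl a (by simp [ha])
      simp only [Function.comp]; omega
    · simp only [mir, List.map_map]
      apply List.map_congr_left
      intro a ha
      have := hl a (by simp [ha])
      simp only [Function.comp]; omega
  have hi : indD (m + 1) (mir (m + 1) w) = 0 := by
    unfold indD
    rw [Nat.sInf_eq_zero]
    left
    exact ⟨u'', [], rfl, by simpa using h3⟩
  obtain ⟨r, hle⟩ := stepD hw.mir hc hi
  have := r.mir
  have hv : v = [] := by
    have := v_nil hw.mir h4 h3
    simpa [mir] using this
  subst hv
  rw [List.append_nil] at *
  have hlu : ∀ a ∈ u, 1 ≤ a := fun a ha => (hl a (by simp [ha])).1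
  have hlet := r.2.1
  have hlet2 : ∀ a ∈ u, 1 ≤ a - 1 ∧ a - 1 ≤ m := by
    intro a ha
    have h5 := hl a (by simp [ha])
    have := hlet (m + 1 - (a - 1)) (by
      simp only [mir, List.mem_map, exists_exists_and_eq_and]
      exact ⟨a, ha, rfl⟩)
    omega
  have hmm : ∀ a ∈ u.map (· - 1), 1 ≤ a ∧ a ≤ m := by
    intro a ha
    obtain ⟨b, hb, rfl⟩ := List.mem_map.1 ha
    exact hlet2 b hb
  rw [mir_mir hmm] at this
  refine ⟨this, ?_⟩
  rw [DL_mir hw.2.1, DL_mir hmm] at hle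
  exact hle

lemma simplicial_ncard {n : ℕ} {w : List ℕ} (hw : IsReduced n w) (h : SimplicialWord n w) :
    (DL n w).ncard ≤ n * (n + 1) / 2 := by
  induction n generalizing w with
  | zero =>
    have : DL 0 w = ∅ := by
      ext ds; simp only [DL, Set.mem_empty_iff_false, iff_false]
      rintro ⟨k, h1, h2, -⟩; omega
    rw [this]; simp
  | succ m ih =>
    obtain ⟨σ, c, rfl, h⟩ := h
    have hs : SimplicialWord m (c m) := ⟨σ, c, rfl, fun k h1 h2 => h k h1 (by omega)⟩
    have h1 := h (m + 1) (by omega) le_rfl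
    rw [Nat.add_sub_cancel] at h1
    have key : IsReduced m (c m) ∧ (DL (m + 1) (c (m + 1))).ncard ≤ (DL m (c m)).ncard + (m + 1) := by
      split_ifs at h1
      · exact stepD hw h1.1 h1.2
      · exact stepA hw h1.1 h1.2
    have := ih key.1 hs
    have e : (m + 1) * (m + 1 + 1) = m * (m + 1) + 2 * (m + 1) := by ring
    omega

/-! ### Minimal number of trails forces a simplicial word -/

lemma FT_k_unique {n k k' : ℕ} {w : List ℕ} (hw : IsReduced n w) (hk1 : 1 ≤ k) (hk2 : k ≤ n)
    (hk1' : 1 ≤ k') (hk2' : k' ≤ n) {ds : List ℤ}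
    (h : FT (pr 1 w) (Set.Iic k) (EndS k) ds) (h' : FT (pr 1 w) (Set.Iic k') (EndS k') ds) :
    k = k' := by
  obtain ⟨Fs, h0, h1, -, hT⟩ := FT_pr_iff.1 h
  obtain ⟨Fs', h0', h1', -, hT'⟩ := FT_pr_iff.1 h'
  have e1 := YL_eq hw hT h0 rfl le_rfl (n + 1 - k)
  have e2 := YL_eq hw hT' h0' rfl le_rfl (n + 1 - k)
  rw [e1, Yc_end hw hk1 hk2 h1, Yc_end hw hk1' hk2' h1', if_pos rfl] at e2
  split_ifs at e2 with h
  · omega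
  · norm_num at e2

lemma pr_before {π : Equiv.Perm ℕ} {w : List ℕ} (h : Red π w) {p : ℕ × ℕ} (hp : p ∈ pr π w) :
    π.symm p.1 < π.symm p.2 := by
  have hlt := h.pr_lt p hp
  obtain ⟨u, a, v, rfl, rfl⟩ := mem_pr.1 hp
  rw [Red_append] at h
  by_contra hcon
  have hne : π.symm ((π * wordProd u) a) ≠ π.symm ((π * wordProd u) (a + 1)) := by
    intro he; have := π.symm.injective he; simp only at hlt; omega
  have := h.1.inv_stay hlt (by simp only at hcon ⊢; omega)
  simp only [Equiv.symm_apply_apply] at this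
  omega

lemma pr_after {π : Equiv.Perm ℕ} {w : List ℕ} (h : Red π w) {p : ℕ × ℕ} (hp : p ∈ pr π w) :
    (π * wordProd w).symm p.2 < (π * wordProd w).symm p.1 := by
  have hlt := h.pr_lt p hp
  obtain ⟨u, a, v, rfl, rfl⟩ := mem_pr.1 hp
  rw [Red_append] at h
  have := h.2.2.inv_stay hlt (by
    simp only
    rw [mul_sTrans_symm, mul_sTrans_symm, Equiv.symm_apply_apply, Equiv.symm_apply_apply,
      sTrans_left, sTrans_right]
    omega)
  rw [wordProd_append, wordProd_cons]
  simpa only [mul_assoc] using this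

lemma FT.follow' {π : Equiv.Perm ℕ} {w : List ℕ} {F : Set ℕ}
    (h : ∀ p ∈ pr π w, p.2 ∈ F → p.1 ∈ F) : FT (pr π w) F F (List.replicate w.length 0) := by
  have := FT.follow h
  rwa [pr_length] at this

/-- two different trails with the same leading node -/
lemma two_trails {n : ℕ} {w : List ℕ} (hw : IsReduced n w) (hN : (DL n w).ncard = w.length)
    {x : List ℤ} {j : ℕ} {d d' : ℤ} {e e' : List ℤ}
    (h : List.replicate j 0 ++ 1 :: (x ++ d :: e) ∈ DL n w)
    (h' : List.replicate j 0 ++ 1 :: (x ++ d' :: e') ∈ DL n w) : d = d' := by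
  have := lead_unique hw hN h h' ⟨_, rfl⟩ ⟨_, rfl⟩
  have := List.append_cancel_left this
  rw [List.cons.injEq] at this
  have := List.append_cancel_left this.2
  rw [List.cons.injEq] at this
  exact this.1

lemma coreA_step {n : ℕ} {u v : List ℕ} {p : ℕ} (hw : IsReduced n (u ++ p :: v))
    (hN : (DL n (u ++ p :: v)).ncard = (u ++ p :: v).length) (hp2 : 2 ≤ p)
    (h1 : wordProd u p = 1) (hj : ∀ j, 1 ≤ j → j < p → wordProd u j = n + 2 - j) :
    wordProd u (p + 1) = n + 2 - p := by
  by_contra hb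
  set π := wordProd u with hπ
  have hu : ∀ a ∈ u, 1 ≤ a ∧ a ≤ n := fun a ha => hw.2.1 a (by simp [ha])
  have hpn := (hw.2.1 p (by simp)).2
  obtain ⟨b1, b2, b3⟩ := state_bounds hw
  rw [← hπ] at b1 b2 b3
  set b := π (p + 1) with hbdef
  set g := n + 2 - p with hg
  have hblt : b < g := by
    by_contra hcon
    have hj2 := hj (n + 2 - b) (by omega) (by omega)
    have : π (n + 2 - b) = π (p + 1) := by rw [hj2]; omega
    have := π.injective this
    omega
  have posb : π.symm b = p + 1 := by rw [hbdef, Equiv.symm_apply_apply]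
  have pos1 : π.symm 1 = p := by rw [← h1, Equiv.symm_apply_apply]
  have posg1 : π.symm (g + 1) = p - 1 := by
    rw [← eq_iff_pos, hj (p - 1) (by omega) (by omega)]; omega
  have poss : ∀ s, 1 < s → s ≠ b → s ≤ g → p + 1 < π.symm s := by
    intro s hs1 hs2 hs3
    have hr := wordProd_symm_range hu (x := s) (by omega)
    rw [← hπ] at hr
    by_contra hcon
    have hcase : π.symm s < p ∨ π.symm s = p ∨ π.symm s = p + 1 := by omega
    rcases hcase with hc | hc | hc
    · have := hj (π.symm s) (by omega) hc
      rw [Equiv.apply_symm_apply] at this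
      omega
    · rw [← pos1] at hc; have := π.symm.injective hc; omega
    · rw [← posb] at hc; exact hs2 (π.symm.injective hc)
  -- the node of the pair (b, g+1)
  obtain ⟨x, a, y, hxy, e1, e2⟩ := exists_cross (π := 1) (w := u) (x := b) (y := g + 1)
    (show b < g + 1 by omega) (by rw [one_mul, ← hπ, posg1, posb]; omega)
  rw [one_mul] at e1 e2
  subst hxy
  have hw' := hw
  have hN' := hN
  rw [List.append_assoc, List.cons_append] at hw' hN'
  have hs := hw'.suffix
  have hRed := hs.1.2
  rw [Red_append] at hRed
  have hπ' : wordProd x * sTrans a * wordProd y = π := by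
    rw [hπ, wordProd_append, wordProd_cons, mul_assoc]
  rw [hπ'] at hRed
  have hend : π * sTrans p * wordProd v = longestPerm n := by
    rw [mul_assoc, ← wordProd_cons]; exact hw.suffix.2
  -- follow y
  have f1 : FT (pr (wordProd x * sTrans a) y) (Fqp g b (g + 1)) (Fqp g b (g + 1))
      (List.replicate y.length 0) := by
    apply FT.follow'
    intro q hq hq2
    have q1 := hRed.1.pr_lt q hq
    have q2 := pr_before hRed.1 hq
    have q3 := pr_after hRed.1 hq
    rw [hπ'] at q3
    rw [mem_Fqp] at hq2 ⊢
    by_contra hcon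
    have hqb : q.1 = b := by omega
    by_cases hs1 : q.2 = g + 1
    · rw [hqb, hs1, mul_sTrans_symm, mul_sTrans_symm, ← e1, ← e2, Equiv.symm_apply_apply,
        Equiv.symm_apply_apply, sTrans_left, sTrans_right] at q2
      omega
    · have := poss q.2 (by omega) (by omega) (by omega)
      rw [hqb, posb] at q3
      omega
  have hpg : ∀ s, (π * sTrans p).symm s = sTrans p (π.symm s) := fun s => mul_sTrans_symm π p s
  have s1 : (π * sTrans p).symm 1 = p + 1 := by rw [hpg, pos1, sTrans_left]
  have sb : (π * sTrans p).symm b = p := by rw [hpg, posb, sTrans_right]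
  have sg1 : (π * sTrans p).symm (g + 1) = p - 1 := by
    rw [hpg, posg1, sTrans_of_ne (by omega) (by omega)]
  have sg : p + 1 < (π * sTrans p).symm g := by
    have := poss g (by omega) (by omega) le_rfl
    rw [hpg, sTrans_of_ne (by omega) (by omega)]; exact this
  obtain ⟨ds0, hd0⟩ := completion (n := n) (k := g) (by omega) (by omega) (w := v) (q := b) (p := g + 1)
    hRed.2.2 hend (by omega) (by omega) (by omega) (by omega) le_rfl
  obtain ⟨ds1, hd1⟩ := completion (n := n) (k := g) (by omega) (by omega) (w := v) (q := 1) (p := g + 1)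
    hRed.2.2 hend (by omega) (by omega) (by omega) (by omega) le_rfl
  have st0 : StepF 1 b (Fqp g b (g + 1)) (Fqp g b (g + 1)) 0 := by
    left; refine ⟨rfl, rfl, fun _ => ?_⟩
    rw [mem_Fqp]; omega
  have st1 : StepF 1 b (Fqp g b (g + 1)) (Fqp g 1 (g + 1)) 1 := by
    rw [StepF_iff (by omega)]
    refine ⟨fun z hz1 hz2 => ?_, Or.inr (Or.inl ⟨rfl, ?_, ?_, ?_, ?_⟩)⟩ <;>
    · simp only [mem_Fqp]; omega
  have build : ∀ (d : ℤ) (G : Set ℕ) (e : List ℤ), StepF 1 b (Fqp g b (g + 1)) G d →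
      FT (pr (π * sTrans p) v) G (EndS g) e →
      List.replicate x.length 0 ++ 1 :: (List.replicate y.length 0 ++ d :: e) ∈
        DL n (x ++ a :: (y ++ p :: v)) := by
    intro d G e hst he
    refine (trail_from hw' (k := g) (by omega) (by omega) (by rw [e1]; omega) (by rw [e2]; omega) ?_).1
    rw [e1, e2, pr_append, hπ']
    refine f1.append ?_
    rw [pr, h1, ← hbdef]
    exact FT.cons hst he
  have := two_trails hw' hN' (build 0 _ ds0 st0 hd0) (build 1 _ ds1 st1 hd1)
  norm_num at this

lemma bubble_right {p : ℕ} {v : List ℕ} (h : ∀ a ∈ v, p + 1 < a) (t : List ℕ) :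
    TwoMoveEquiv (p :: (v ++ t)) (v ++ p :: t) := by
  induction v with
  | nil => exact TwoMoveEquiv.rfl'
  | cons a v ih =>
    have h1 : TwoMoveEquiv (p :: a :: (v ++ t)) (a :: p :: (v ++ t)) :=
      Relation.ReflTransGen.single ⟨[], v ++ t, p, a, Or.inl (h a (by simp)), rfl, rfl⟩
    exact h1.trans ((ih (fun b hb => h b (by simp [hb]))).append_left [a])

lemma coreA_ind {n : ℕ} {w : List ℕ} (hw : IsReduced n w) (hN : (DL n w).ncard = w.length)
    (H1 : ∀ u v, w = u ++ 1 :: v → wordProd u 1 = 1 → wordProd u 2 = n + 1) (v : List ℕ) :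
    ∀ (u : List ℕ) (p : ℕ), w = u ++ v → 1 ≤ p → p ≤ n + 1 → wordProd u p = 1 →
      (∀ j, 1 ≤ j → j < p → wordProd u j = n + 2 - j) →
      ∃ v', (∀ a ∈ v', p < a) ∧ TwoMoveEquiv v (v' ++ List.range' p (n + 1 - p)) := by
  induction v with
  | nil =>
    intro u p hwu hp hpn h1 hj
    rw [List.append_nil] at hwu
    subst hwu
    have : p = n + 1 := by
      rw [hw.2.2, longestPerm_apply, if_pos ⟨hp, hpn⟩] at h1; omega
    subst this
    exact ⟨[], by simp, by simpa using TwoMoveEquiv.rfl'⟩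
  | cons e v ih =>
    intro u p hwu hp hpn h1 hj
    subst hwu
    obtain ⟨b1, b2, b3⟩ := state_bounds hw
    have he := hw.2.1 e (by simp)
    have hsucc : u ++ e :: v = (u ++ [e]) ++ v := by simp
    rcases Nat.lt_trichotomy e p with hlt | rfl | hgt
    · exfalso
      have e1 := hj e (by omega) hlt
      by_cases hc : e + 1 = p
      · rw [hc, h1] at b2; omega
      · have e2 := hj (e + 1) (by omega) (by omega)
        omega
    · have hg : wordProd u (e + 1) = n + 2 - e := by
        by_cases h2 : e = 1
        · subst h2; rw [H1 u v rfl h1]; omega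
        · exact coreA_step hw hN (by omega) h1 hj
      obtain ⟨v', h2, h3⟩ := ih (u ++ [e]) (e + 1) hsucc (by omega) (by omega)
        (by rw [wordProd_append, Equiv.Perm.mul_apply]; simp [sTrans_right, h1])
        (by
          intro j hj1 hj2
          rw [wordProd_append, Equiv.Perm.mul_apply]
          simp only [wordProd_cons, wordProd_nil, mul_one]
          by_cases hje : j = e
          · rw [hje, sTrans_left, hg]
          · rw [sTrans_of_ne hje (by omega)]
            exact hj j hj1 (by omega))
      refine ⟨v', fun a ha => by have := h2 a ha; omega, ?_⟩
      have h4 := (h3.append_left [e]).trans (bubble_right h2 _)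
      have h5 : e :: List.range' (e + 1) (n + 1 - (e + 1)) = List.range' e (n + 1 - e) := by
        rw [← List.range'_succ]; congr 1; omega
      rw [h5] at h4
      exact h4
    · obtain ⟨v', h2, h3⟩ := ih (u ++ [e]) p hsucc (by omega) (by omega)
        (by rw [wordProd_append, Equiv.Perm.mul_apply]
            simp [sTrans_of_ne (show p ≠ e by omega) (by omega), h1])
        (by
          intro j hj1 hj2
          rw [wordProd_append, Equiv.Perm.mul_apply]
          simp only [wordProd_cons, wordProd_nil, mul_one]
          rw [sTrans_of_ne (by omega) (by omega)]
          exact hj j hj1 (by omega))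
      refine ⟨e :: v', ?_, h3.append_left [e]⟩
      intro a ha
      rcases List.mem_cons.1 ha with rfl | ha
      · exact hgt
      · exact h2 a ha

lemma asc_eq (q : ℕ) : ascWord q = List.range' 1 q := by
  apply List.ext_getElem
  · simp [ascWord]
  · intro i h1 h2
    simp [ascWord]; omega

lemma coreA {n : ℕ} {u0 v0 : List ℕ} (hw : IsReduced n (u0 ++ 1 :: v0))
    (hN : (DL n (u0 ++ 1 :: v0)).ncard = (u0 ++ 1 :: v0).length)
    (h1 : wordProd u0 1 = 1) (h2 : wordProd u0 2 = n + 1) :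
    ∃ u, TwoMoveEquiv (u0 ++ 1 :: v0) (u ++ ascWord n) := by
  obtain ⟨v', -, h⟩ := coreA_ind hw hN (by
    intro u v huv hu1
    rw [List.append_eq_append_iff] at huv
    rcases huv with ⟨as, e1, e2⟩ | ⟨bs, e1, e2⟩
    · cases as with
      | nil => rw [List.append_nil] at e1; rw [e1]; exact h2
      | cons a as =>
        exfalso
        rw [List.cons_append, List.cons.injEq] at e2
        obtain ⟨rfl, e2⟩ := e2
        subst e1
        obtain ⟨b1, b2, b3⟩ := state_bounds hw
        have hR := hw.suffix.1.2
        rw [e2, Red_append] at hR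
        have := hR.1.inv_stay (x := 1) (y := n + 1) (by omega) (by
          rw [mul_sTrans_symm, mul_sTrans_symm, (eq_iff_pos _ _ _).1 h1, (eq_iff_pos _ _ _).1 h2,
            sTrans_left, sTrans_right]; omega)
        rw [mul_assoc, ← wordProd_cons, ← wordProd_append, (eq_iff_pos _ _ _).1 hu1] at this
        have hr := wordProd_symm_range (n := n) (w := u0 ++ 1 :: as) (x := n + 1)
          (fun b hb => hw.2.1 b (by
            rw [e2]; simp only [List.mem_append, List.mem_cons] at hb ⊢; tauto)) (by omega)
        omega
    · cases bs with
      | nil => rw [List.append_nil] at e1; rw [← e1]; exact h2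
      | cons a bs =>
        exfalso
        rw [List.cons_append, List.cons.injEq] at e2
        obtain ⟨rfl, e2⟩ := e2
        subst e1
        have hw' := hw
        rw [List.append_assoc, List.cons_append] at hw'
        obtain ⟨b1, b2, b3⟩ := state_bounds hw'
        have hR := hw'.suffix.1.2
        rw [Red_append] at hR
        set b := wordProd u 2 with hb
        have hp1 := (eq_iff_pos _ _ _).1 hu1
        have hpb := (eq_iff_pos _ _ _).1 hb.symm
        have := hR.1.inv_stay (x := 1) (y := b) (by omega) (by
          rw [mul_sTrans_symm, mul_sTrans_symm, hp1, hpb,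
            sTrans_left, sTrans_right]; omega)
        rw [mul_assoc, ← wordProd_cons, ← wordProd_append, (eq_iff_pos _ _ _).1 h1] at this
        have hr := wordProd_symm_range (n := n) (w := u ++ 1 :: bs) (x := b)
          (fun b hb => hw.2.1 b (by
            simp only [List.mem_append, List.mem_cons] at hb ⊢; tauto)) (by omega)
        omega) (u0 ++ 1 :: v0) [] 1 rfl le_rfl (by omega) rfl (by intro j a b; omega)
  rw [Nat.add_sub_cancel, ← asc_eq] at h
  exact ⟨v', h⟩

lemma coreB {n k a b c : ℕ} {x y z t : List ℕ}
    (hw : IsReduced n (x ++ a :: (y ++ b :: (z ++ c :: t))))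
    (hN : (DL n (x ++ a :: (y ++ b :: (z ++ c :: t)))).ncard =
      (x ++ a :: (y ++ b :: (z ++ c :: t))).length)
    (hk1 : 1 < k) (hk2 : k < n)
    (a1 : wordProd x a = 1) (a2 : wordProd x (a + 1) = k + 1)
    (b1 : (wordProd x * sTrans a * wordProd y) b = k)
    (b2 : (wordProd x * sTrans a * wordProd y) (b + 1) = n + 1)
    (c1 : (wordProd x * sTrans a * wordProd y * sTrans b * wordProd z) c = 1)
    (c2 : (wordProd x * sTrans a * wordProd y * sTrans b * wordProd z) (c + 1) = n + 1)
    (hP : ∀ s, 1 ≤ s → s ≤ n + 1 →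
      (c + 1 ≤ (wordProd x * sTrans a * wordProd y * sTrans b * wordProd z * sTrans c).symm s ↔ s ≤ k)) :
    False := by
  set A1 := wordProd x * sTrans a with hA1
  set B0 := A1 * wordProd y with hB0
  set B1 := B0 * sTrans b with hB1
  set C0 := B1 * wordProd z with hC0
  set C1 := C0 * sTrans c with hC1
  have hs := hw.suffix
  have hRA : Red A1 (y ++ b :: (z ++ c :: t)) := hs.1.2
  have hRA' := hRA
  rw [Red_append, ← hB0] at hRA
  have hRy := hRA.1
  have hRB : Red B1 (z ++ c :: t) := hRA.2.2
  rw [Red_append, ← hC0] at hRB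
  have hRz := hRB.1
  have hRt : Red C1 t := hRB.2.2
  have hR : Red A1 (y ++ b :: (z ++ [c])) := by
    have e : y ++ b :: (z ++ c :: t) = (y ++ b :: (z ++ [c])) ++ t := by simp
    rw [e, Red_append] at hRA'
    exact hRA'.1
  have hC1R : A1 * wordProd (y ++ b :: (z ++ [c])) = C1 := by
    simp only [wordProd_append, wordProd_cons, wordProd_nil, mul_one, hC1, hC0, hB1, hB0, mul_assoc]
  have hend : C1 * wordProd t = longestPerm n := by
    rw [← hs.2]
    simp only [wordProd_append, wordProd_cons, hC1, hC0, hB1, hB0, hA1, mul_assoc]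
  have pA1 : A1.symm 1 = a + 1 := by
    rw [hA1, mul_sTrans_symm, (eq_iff_pos _ _ _).1 a1, sTrans_left]
  have pAk : A1.symm (k + 1) = a := by
    rw [hA1, mul_sTrans_symm, (eq_iff_pos _ _ _).1 a2, sTrans_right]
  have pBk : B1.symm k = b + 1 := by
    rw [hB1, mul_sTrans_symm, (eq_iff_pos _ _ _).1 b1, sTrans_left]
  have pBn : B1.symm (n + 1) = b := by
    rw [hB1, mul_sTrans_symm, (eq_iff_pos _ _ _).1 b2, sTrans_right]
  have p01 := (eq_iff_pos _ _ _).1 c1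
  have p0n := (eq_iff_pos _ _ _).1 c2
  have pC1 : C1.symm 1 = c + 1 := by rw [hC1, mul_sTrans_symm, p01, sTrans_left]
  have pCn : C1.symm (n + 1) = c := by rw [hC1, mul_sTrans_symm, p0n, sTrans_right]
  have hPk : ∀ s, 2 ≤ s → s ≤ k → c + 1 < C1.symm s := by
    intro s h1 h2
    have h3 := (hP s (by omega) (by omega)).2 h2
    have h4 : C1.symm s ≠ C1.symm 1 := fun h => by have := C1.symm.injective h; omega
    omega
  have hPl : ∀ s, k < s → s ≤ n → C1.symm s < c := by
    intro s h1 h2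
    have h3 : ¬ c + 1 ≤ C1.symm s := fun h => by
      have := (hP s (by omega) (by omega)).1 h; omega
    have h4 : C1.symm s ≠ C1.symm (n + 1) := fun h => by have := C1.symm.injective h; omega
    omega
  have pAkk : a + 1 < A1.symm k := by
    by_contra hcon
    have h4 : A1.symm k ≠ A1.symm 1 := fun h => by have := A1.symm.injective h; omega
    have := hR.inv_stay (x := 1) (y := k) hk1 (by omega)
    rw [hC1R] at this
    have := hPk k (by omega) le_rfl
    omega
  have suby : ∀ q ∈ pr A1 y, q ∈ pr A1 (y ++ b :: (z ++ [c])) := by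
    intro q hq; rw [pr_append]; simp [hq]
  have subz : ∀ q ∈ pr B1 z, q ∈ pr A1 (y ++ b :: (z ++ [c])) := by
    intro q hq; rw [pr_append, ← hB0, pr, ← hB1, pr_append]; simp [hq]
  have no1 : ∀ q ∈ pr A1 (y ++ b :: (z ++ [c])), q.1 = 1 → q.2 ≤ k + 1 → False := by
    intro q hq h1 h2
    have q1 := hR.pr_lt q hq
    have q2 := pr_before hR hq
    have q3 := pr_after hR hq
    rw [hC1R, h1] at q3
    rw [h1] at q2
    by_cases h3 : q.2 = k + 1
    · rw [h3] at q2; omega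
    · have := hPk q.2 (by omega) (by omega)
      omega
  have fol1 : ∀ q ∈ pr A1 (y ++ b :: (z ++ [c])), q.2 ∈ Fqp k 1 (k + 1) → q.1 ∈ Fqp k 1 (k + 1) := by
    intro q hq hq2
    have q1 := hR.pr_lt q hq
    rw [mem_Fqp] at hq2 ⊢
    by_contra hcon
    exact no1 q hq (by omega) (by omega)
  have fy := FT.follow' (w := y) (fun q hq => fol1 q (suby q hq))
  have fz := FT.follow' (w := z) (fun q hq => fol1 q (subz q hq))
  have t0 : StepF k (n + 1) (Fqp k 1 (k + 1)) (Fqp k 1 (k + 1)) 0 := by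
    left; refine ⟨rfl, rfl, fun h => ?_⟩
    rw [mem_Fqp] at *; omega
  have t1 : StepF 1 (n + 1) (Fqp k 1 (k + 1)) (Fqp k 1 (k + 1)) 0 := by
    left; refine ⟨rfl, rfl, fun h => ?_⟩
    rw [mem_Fqp] at *; omega
  have hl := hPl (k + 1) (by omega) (by omega)
  have hr := hPk k (by omega) le_rfl
  obtain ⟨ds0, hd0⟩ := completion (n := n) (k := k) (by omega) (by omega) (w := t) (q := 1) (p := k + 1)
    hRt hend (by omega) (by omega) (by omega) (by omega) le_rfl
  -- the second trail
  set F2 : Set ℕ := {s | (s < k ∧ s ≠ 1) ∨ s = k + 1 ∨ s = n + 1} with hF2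
  have mF2 : ∀ s, s ∈ F2 ↔ (s < k ∧ s ≠ 1) ∨ s = k + 1 ∨ s = n + 1 := fun s => Iff.rfl
  have s0 : StepF k (n + 1) (Fqp k 1 (k + 1)) F2 1 := by
    rw [StepF_iff (by omega)]
    refine ⟨fun z hz1 hz2 => ?_, Or.inr (Or.inl ⟨rfl, ?_, ?_, ?_, ?_⟩)⟩ <;>
    · simp only [mem_Fqp, mF2, or_true]; try omega
  have s1 : StepF 1 (n + 1) F2 (EndS k) (-1) := by
    rw [StepF_iff (by omega)]
    refine ⟨fun z hz1 hz2 => ?_, Or.inr (Or.inr ⟨rfl, ?_, ?_, ?_, ?_⟩)⟩ <;>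
    · simp only [mem_EndS, mF2, or_true]; try omega
  have gz : FT (pr B1 z) F2 F2 (List.replicate z.length 0) := by
    apply FT.follow'
    intro q hq hq2
    have q1 := hRz.pr_lt q hq
    have q2 := pr_before hRz hq
    have q3 := pr_after hRz hq
    rw [← hC0] at q3
    have q4 := pr_before hR (subz q hq)
    have q5 := pr_after hR (subz q hq)
    rw [hC1R] at q5
    rw [mF2] at hq2 ⊢
    by_contra hcon
    by_cases e1 : q.1 = 1
    · by_cases e2 : q.2 = n + 1
      · rw [e1, e2] at q3; omega
      · exact no1 q (subz q hq) e1 (by omega)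
    · have hq0 : q.1 = k ∨ (k + 1 < q.1 ∧ q.2 = n + 1) := by omega
      rcases hq0 with e2 | ⟨e2, e3⟩
      · have : q.2 = k + 1 ∨ q.2 = n + 1 := by omega
        rcases this with e3 | e3
        · rw [e2, e3] at q4; omega
        · rw [e2, e3] at q2; omega
      · rw [e3, pCn] at q5
        have := hPl q.1 (by omega) (by omega)
        omega
  have gt : FT (pr C1 t) (EndS k) (EndS k) (List.replicate t.length 0) := by
    apply FT.follow'
    intro q hq hq2
    have q1 := hRt.pr_lt q hq
    have q2 := pr_before hRt hq
    rw [mem_EndS] at hq2 ⊢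
    by_contra hcon
    have e1 : q.1 = k := by omega
    have e2 : q.2 = k + 1 := by omega
    rw [e1, e2] at q2
    omega
  have build : ∀ (d d' : ℤ) (G H : Set ℕ) (e : List ℤ), StepF k (n + 1) (Fqp k 1 (k + 1)) G d →
      FT (pr B1 z) G G (List.replicate z.length 0) → StepF 1 (n + 1) G H d' →
      FT (pr C1 t) H (EndS k) e →
      List.replicate x.length 0 ++ 1 :: (List.replicate y.length 0 ++ d ::
        (List.replicate z.length 0 ++ d' :: e)) ∈
        DL n (x ++ a :: (y ++ b :: (z ++ c :: t))) := by
    intro d d' G H e h1 h2 h3 h4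
    refine (trail_from hw (k := k) (by omega) (by omega) (by rw [a1]; omega) (by rw [a2]; omega) ?_).1
    rw [a1, a2, pr_append, ← hA1, ← hB0]
    refine fy.append ?_
    rw [pr, b1, b2, ← hB1]
    refine FT.cons h1 ?_
    rw [pr_append, ← hC0]
    refine h2.append ?_
    rw [pr, c1, c2, ← hC1]
    exact FT.cons h3 h4
  have := two_trails hw hN (build 0 0 _ _ ds0 t0 fz t1 hd0) (build 1 (-1) _ _ _ s0 gz s1 gt)
  norm_num at this

lemma coreB' {n k a b c : ℕ} {u0 x y x2 z t : List ℕ}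
    (hw : IsReduced n (u0 ++ c :: t))
    (hN : (DL n (u0 ++ c :: t)).ncard = (u0 ++ c :: t).length)
    (hk1 : 1 < k) (hk2 : k < n) (hx : u0 = x ++ a :: y) (hx2 : u0 = x2 ++ b :: z)
    (hlen : x.length < x2.length)
    (a1 : wordProd x a = 1) (a2 : wordProd x (a + 1) = k + 1)
    (b1 : wordProd x2 b = k) (b2 : wordProd x2 (b + 1) = n + 1)
    (c1 : wordProd u0 c = 1) (c2 : wordProd u0 (c + 1) = n + 1)
    (hP : ∀ s, 1 ≤ s → s ≤ n + 1 → (c + 1 ≤ (wordProd u0 * sTrans c).symm s ↔ s ≤ k)) :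
    False := by
  have h := hx.symm.trans hx2
  rw [List.append_eq_append_iff] at h
  rcases h with ⟨as, e1, e2⟩ | ⟨bs, e1, e2⟩
  · cases as with
    | nil => rw [List.append_nil] at e1; rw [e1] at hlen; omega
    | cons a' as =>
      rw [List.cons_append, List.cons.injEq] at e2
      obtain ⟨rfl, rfl⟩ := e2
      subst hx
      have ew : x ++ a :: (as ++ b :: z) ++ c :: t = x ++ a :: (as ++ b :: (z ++ c :: t)) := by simp
      have ep : wordProd (x ++ a :: (as ++ b :: z)) =
          wordProd x * sTrans a * wordProd as * sTrans b * wordProd z := by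
        simp only [wordProd_append, wordProd_cons, mul_assoc]
      have ep2 : wordProd x2 = wordProd x * sTrans a * wordProd as := by
        rw [e1]; simp only [wordProd_append, wordProd_cons, mul_assoc]
      rw [ew] at hw hN
      rw [ep] at c1 c2 hP
      rw [ep2] at b1 b2
      exact coreB hw hN hk1 hk2 a1 a2 b1 b2 c1 c2 hP
  · rw [e1, List.length_append] at hlen; omega

lemma mir_apply {n a : ℕ} {u : List ℕ} (hu : ∀ a ∈ u, 1 ≤ a ∧ a ≤ n) (ha : 1 ≤ a ∧ a ≤ n) :
    wordProd (mir n u) (n + 1 - a) = longestPerm n (wordProd u (a + 1)) ∧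
    wordProd (mir n u) (n + 1 - a + 1) = longestPerm n (wordProd u a) := by
  rw [wordProd_mir hu]
  simp only [Equiv.Perm.mul_apply]
  constructor
  · congr 2
    rw [longestPerm_apply, if_pos (by omega)]; omega
  · congr 2
    rw [longestPerm_apply, if_pos (by omega)]; omega

lemma mir_symm_apply {n : ℕ} {u : List ℕ} (hu : ∀ a ∈ u, 1 ≤ a ∧ a ≤ n) (s : ℕ) :
    (wordProd (mir n u)).symm s = longestPerm n ((wordProd u).symm (longestPerm n s)) := by
  rw [wordProd_mir hu, mul_symm_apply', mul_symm_apply', longestPerm_symm]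

lemma core {n : ℕ} (hn : 1 ≤ n) {w : List ℕ} (hw : IsReduced n w)
    (hN : (DL n w).ncard = w.length) :
    (∃ u, TwoMoveEquiv w (u ++ ascWord n)) ∨ (∃ u, TwoMoveEquiv w (u ++ descWord n)) := by
  obtain ⟨u0, c, t, rfl, c1, c2⟩ := exists_cross (π := 1) (w := w) (x := 1) (y := n + 1)
    (show 1 < n + 1 by omega) (by
      rw [one_mul, hw.2.2, longestPerm_symm, longestPerm_apply, longestPerm_apply,
        if_pos (by omega), if_pos (by omega)]; omega)
  rw [one_mul] at c1 c2
  have hu : ∀ a ∈ u0, 1 ≤ a ∧ a ≤ n := fun a ha => hw.2.1 a (by simp [ha])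
  have hc := hw.2.1 c (by simp)
  have p1 := (eq_iff_pos _ _ _).1 c1
  have pn := (eq_iff_pos _ _ _).1 c2
  set C := wordProd u0 * sTrans c with hC
  have hCs : ∀ s, C.symm s = sTrans c ((wordProd u0).symm s) := fun s => by rw [hC, mul_sTrans_symm]
  have q1 : C.symm 1 = c + 1 := by rw [hCs, p1, sTrans_left]
  have qn : C.symm (n + 1) = c := by rw [hCs, pn, sTrans_right]
  have huniq : ∀ k k', 1 ≤ k → k ≤ n → 1 ≤ k' → k' ≤ n → c + 1 ≤ C.symm k → C.symm (k + 1) ≤ c →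
      c + 1 ≤ C.symm k' → C.symm (k' + 1) ≤ c → k = k' := by
    intro k k' h1 h2 h3 h4 h5 h6 h7 h8
    obtain ⟨ds, hd⟩ := canonical_k hw h1 h2 (by omega) (by omega) h5 h6
    obtain ⟨ds', hd'⟩ := canonical_k hw h3 h4 (by omega) (by omega) h7 h8
    have := lead_unique hw hN ⟨k, h1, h2, hd⟩ ⟨k', h3, h4, hd'⟩ ⟨_, rfl⟩ ⟨_, rfl⟩
    rw [this] at hd
    exact FT_k_unique hw h1 h2 h3 h4 hd hd'
  obtain ⟨k, hk1, hk2, hk3, hk4⟩ := exists_k (P := fun s => c + 1 ≤ C.symm s) (r := 1) (s := n + 1)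
    (by omega) (by omega) (by omega)
  have hP : ∀ s, 1 ≤ s → s ≤ n + 1 → (c + 1 ≤ C.symm s ↔ s ≤ k) := by
    intro s hs1 hs2
    constructor
    · intro hs3
      by_contra hcon
      by_cases hs : s = n + 1
      · rw [hs] at hs3; omega
      obtain ⟨k', h1, h2, h3, h4⟩ := exists_k (P := fun s => c + 1 ≤ C.symm s) (r := s) (s := n + 1)
        (by omega) hs3 (by omega)
      have := huniq k k' (by omega) (by omega) (by omega) (by omega) hk3 (by omega) h3 (by omega)
      omega
    · intro hs3
      by_contra hcon
      by_cases hs : s = 1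
      · rw [hs] at hcon; omega
      obtain ⟨k', h1, h2, h3, h4⟩ := exists_k (P := fun s => c + 1 ≤ C.symm s) (r := 1) (s := s)
        (by omega) (by omega) hcon
      have := huniq k k' (by omega) (by omega) (by omega) (by omega) hk3 (by omega) h3 (by omega)
      omega
  have hCr : ∀ s, 1 ≤ s → s ≤ n + 1 → 1 ≤ C s ∧ C s ≤ n + 1 := by
    intro s h1 h2
    have := wordProd_range (n := n) (w := u0 ++ [c]) (x := s) (by
      intro a ha; apply hw.2.1; simp only [List.mem_append, List.mem_cons] at ha ⊢; tauto) ⟨h1, h2⟩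
    rw [wordProd_append, wordProd_cons, wordProd_nil, mul_one] at this
    exact this
  have mw := hw.mir
  have mN : (DL n (mir n (u0 ++ c :: t))).ncard = (mir n (u0 ++ c :: t)).length := by
    rw [DL_mir hw.2.1, hN]; simp [mir]
  have ew : mir n (u0 ++ c :: t) = mir n u0 ++ (n + 1 - c) :: mir n t := by simp [mir]
  have mc := mir_apply hu hc
  rw [c1, c2] at mc
  have l1 : longestPerm n 1 = n + 1 := by rw [longestPerm_apply, if_pos (by omega)]; omega
  have ln : longestPerm n (n + 1) = 1 := by rw [longestPerm_apply, if_pos (by omega)]; omega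
  rw [l1, ln] at mc
  by_cases hkn : k = n
  · left
    have hc1 : c = 1 := by
      by_contra hne
      have h1 := (hP (C 1) (hCr 1 le_rfl (by omega)).1 (hCr 1 le_rfl (by omega)).2)
      rw [Equiv.symm_apply_apply] at h1
      have h2 := (hCr 1 le_rfl (by omega)).2
      have h3 : C 1 ≠ n + 1 := by
        intro h; rw [eq_iff_pos, qn] at h; omega
      omega
    subst hc1
    exact coreA hw hN c1 c2
  by_cases hk1' : k = 1
  · right
    have hcn : c = n := by
      by_contra hne
      have h1 := (hP (C (n + 1)) (hCr (n + 1) (by omega) le_rfl).1 (hCr (n + 1) (by omega) le_rfl).2)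
      rw [Equiv.symm_apply_apply] at h1
      have h2 := (hCr (n + 1) (by omega) le_rfl).1
      have h3 : C (n + 1) ≠ 1 := by
        intro h; rw [eq_iff_pos, q1] at h; omega
      omega
    rw [ew] at mw mN
    have e1 : n + 1 - c = 1 := by omega
    rw [e1] at mw mN mc ew
    obtain ⟨u, hu'⟩ := coreA mw mN mc.1 mc.2
    rw [← ew] at hu'
    have := (hu'.mir (mir_letters hw.2.1)).1
    rw [mir_mir hw.2.1, mir_append, mir_asc] at this
    exact ⟨_, this⟩
  exfalso
  -- the two nodes
  have hk2n : k < n := by omega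
  have pk1 : (wordProd u0).symm (k + 1) < c := by
    have h1 : ¬ c + 1 ≤ C.symm (k + 1) := fun h => by
      have := (hP (k + 1) (by omega) (by omega)).1 h; omega
    have h2 : (wordProd u0).symm (k + 1) ≠ (wordProd u0).symm 1 := fun h => by
      have := (wordProd u0).symm.injective h; omega
    have h3 : (wordProd u0).symm (k + 1) ≠ (wordProd u0).symm (n + 1) := fun h => by
      have := (wordProd u0).symm.injective h; omega
    rw [hCs, sTrans_of_ne (by omega) (by omega)] at h1
    omega
  have pk : c + 1 < (wordProd u0).symm k := by
    have h1 := (hP k (by omega) (by omega)).2 le_rfl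
    have h2 : (wordProd u0).symm k ≠ (wordProd u0).symm 1 := fun h => by
      have := (wordProd u0).symm.injective h; omega
    have h3 : (wordProd u0).symm k ≠ (wordProd u0).symm (n + 1) := fun h => by
      have := (wordProd u0).symm.injective h; omega
    rw [hCs, sTrans_of_ne (by omega) (by omega)] at h1
    omega
  obtain ⟨x, a, y, hx, a1, a2⟩ := exists_cross (π := 1) (w := u0) (x := 1) (y := k + 1)
    (show 1 < k + 1 by omega) (by rw [one_mul]; omega)
  obtain ⟨x2, b, z, hx2, b1, b2⟩ := exists_cross (π := 1) (w := u0) (x := k) (y := n + 1)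
    (show k < n + 1 by omega) (by rw [one_mul]; omega)
  rw [one_mul] at a1 a2 b1 b2
  rcases Nat.lt_trichotomy x.length x2.length with hlt | heq | hgt
  · exact coreB' hw hN (by omega) hk2n hx hx2 hlt a1 a2 b1 b2 c1 c2 hP
  · obtain ⟨rfl, h2⟩ := List.append_inj (hx.symm.trans hx2) heq
    rw [List.cons.injEq] at h2
    rw [h2.1, b1] at a1
    omega
  · rw [ew] at mw mN
    have ha := hu a (by rw [hx]; simp)
    have hb := hu b (by rw [hx2]; simp)
    have ma := mir_apply (u := x) (fun d hd => hu d (by rw [hx]; simp [hd])) ha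
    have mb := mir_apply (u := x2) (fun d hd => hu d (by rw [hx2]; simp [hd])) hb
    have lk : longestPerm n k = n + 1 - k + 1 := by rw [longestPerm_apply, if_pos (by omega)]; omega
    have lk1 : longestPerm n (k + 1) = n + 1 - k := by
      rw [longestPerm_apply, if_pos (by omega)]; omega
    rw [a1, a2, l1, lk1] at ma
    rw [b1, b2, ln, lk] at mb
    refine coreB' (k := n + 1 - k) (x := mir n x2) (x2 := mir n x) (a := n + 1 - b) (b := n + 1 - a)
      (y := mir n z) (z := mir n y) mw mN (by omega) (by omega)
      (by rw [hx2]; simp [mir]) (by rw [hx]; simp [mir]) (by simpa [mir] using hgt)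
      mb.1 mb.2 ma.1 ma.2 mc.1 mc.2 ?_
    intro s hs1 hs2
    have hmu : wordProd (mir n u0) * sTrans (n + 1 - c) = wordProd (mir n (u0 ++ [c])) := by
      rw [mir_append, wordProd_append]; simp [mir]
    rw [hmu, mir_symm_apply (by
      intro a ha; apply hw.2.1; simp only [List.mem_append, List.mem_cons] at ha ⊢; tauto)]
    have hCe : wordProd (u0 ++ [c]) = C := by
      rw [wordProd_append, wordProd_cons, wordProd_nil, mul_one]
    rw [hCe]
    have ls : longestPerm n s = n + 2 - s := by rw [longestPerm_apply, if_pos (by omega)]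
    rw [ls]
    have h1 := hP (n + 2 - s) (by omega) (by omega)
    have h2 := wordProd_symm_range (n := n) (w := u0 ++ [c]) (x := n + 2 - s) (by
      intro a ha; apply hw.2.1; simp only [List.mem_append, List.mem_cons] at ha ⊢; tauto) (by omega)
    rw [hCe] at h2
    rw [longestPerm_apply, if_pos h2]
    omega

lemma simplicial_of_ncard {n : ℕ} {w : List ℕ} (hw : IsReduced n w)
    (hN : (DL n w).ncard = w.length) : SimplicialWord n w := by
  induction n generalizing w with
  | zero => exact ⟨fun _ => true, fun _ => w, rfl, fun k h1 h2 => by omega⟩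
  | succ m ih =>
    have ext : ∀ (w' : List ℕ) (b : Bool), SimplicialWord m w' →
        (if b then IsContractionD (m + 1) w w' ∧ indD (m + 1) w = 0
          else IsContractionA (m + 1) w w' ∧ indA (m + 1) w = 0) → SimplicialWord (m + 1) w := by
      rintro w' b ⟨σ, c, hc, h⟩ hb
      refine ⟨fun k => if k = m + 1 then b else σ k, fun k => if k = m + 1 then w else c k,
        by simp, ?_⟩
      intro k hk1 hk2
      by_cases hk : k = m + 1
      · subst hk
        simpa [hc] using hb
      · have h1 := h k hk1 (by omega)
        have h2 : k - 1 ≠ m + 1 := by omega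
        simpa [hk, h2] using h1
    have eN : (m + 1) * (m + 1 + 1) = m * (m + 1) + 2 * (m + 1) := by ring
    have hlen := hw.1
    rcases core (by omega) hw hN with ⟨u, h⟩ | ⟨u, h⟩
    · have hm := (h.mir hw.2.1).1
      have hl := (h.mir hw.2.1).2
      rw [mir_append, mir_asc] at hm
      have r := hm.reduced hw.mir
      obtain ⟨hu, -⟩ := reduced_u r
      have hc := ncard_desc_ge r
      rw [← hm.ncard_eq, DL_mir hw.2.1] at hc
      have e1 : u.map (· - 1) = mir m (mir (m + 1) u) := by
        simp only [mir, List.map_map]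
        apply List.map_congr_left
        intro a ha
        have := hl a (by simp [ha])
        simp only [Function.comp]; omega
      have hge := DL_ncard_ge hu
      have := hu.1
      have hs : SimplicialWord m (u.map (· - 1)) := by
        apply ih
        · rw [e1]; exact hu.mir
        · rw [e1, DL_mir hu.2.1]
          have e2 : (mir m (mir (m + 1) u)).length = (mir (m + 1) u).length := by simp [mir]
          rw [e2]
          omega
      refine ext _ false hs ?_
      simp only [Bool.false_eq_true, if_false]
      refine ⟨⟨u, [], by simpa using h, by simp⟩, ?_⟩
      unfold indA
      rw [Nat.sInf_eq_zero]
      left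
      exact ⟨u, [], rfl, by simpa using h⟩
    · have r := h.reduced hw
      obtain ⟨hu, -⟩ := reduced_u r
      have hc := ncard_desc_ge r
      rw [← h.ncard_eq] at hc
      have hge := DL_ncard_ge hu
      have := hu.1
      have hs : SimplicialWord m u := ih hu (by omega)
      refine ext _ true hs ?_
      simp only [if_true]
      refine ⟨⟨u, [], by simpa using h, by simp⟩, ?_⟩
      unfold indD
      rw [Nat.sInf_eq_zero]
      left
      exact ⟨u, [], rfl, by simpa using h⟩

/-! ### Rigorous paths as walks along edges -/

/-- height of the edge of wire `r` entering node of index `i` -/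
def ent (k i r : ℕ) : ℕ := if r ≤ k then i + 1 else i

/-- height of the edge of wire `r` leaving node of index `i` -/
def ext (k i r : ℕ) : ℕ := if r ≤ k then i else i + 1

/-- walks along edges, recording switches and passes -/
inductive WK (w : List ℕ) (k : ℕ) : ℕ → ℕ → List ℕ → List (ℕ × ℕ × ℕ) → Prop
  | fin : WK w k (k + 1) w.length [] []
  | go {i r : ℕ} {ms : List ℕ} {ps : List (ℕ × ℕ × ℕ)} (hi : i < w.length)
      (hf : NodeOnWire w (i + 1) r → ¬ Forbidden w k (i + 1) r)
      (t : WK w k r (ext k i r) ms ps) : WK w k r (ent k i r) ms ((i, r, r) :: ps)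
  | sw {i r : ℕ} {ms : List ℕ} {ps : List (ℕ × ℕ × ℕ)} (hi : i < w.length)
      (hon : NodeOnWire w (i + 1) r)
      (t : WK w k (otherWire w (i + 1) r) (ext k i (otherWire w (i + 1) r)) ms ps) :
      WK w k r (ent k i r) ((i + 1) :: ms) ((i, r, otherWire w (i + 1) r) :: ps)

/-- visited nodes of a list of passes -/
def vis (w : List ℕ) (ps : List (ℕ × ℕ × ℕ)) : List ℕ :=
  (ps.filter (fun p => decide (NodeOnWire w (p.1 + 1) p.2.1))).map (fun p => p.1 + 1)

lemma vis_cons (w : List ℕ) (i r o : ℕ) (ps : List (ℕ × ℕ × ℕ)) :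
    vis w ((i, r, o) :: ps) = (if NodeOnWire w (i + 1) r then [i + 1] else []) ++ vis w ps := by
  unfold vis
  by_cases h : NodeOnWire w (i + 1) r <;> simp [h]

lemma mem_nodesOn {w : List ℕ} {r j : ℕ} :
    j ∈ nodesOn w r ↔ (1 ≤ j ∧ j ≤ w.length) ∧ NodeOnWire w j r := by
  simp only [nodesOn, List.mem_filter, List.mem_map, List.mem_range, decide_eq_true_eq]
  constructor
  · rintro ⟨⟨a, ha, rfl⟩, h⟩; exact ⟨by omega, h⟩
  · rintro ⟨h1, h⟩; exact ⟨⟨j - 1, by omega, by omega⟩, h⟩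

lemma nodesOn_nodup (w : List ℕ) (r : ℕ) : (nodesOn w r).Nodup := by
  unfold nodesOn
  apply List.Nodup.filter
  exact (List.nodup_range).map (fun a b h => by simpa using h)

lemma filt_step {w : List ℕ} {r i : ℕ} (hi : i < w.length) {p q : ℕ → Bool}
    (h1 : ∀ j, 1 ≤ j → j ≤ w.length → (p j = true ↔ q j = true ∨ j = i + 1))
    (h2 : ¬ q (i + 1) = true) :
    ((nodesOn w r).filter p).Perm
      ((if NodeOnWire w (i + 1) r then [i + 1] else []) ++ (nodesOn w r).filter q) := by
  rw [List.perm_ext_iff_of_nodup ((nodesOn_nodup w r).filter _)]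
  · intro j
    by_cases h : NodeOnWire w (i + 1) r
    · simp only [h, if_true, List.mem_append, List.mem_singleton, List.mem_filter, mem_nodesOn]
      constructor
      · rintro ⟨⟨ha, hb⟩, hc⟩
        rcases (h1 j ha.1 ha.2).1 hc with hq | rfl
        · exact Or.inr ⟨⟨ha, hb⟩, hq⟩
        · exact Or.inl rfl
      · rintro (rfl | ⟨⟨ha, hb⟩, hc⟩)
        · exact ⟨⟨by omega, h⟩, (h1 _ (by omega) (by omega)).2 (Or.inr rfl)⟩
        · exact ⟨⟨ha, hb⟩, (h1 _ ha.1 ha.2).2 (Or.inl hc)⟩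
    · simp only [h, if_false, List.nil_append, List.mem_filter, mem_nodesOn]
      constructor
      · rintro ⟨⟨ha, hb⟩, hc⟩
        rcases (h1 j ha.1 ha.2).1 hc with hq | rfl
        · exact ⟨⟨ha, hb⟩, hq⟩
        · exact absurd hb h
      · rintro ⟨⟨ha, hb⟩, hc⟩
        exact ⟨⟨ha, hb⟩, (h1 _ ha.1 ha.2).2 (Or.inl hc)⟩
  · by_cases h : NodeOnWire w (i + 1) r
    · simp only [h, if_true, List.singleton_append, List.nodup_cons]
      refine ⟨?_, (nodesOn_nodup w r).filter _⟩
      rw [List.mem_filter]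
      exact fun h => h2 h.2
    · simpa only [h, if_false, List.nil_append] using (nodesOn_nodup w r).filter _

lemma filt_none {w : List ℕ} {r : ℕ} {p : ℕ → Bool}
    (h1 : ∀ j, 1 ≤ j → j ≤ w.length → ¬ p j = true) : (nodesOn w r).filter p = [] := by
  rw [List.filter_eq_nil_iff]
  intro j hj
  rw [mem_nodesOn] at hj
  exact h1 j hj.1.1 hj.1.2

/-- segment of a wire -/
def sg (w : List ℕ) (r lo hi : ℕ) : List ℕ :=
  (nodesOn w r).filter (fun j => decide (lo < j ∧ j ≤ hi))

lemma mem_sg {w : List ℕ} {r lo hi j : ℕ} : j ∈ sg w r lo hi ↔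
    ((1 ≤ j ∧ j ≤ w.length) ∧ NodeOnWire w j r) ∧ lo < j ∧ j ≤ hi := by
  simp [sg, mem_nodesOn]

lemma WK.goUp {w : List ℕ} {k r lo : ℕ} {ms : List ℕ} {ps : List (ℕ × ℕ × ℕ)} (hr : r ≤ k)
    (h : WK w k r lo ms ps) (t : ℕ) (ht : lo + t ≤ w.length)
    (hf : ∀ j ∈ sg w r lo (lo + t), ¬ Forbidden w k j r) :
    ∃ ps', WK w k r (lo + t) ms ps' ∧ (vis w ps').Perm (sg w r lo (lo + t) ++ vis w ps) := by
  induction t with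
  | zero =>
    refine ⟨ps, h, ?_⟩
    unfold sg
    rw [filt_none]
    · rfl
    · intro j _ _; simp only [decide_eq_true_eq]; omega
  | succ t ih =>
    obtain ⟨ps', h', hp⟩ := ih (by omega) (fun j hj => hf j (by rw [mem_sg] at hj ⊢; exact ⟨hj.1, by omega⟩))
    refine ⟨(lo + t, r, r) :: ps', ?_, ?_⟩
    · have e := WK.go (i := lo + t) (r := r) (w := w) (k := k) (ms := ms) (ps := ps') (by omega)
        (fun ho => hf _ (by rw [mem_sg]; exact ⟨⟨by omega, ho⟩, by omega⟩))
        (by simpa [ext, hr] using h')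
      have : ent k (lo + t) r = lo + (t + 1) := by simp [ent, hr]; omega
      rwa [this] at e
    · rw [vis_cons]
      have e := filt_step (w := w) (r := r) (i := lo + t) (by omega)
        (p := fun j => decide (lo < j ∧ j ≤ lo + (t + 1)))
        (q := fun j => decide (lo < j ∧ j ≤ lo + t))
        (by intro j _ _; simp only [decide_eq_true_eq]; omega)
        (by simp only [decide_eq_true_eq]; omega)
      refine ((List.perm_append_left_iff _).2 hp).trans ?_
      rw [← List.append_assoc]
      exact ((List.perm_append_right_iff _).2 e.symm)

lemma WK.goDown {w : List ℕ} {k r : ℕ} {ms : List ℕ} {ps : List (ℕ × ℕ × ℕ)} (hr : k < r)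
    (t : ℕ) : ∀ {lo : ℕ} (_ : WK w k r (lo + t) ms ps) (_ : lo + t ≤ w.length)
    (_ : ∀ j ∈ sg w r lo (lo + t), ¬ Forbidden w k j r),
    ∃ ps', WK w k r lo ms ps' ∧ (vis w ps').Perm (sg w r lo (lo + t) ++ vis w ps) := by
  induction t with
  | zero =>
    intro lo h ht hf
    refine ⟨ps, h, ?_⟩
    unfold sg
    rw [filt_none]
    · rfl
    · intro j _ _; simp only [decide_eq_true_eq]; omega
  | succ t ih =>
    intro lo h ht hf
    have e0 : lo + (t + 1) = lo + 1 + t := by omega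
    rw [e0] at h ht hf
    obtain ⟨ps', h', hp⟩ := ih h ht (fun j hj => hf j (by rw [mem_sg] at hj ⊢; exact ⟨hj.1, by omega⟩))
    refine ⟨(lo, r, r) :: ps', ?_, ?_⟩
    · have e := WK.go (i := lo) (r := r) (w := w) (k := k) (ms := ms) (ps := ps') (by omega)
        (fun ho => hf _ (by rw [mem_sg]; exact ⟨⟨by omega, ho⟩, by omega⟩))
        (by simpa [ext, not_le.2 hr] using h')
      have : ent k lo r = lo := by simp [ent, not_le.2 hr]
      rwa [this] at e
    · rw [vis_cons, e0]
      have e := filt_step (w := w) (r := r) (i := lo) (by omega)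
        (p := fun j => decide (lo < j ∧ j ≤ lo + 1 + t))
        (q := fun j => decide (lo + 1 < j ∧ j ≤ lo + 1 + t))
        (by intro j _ _; simp only [decide_eq_true_eq]; omega)
        (by simp only [decide_eq_true_eq]; omega)
      refine ((List.perm_append_left_iff _).2 hp).trans ?_
      rw [← List.append_assoc]
      exact ((List.perm_append_right_iff _).2 e.symm)

/-- node index corresponding to an edge -/
def aa (k r h : ℕ) : ℕ := if r ≤ k then h + 1 else h

lemma aa_ext (k i o : ℕ) : aa k o (ext k i o) = i + 1 := by
  unfold aa ext; split_ifs <;> rfl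

lemma WK_of_Travel {w : List ℕ} {k : ℕ} (ms : List ℕ) : ∀ {r h : ℕ} (_ : h ≤ w.length)
    (_ : TravelOK w k r (aa k r h) ms),
    ∃ ps, WK w k r h ms ps ∧ (vis w ps).Perm (visitTail w r (aa k r h) ms) := by
  induction ms with
  | nil =>
    rintro r h hh ⟨rfl, hf⟩
    have hr : k < k + 1 := by omega
    have ea : aa k (k + 1) h = h := by simp [aa]
    rw [ea] at hf ⊢
    have e1 : tailList w (k + 1) h = sg w (k + 1) h (h + (w.length - h)) := by
      unfold tailList sg
      apply List.filter_congr
      intro j hj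
      rw [mem_nodesOn] at hj
      simp only [decide_eq_decide]; omega
    have := WK.goDown (w := w) (k := k) (ms := []) (ps := []) hr (w.length - h) (lo := h)
      (by rw [Nat.add_sub_cancel' hh]; exact WK.fin) (by omega) (by rw [← e1]; exact hf)
    obtain ⟨ps, h1, h2⟩ := this
    refine ⟨ps, h1, ?_⟩
    rw [visitTail, e1]
    simpa [vis] using h2
  | cons m ms ih =>
    rintro r h hh ⟨hv, hon, hlt, hf, ht⟩
    obtain ⟨i, rfl⟩ : ∃ i, m = i + 1 := ⟨m - 1, by have := hv.1; omega⟩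
    have hi : i < w.length := by have := hv.2; omega
    obtain ⟨ps, h1, h2⟩ := ih (r := otherWire w (i + 1) r) (h := ext k i (otherWire w (i + 1) r))
      (by unfold ext; split_ifs <;> omega) (by rw [aa_ext]; exact ht)
    have h3 := WK.sw hi hon h1
    rw [aa_ext] at h2
    by_cases hr : r ≤ k
    · simp only [aa, hr, if_true] at hlt hf ⊢
      have e1 : segList w r (h + 1) (i + 1) = sg w r (i + 1) (i + 1 + (h - (i + 1))) := by
        unfold segList sg
        apply List.filter_congr
        intro j hj
        simp only [decide_eq_decide]; omega
      have ee : ent k i r = i + 1 := by simp [ent, hr]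
      rw [ee] at h3
      obtain ⟨ps', h4, h5⟩ := WK.goUp hr h3 (h - (i + 1)) (by omega) (by rw [← e1]; exact hf)
      have e2 : i + 1 + (h - (i + 1)) = h := by omega
      refine ⟨ps', by rwa [e2] at h4, ?_⟩
      rw [visitTail, e1]
      refine h5.trans ((List.perm_append_left_iff _).2 ?_)
      rw [vis_cons, if_pos hon]
      exact List.Perm.cons _ h2
    · simp only [aa, hr, if_false] at hlt hf ⊢
      have e1 : segList w r h (i + 1) = sg w r h (h + (i - h)) := by
        unfold segList sg
        apply List.filter_congr
        intro j hj
        simp only [decide_eq_decide]; omega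
      have ee : ent k i r = i := by simp [ent, hr]
      rw [ee] at h3
      have e2 : h + (i - h) = i := by omega
      obtain ⟨ps', h4, h5⟩ := WK.goDown (w := w) (ms := (i + 1) :: ms)
        (ps := (i, r, otherWire w (i + 1) r) :: ps) (show k < r by omega) (i - h) (lo := h)
        (by rw [e2]; exact h3) (by omega)
        (by rw [← e1]; exact hf)
      refine ⟨ps', h4, ?_⟩
      rw [visitTail, e1]
      refine h5.trans ((List.perm_append_left_iff _).2 ?_)
      rw [vis_cons, if_pos hon]
      exact List.Perm.cons _ h2

lemma Travel_of_WK {w : List ℕ} {k r h : ℕ} {ms : List ℕ} {ps : List (ℕ × ℕ × ℕ)}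
    (H : WK w k r h ms ps) :
    TravelOK w k r (aa k r h) ms ∧ (vis w ps).Perm (visitTail w r (aa k r h) ms) := by
  induction H with
  | fin =>
    have ea : aa k (k + 1) w.length = w.length := by simp [aa]
    have e1 : tailList w (k + 1) w.length = [] := by
      unfold tailList
      apply filt_none
      intro j _ _; simp only [decide_eq_true_eq]; omega
    rw [ea]
    refine ⟨⟨rfl, by rw [e1]; simp⟩, ?_⟩
    rw [visitTail, e1]; simp [vis]
  | @go i r ms ps hi hf t ih =>
    rw [aa_ext] at ih
    obtain ⟨h1, h2⟩ := ih
    cases ms with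
    | nil =>
      obtain ⟨rfl, h3⟩ := h1
      have ea : aa k (k + 1) (ent k i (k + 1)) = i := by simp [aa, ent]
      rw [ea]
      have e := filt_step (w := w) (r := k + 1) (i := i) hi (p := fun j => decide (i < j))
        (q := fun j => decide (i + 1 < j))
        (by intro j _ _; simp only [decide_eq_true_eq]; omega)
        (by simp only [decide_eq_true_eq]; omega)
      refine ⟨⟨rfl, ?_⟩, ?_⟩
      · intro j hj
        have := (e.mem_iff).1 hj
        rw [List.mem_append] at this
        rcases this with h | h
        · split_ifs at h with ho
          · rw [List.mem_singleton] at h; subst h; exact hf ho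
          · simp at h
        · exact h3 j h
      · rw [vis_cons]
        exact ((List.perm_append_left_iff _).2 h2).trans e.symm
    | cons m ms =>
      obtain ⟨hv, hon, hlt, h3, ht⟩ := h1
      have key : segList w r (aa k r (ent k i r)) m |>.Perm
          ((if NodeOnWire w (i + 1) r then [i + 1] else []) ++ segList w r (i + 1) m) := by
        unfold segList
        apply filt_step hi
        · intro j _ _; simp only [decide_eq_true_eq]
          unfold aa ent
          split_ifs at * <;> omega
        · simp only [decide_eq_true_eq]; omega
      refine ⟨⟨hv, hon, ?_, ?_, ht⟩, ?_⟩
      · unfold aa ent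
        split_ifs at * <;> omega
      · intro j hj
        have := (key.mem_iff).1 hj
        rw [List.mem_append] at this
        rcases this with h | h
        · split_ifs at h with ho
          · rw [List.mem_singleton] at h; subst h; exact hf ho
          · simp at h
        · exact h3 j h
      · rw [vis_cons]
        refine ((List.perm_append_left_iff _).2 h2).trans ?_
        rw [visitTail, visitTail, ← List.append_assoc]
        exact ((List.perm_append_right_iff _).2 key.symm)
  | @sw i r ms ps hi hon t ih =>
    rw [aa_ext] at ih
    obtain ⟨h1, h2⟩ := ih
    have e1 : segList w r (aa k r (ent k i r)) (i + 1) = [] := by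
      unfold segList
      apply filt_none
      intro j _ _; simp only [decide_eq_true_eq]
      unfold aa ent
      split_ifs <;> omega
    refine ⟨⟨⟨by omega, by omega⟩, hon, ?_, ?_, h1⟩, ?_⟩
    · unfold aa ent
      split_ifs <;> omega
    · rw [e1]; simp
    · rw [vis_cons, if_pos hon, visitTail, e1]
      exact List.Perm.cons _ h2

lemma GP_iff {n : ℕ} {w : List ℕ} {k : ℕ} {ms : List ℕ} :
    IsGPPath n w k ms ↔ 1 ≤ k ∧ k ≤ n ∧ ∃ ps, WK w k k w.length ms ps ∧ (vis w ps).Nodup := by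
  have e0 : aa k k w.length = w.length + 1 := by simp [aa]
  have e1 : ∀ m, 1 ≤ m → m ≤ w.length → tailList w k m = segList w k (w.length + 1) m := by
    intro m _ _
    unfold tailList segList
    apply List.filter_congr
    intro j hj
    rw [mem_nodesOn] at hj
    simp only [decide_eq_decide]; omega
  have key : IsGPPath n w k ms ↔ 1 ≤ k ∧ k ≤ n ∧ TravelOK w k k (w.length + 1) ms ∧
      (visitTail w k (w.length + 1) ms).Nodup := by
    unfold IsGPPath
    cases ms with
    | nil => simp [TravelOK]
    | cons m ms =>
      simp only [TravelOK, visitList, visitTail, le_refl, if_true]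
      refine and_congr_right fun _ => and_congr_right fun _ => ?_
      by_cases hv : ValidNode w m
      · rw [e1 m hv.1 hv.2]
        have : m < w.length + 1 := by have := hv.2; omega
        simp [this]
      · simp [hv]
  rw [key]
  refine and_congr_right fun _ => and_congr_right fun _ => ?_
  constructor
  · rintro ⟨h1, h2⟩
    rw [← e0] at h1 h2
    obtain ⟨ps, h3, h4⟩ := WK_of_Travel ms le_rfl h1
    exact ⟨ps, h3, h4.nodup_iff.2 h2⟩
  · rintro ⟨ps, h1, h2⟩
    have := Travel_of_WK h1
    rw [e0] at this
    exact ⟨this.1, this.2.nodup_iff.1 h2⟩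

/-! ### Local conditions at nodes -/

/-- local condition in terms of entering and leaving edges -/
def LocP (k a b : ℕ) (ea xa eb xb : Prop) (d : ℤ) : Prop :=
  (¬ea ∧ ¬eb ∧ ¬xa ∧ ¬xb ∧ d = 0) ∨ (ea ∧ ¬eb ∧ xa ∧ ¬xb ∧ d = 0 ∧ k < b) ∨
  (eb ∧ ¬ea ∧ xb ∧ ¬xa ∧ d = 0 ∧ a ≤ k) ∨ (ea ∧ ¬eb ∧ xb ∧ ¬xa ∧ d = 1) ∨
  (eb ∧ ¬ea ∧ xa ∧ ¬xb ∧ d = -1)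

/-- local condition at a node for a set of edges -/
def Loc (w : List ℕ) (k : ℕ) (E : ℕ → ℕ → Prop) (i : ℕ) (d : ℤ) : Prop :=
  (∀ r, ¬ NodeOnWire w (i + 1) r → (E r i ↔ E r (i + 1))) ∧
  LocP k (wireX w (i + 1)) (wireY w (i + 1))
    (E (wireX w (i + 1)) (ent k i (wireX w (i + 1)))) (E (wireX w (i + 1)) (ext k i (wireX w (i + 1))))
    (E (wireY w (i + 1)) (ent k i (wireY w (i + 1)))) (E (wireY w (i + 1)) (ext k i (wireY w (i + 1)))) d

/-- the set of wires associated with a set of edges -/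
def FE (k : ℕ) (E : ℕ → ℕ → Prop) (h : ℕ) : Set ℕ := {r | ¬(r ≤ k ↔ E r h)}

lemma mem_FE {k : ℕ} {E : ℕ → ℕ → Prop} {h r : ℕ} : r ∈ FE k E h ↔ ¬(r ≤ k ↔ E r h) := Iff.rfl

lemma wX (w : List ℕ) (i : ℕ) : wireX w (i + 1) = St w i (lt w i) := rfl

lemma wY (w : List ℕ) (i : ℕ) : wireY w (i + 1) = St w i (lt w i + 1) := rfl

lemma wXY {n : ℕ} {w : List ℕ} (hw : IsReduced n w) {i : ℕ} (hi : i < w.length) :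
    wireX w (i + 1) < wireY w (i + 1) := hw.red.lt_at hi

lemma Loc.step {n : ℕ} {w : List ℕ} (hw : IsReduced n w) {k : ℕ} {E : ℕ → ℕ → Prop} {i : ℕ} {d : ℤ}
    (hi : i < w.length) (h : Loc w k E i d) :
    StepF (St w i (lt w i)) (St w i (lt w i + 1)) (FE k E i) (FE k E (i + 1)) d := by
  have hab := wXY hw hi
  obtain ⟨h1, h2⟩ := h
  rw [← wX, ← wY, StepF_iff hab.ne]
  simp only [mem_FE]
  constructor
  · intro x hx hy
    rw [h1 x (by rintro (h | h); exacts [hx h.symm, hy h.symm])]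
  · generalize wireX w (i + 1) = a at *
    generalize wireY w (i + 1) = b at *
    unfold LocP ent ext at h2
    by_cases ha : a ≤ k <;> by_cases hb : b ≤ k <;>
      simp only [ha, hb, if_true, if_false] at h2 ⊢ <;>
      generalize E a i = e1 at * <;> generalize E a (i + 1) = e2 at * <;>
      generalize E b i = e3 at * <;> generalize E b (i + 1) = e4 at * <;>
      by_cases e1 <;> by_cases e2 <;> by_cases e3 <;> by_cases e4 <;> simp_all <;> omega

lemma ind_true {p : Prop} (h : p) : ind p = 1 := by simp [ind, h]

lemma ind_false {p : Prop} (h : ¬p) : ind p = 0 := by simp [ind, h]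

lemma locP_of {k a b : ℕ} (hab : a < b) {F G : Set ℕ} {d y : ℤ} {i : ℕ} {E : ℕ → ℕ → Prop}
    (hE0 : ∀ r, E r i ↔ ¬(r ∈ F ↔ r ≤ k)) (hE1 : ∀ r, E r (i + 1) ↔ ¬(r ∈ G ↔ r ≤ k))
    (hs : StepF a b F G d) (h0 : y = 0 ∨ y = 1)
    (h1 : y + (ind (a ∈ F) - ind (a ≤ k)) = 0 ∨ y + (ind (a ∈ F) - ind (a ≤ k)) = 1)
    (h2 : y + (ind (a ∈ F) - ind (a ≤ k)) + (ind (b ∈ F) - ind (b ≤ k)) = 0 ∨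
      y + (ind (a ∈ F) - ind (a ≤ k)) + (ind (b ∈ F) - ind (b ≤ k)) = 1)
    (h3 : y + (ind (b ∈ G) - ind (b ≤ k)) = 0 ∨ y + (ind (b ∈ G) - ind (b ≤ k)) = 1) :
    LocP k a b (E a (ent k i a)) (E a (ext k i a)) (E b (ent k i b)) (E b (ext k i b)) d := by
  rw [StepF_iff hab.ne] at hs
  replace hs := hs.2
  have hba : b ≤ k → a ≤ k := fun h => by omega
  have hbk : k < b ↔ ¬ b ≤ k := by omega
  unfold LocP ent ext
  rw [hbk]
  by_cases ha : a ≤ k <;> by_cases hb : b ≤ k <;>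
    simp only [ha, hb, if_true, if_false, hE0, hE1] at hs hba h0 h1 h2 h3 ⊢ <;>
    generalize (a ∈ F) = e1 at * <;> generalize (a ∈ G) = e2 at * <;>
    generalize (b ∈ F) = e3 at * <;> generalize (b ∈ G) = e4 at * <;>
    by_cases he1 : e1 <;> by_cases he2 : e2 <;> by_cases he3 : e3 <;> by_cases he4 : e4 <;>
    simp only [he1, he2, he3, he4, ind, if_true, if_false] at hs h0 h1 h2 h3 ⊢ <;>
    first
    | (exfalso; omega)
    | (simp at hs ⊢; try omega)

lemma loc_of_HT {n : ℕ} {w : List ℕ} (hw : IsReduced n w) {Fs : ℕ → Set ℕ} {d : ℕ → ℤ} {k : ℕ}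
    (hk1 : 1 ≤ k) (hk2 : k ≤ n)
    (h : HT w Fs d) (h0 : Fs 0 = Set.Iic k) (h1 : Fs w.length = EndS k) {i : ℕ}
    (hi : i < w.length) : Loc w k (fun r h => ¬(r ∈ Fs h ↔ r ≤ k)) i (d i) := by
  have hs := h i hi
  have hab := wXY hw hi
  have hl := hw.letter hi
  obtain ⟨c, hc⟩ : ∃ c, lt w i = c + 1 := ⟨lt w i - 1, by omega⟩
  constructor
  · intro r hr
    beta_reduce
    rw [hs.mem_of_ne (fun e => hr (Or.inl e.symm)) (fun e => hr (Or.inr e.symm))]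
  · have y0 := h.Yc01 hw hk1 hk2 h0 h1 hi.le c
    have y1 := h.Yc01 hw hk1 hk2 h0 h1 hi.le (c + 1)
    have y2 := h.Yc01 hw hk1 hk2 h0 h1 hi.le (c + 1 + 1)
    have y3 := h.Yc01 hw hk1 hk2 h0 h1 (j := i + 1) hi (c + 1)
    have e4 : Yc w k Fs (i + 1) c = Yc w k Fs i c := by
      unfold Yc
      rw [St_succ hi]
      exact Ystep_ne hs (by omega)
    unfold Yc at *
    rw [Yp_succ] at y1 y3
    rw [Yp_succ, Yp_succ] at y2
    rw [e4] at y3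
    rw [St_succ hi] at y3
    unfold XX at y1 y2 y3
    simp only [← hc, Equiv.Perm.mul_apply, sTrans_left] at y1 y2 y3
    rw [wX, wY] at *
    exact locP_of hab (i := i) (E := fun r h => ¬(r ∈ Fs h ↔ r ≤ k)) (F := Fs i) (G := Fs (i + 1)) (fun r => Iff.rfl)
      (fun r => Iff.rfl) hs y0 y1 y2 y3

lemma Loc.sub {w : List ℕ} {k : ℕ} {E P : ℕ → ℕ → Prop} {i : ℕ} {d e : ℤ}
    (h : Loc w k E i d) (h' : Loc w k P i e) (hP : ∀ r h, h ≤ w.length → P r h → E r h)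
    (hi : i < w.length) :
    Loc w k (fun r h => E r h ∧ ¬ P r h) i (d - e) := by
  constructor
  · intro r hr
    beta_reduce
    rw [h.1 r hr, h'.1 r hr]
  · have h1 := h.2
    have h2 := h'.2
    have p1 := hP (wireX w (i + 1)) (ent k i (wireX w (i + 1))) (by unfold ent; split_ifs <;> omega)
    have p2 := hP (wireX w (i + 1)) (ext k i (wireX w (i + 1))) (by unfold ext; split_ifs <;> omega)
    have p3 := hP (wireY w (i + 1)) (ent k i (wireY w (i + 1))) (by unfold ent; split_ifs <;> omega)
    have p4 := hP (wireY w (i + 1)) (ext k i (wireY w (i + 1))) (by unfold ext; split_ifs <;> omega)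
    unfold LocP at *
    rcases h1 with h | h | h | h | h <;> rcases h2 with h' | h' | h' | h' | h' <;> simp_all

/-! ### From rigorous paths to trails -/

/-- entering edge of a pass -/
def enE (k : ℕ) (p : ℕ × ℕ × ℕ) : ℕ × ℕ := (p.2.1, ent k p.1 p.2.1)

/-- leaving edge of a pass -/
def exE (k : ℕ) (p : ℕ × ℕ × ℕ) : ℕ × ℕ := (p.2.2, ext k p.1 p.2.2)

/-- valid passes -/
def VP (w : List ℕ) (k i r o : ℕ) : Prop :=
  (o = r ∧ (NodeOnWire w (i + 1) r → ¬ Forbidden w k (i + 1) r)) ∨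
  (NodeOnWire w (i + 1) r ∧ o = otherWire w (i + 1) r)

/-- sign of a pass -/
def sgn (r o : ℕ) : ℤ := if r < o then 1 else if o < r then -1 else 0

/-- coefficient of a list of passes -/
def cI (ps : List (ℕ × ℕ × ℕ)) (i : ℕ) : ℤ :=
  (ps.map (fun p => if p.1 = i then sgn p.2.1 p.2.2 else 0)).sum

/-- the edges of a list of passes -/
def EP (w : List ℕ) (k : ℕ) (ps : List (ℕ × ℕ × ℕ)) (r h : ℕ) : Prop :=
  (r, h) ∈ ps.map (enE k) ++ [(k + 1, w.length)]

lemma ent_inj {k i j r : ℕ} (h : ent k i r = ent k j r) : i = j := by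
  unfold ent at h; split_ifs at h <;> omega

lemma ext_inj {k i j r : ℕ} (h : ext k i r = ext k j r) : i = j := by
  unfold ext at h; split_ifs at h <;> omega

lemma WK.edges {w : List ℕ} {k r h : ℕ} {ms : List ℕ} {ps : List (ℕ × ℕ × ℕ)}
    (H : WK w k r h ms ps) :
    ps.map (enE k) ++ [(k + 1, w.length)] = (r, h) :: ps.map (exE k) := by
  induction H with
  | fin => rfl
  | go hi hf t ih => simp only [List.map_cons, List.cons_append, ih]; rfl
  | sw hi hf t ih => simp only [List.map_cons, List.cons_append, ih]; rfl

lemma WK.valid {w : List ℕ} {k r h : ℕ} {ms : List ℕ} {ps : List (ℕ × ℕ × ℕ)}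
    (H : WK w k r h ms ps) : ∀ p ∈ ps, p.1 < w.length ∧ VP w k p.1 p.2.1 p.2.2 := by
  induction H with
  | fin => simp
  | go hi hf t ih =>
    intro p hp
    rcases List.mem_cons.1 hp with rfl | hp
    · exact ⟨hi, Or.inl ⟨rfl, hf⟩⟩
    · exact ih p hp
  | sw hi hf t ih =>
    intro p hp
    rcases List.mem_cons.1 hp with rfl | hp
    · exact ⟨hi, Or.inr ⟨hf, rfl⟩⟩
    · exact ih p hp

lemma other_ne {n : ℕ} {w : List ℕ} (hw : IsReduced n w) {i r : ℕ} (hi : i < w.length)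
    (hr : NodeOnWire w (i + 1) r) : otherWire w (i + 1) r ≠ r := by
  have := wXY hw hi
  unfold otherWire
  split_ifs with h
  · omega
  · exact h

lemma WK.coeff {n : ℕ} {w : List ℕ} (hw : IsReduced n w) {k r h : ℕ} {ms : List ℕ}
    {ps : List (ℕ × ℕ × ℕ)} (H : WK w k r h ms ps) (i : ℕ) :
    StringPolytope.coeff w r ms (i + 1) = (cI ps i : ℝ) := by
  unfold StringPolytope.coeff cI
  induction H with
  | fin => simp [pathSwitches]
  | go hi hf t ih =>
    rw [ih]
    simp [sgn]
  | @sw i' r ms ps hi hf t ih =>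
    have := other_ne hw hi hf
    simp only [pathSwitches, List.map_cons, List.sum_cons, ih, Int.cast_add]
    congr 1
    simp only [Nat.add_right_cancel_iff, sgn]
    by_cases e : i' = i
    · subst e
      by_cases e2 : r < otherWire w (i' + 1) r
      · simp [e2]
      · have e3 : otherWire w (i' + 1) r < r := by omega
        simp [e2, e3]
    · simp [e]

lemma sum_key {α : Type*} (L : List α) (p : α → Bool) (g : α → ℕ) (f : α → ℤ) (j : ℕ)
    (hnd : ((L.filter p).map g).Nodup) (hf : ∀ x ∈ L, (¬ p x = true ∨ g x ≠ j) → f x = 0)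
    {x : α} (hx : x ∈ L) (hp : p x = true) (hg : g x = j) : (L.map f).sum = f x := by
  induction L with
  | nil => simp at hx
  | cons y L ih =>
    rw [List.map_cons, List.sum_cons]
    have hnd' : ((L.filter p).map g).Nodup := by
      by_cases hy : p y = true
      · rw [List.filter_cons_of_pos hy, List.map_cons, List.nodup_cons] at hnd; exact hnd.2
      · rwa [List.filter_cons_of_neg hy] at hnd
    rcases List.mem_cons.1 hx with rfl | hx
    · rw [List.filter_cons_of_pos hp, List.map_cons, List.nodup_cons] at hnd
      have : (L.map f).sum = 0 := by
        apply List.sum_eq_zero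
        intro z hz
        obtain ⟨u, hu, rfl⟩ := List.mem_map.1 hz
        apply hf u (List.mem_cons_of_mem _ hu)
        by_contra hc
        push Not at hc
        exact hnd.1 (List.mem_map.2 ⟨u, List.mem_filter.2 ⟨hu, hc.1⟩, by rw [hc.2, hg]⟩)
      omega
    · rw [ih hnd' (fun z hz => hf z (List.mem_cons_of_mem _ hz)) hx]
      have : f y = 0 := by
        apply hf y List.mem_cons_self
        by_contra hc
        push Not at hc
        rw [List.filter_cons_of_pos hc.1, List.map_cons, List.nodup_cons] at hnd
        exact hnd.1 (List.mem_map.2 ⟨x, List.mem_filter.2 ⟨hx, hp⟩, by rw [hc.2, hg]⟩)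
      omega

lemma vis_unique {w : List ℕ} {ps : List (ℕ × ℕ × ℕ)} (hnd : (vis w ps).Nodup)
    {p q : ℕ × ℕ × ℕ} (hp : p ∈ ps) (hq : q ∈ ps) (h1 : NodeOnWire w (p.1 + 1) p.2.1)
    (h2 : NodeOnWire w (q.1 + 1) q.2.1) (h : p.1 = q.1) : p = q := by
  unfold vis at hnd
  exact List.inj_on_of_nodup_map hnd (List.mem_filter.2 ⟨hp, by simpa using h1⟩)
    (List.mem_filter.2 ⟨hq, by simpa using h2⟩) (by simp [h])

lemma EP_ent {w : List ℕ} {k : ℕ} {ps : List (ℕ × ℕ × ℕ)} {i r : ℕ} (hi : i < w.length) :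
    EP w k ps r (ent k i r) ↔ ∃ o, (i, r, o) ∈ ps := by
  unfold EP
  rw [List.mem_append, List.mem_singleton, List.mem_map]
  constructor
  · rintro (⟨⟨i', r', o⟩, hp, he⟩ | h)
    · simp only [enE, Prod.mk.injEq] at he
      obtain ⟨rfl, h2⟩ := he
      obtain rfl := ent_inj h2
      exact ⟨o, hp⟩
    · rw [Prod.mk.injEq] at h
      obtain ⟨rfl, h⟩ := h
      simp [ent] at h; omega
  · rintro ⟨o, h⟩
    exact Or.inl ⟨_, h, rfl⟩

lemma EP_ext {w : List ℕ} {k : ℕ} {ms : List ℕ} {ps : List (ℕ × ℕ × ℕ)}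
    (H : WK w k k w.length ms ps) {i o : ℕ} (hi : i < w.length) :
    EP w k ps o (ext k i o) ↔ ∃ r, (i, r, o) ∈ ps := by
  unfold EP
  rw [H.edges, List.mem_cons, List.mem_map]
  constructor
  · rintro (h | ⟨⟨i', r', o'⟩, hp, he⟩)
    · rw [Prod.mk.injEq] at h
      obtain ⟨rfl, h⟩ := h
      simp [ext] at h; omega
    · simp only [exE, Prod.mk.injEq] at he
      obtain ⟨rfl, h2⟩ := he
      obtain rfl := ext_inj h2
      exact ⟨r', hp⟩
  · rintro ⟨r, h⟩
    exact Or.inr ⟨_, h, rfl⟩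

lemma other_on {w : List ℕ} {i r : ℕ} : NodeOnWire w i (otherWire w i r) := by
  unfold otherWire NodeOnWire
  split_ifs <;> simp

lemma VP.on_iff {w : List ℕ} {k i r o : ℕ} (h : VP w k i r o) :
    NodeOnWire w (i + 1) r ↔ NodeOnWire w (i + 1) o := by
  rcases h with ⟨rfl, -⟩ | ⟨h1, rfl⟩
  · rfl
  · exact ⟨fun _ => other_on, fun _ => h1⟩

lemma WK.zero {w : List ℕ} {k : ℕ} {ms : List ℕ} {ps : List (ℕ × ℕ × ℕ)}
    (H : WK w k k w.length ms ps) (hN : 0 < w.length) (r : ℕ) : ¬ EP w k ps r 0 := by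
  intro h
  have h' := h
  unfold EP at h h'
  rw [H.edges] at h'
  simp only [List.mem_append, List.mem_cons, List.mem_map, List.not_mem_nil, or_false, enE, exE,
    Prod.mk.injEq] at h h'
  rcases h with ⟨p, -, h1, h2⟩ | h <;> rcases h' with h' | ⟨q, -, h3, h4⟩
  · omega
  · rw [h1] at h2; rw [h3] at h4; unfold ent at h2; unfold ext at h4
    split_ifs at * <;> omega
  · omega
  · omega

lemma WK.last {w : List ℕ} {k : ℕ} {ms : List ℕ} {ps : List (ℕ × ℕ × ℕ)}
    (H : WK w k k w.length ms ps) (r : ℕ) :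
    EP w k ps r w.length ↔ r = k ∨ r = k + 1 := by
  have hv := H.valid
  constructor
  · intro h
    have h' := h
    unfold EP at h h'
    rw [H.edges] at h'
    simp only [List.mem_append, List.mem_cons, List.mem_map, List.not_mem_nil, or_false, enE, exE,
      Prod.mk.injEq] at h h'
    rcases h with ⟨p, hp, h1, h2⟩ | h <;> rcases h' with h' | ⟨q, hq, h3, h4⟩
    · omega
    · have := (hv p hp).1
      have := (hv q hq).1
      rw [h1] at h2; rw [h3] at h4; unfold ent at h2; unfold ext at h4
      split_ifs at * <;> omega
    · omega
    · omega
  · rintro (rfl | rfl)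
    · unfold EP; rw [H.edges]; simp
    · unfold EP; simp

lemma WK.loc {n : ℕ} {w : List ℕ} (hw : IsReduced n w) {k : ℕ} {ms : List ℕ}
    {ps : List (ℕ × ℕ × ℕ)} (H : WK w k k w.length ms ps) (hnd : (vis w ps).Nodup) {i : ℕ}
    (hi : i < w.length) : Loc w k (EP w k ps) i (cI ps i) := by
  have hv := H.valid
  have hab := wXY hw hi
  constructor
  · intro r hr
    have key : EP w k ps r (ent k i r) ↔ EP w k ps r (ext k i r) := by
      rw [EP_ent hi, EP_ext H hi]
      constructor
      · rintro ⟨o, ho⟩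
        have := (hv _ ho).2
        rcases this with ⟨h1, -⟩ | ⟨h1, -⟩
        · simp only at h1; subst h1; exact ⟨_, ho⟩
        · exact absurd h1 hr
      · rintro ⟨o, ho⟩
        have := (hv _ ho).2
        have h2 := this.on_iff
        rcases this with ⟨h1, -⟩ | ⟨h1, -⟩
        · simp only at h1; subst h1; exact ⟨_, ho⟩
        · exact absurd (h2.1 h1) hr
    unfold ent ext at key
    split_ifs at key
    · exact key.symm
    · exact key
  · rw [EP_ent hi, EP_ent hi, EP_ext H hi, EP_ext H hi]
    have honX : NodeOnWire w (i + 1) (wireX w (i + 1)) := Or.inl rfl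
    have honY : NodeOnWire w (i + 1) (wireY w (i + 1)) := Or.inr rfl
    have oX : otherWire w (i + 1) (wireX w (i + 1)) = wireY w (i + 1) := by simp [otherWire]
    have oY : otherWire w (i + 1) (wireY w (i + 1)) = wireX w (i + 1) := by
      simp only [otherWire]; rw [if_neg hab.ne]
    by_cases hex : ∃ r o, (i, r, o) ∈ ps ∧ NodeOnWire w (i + 1) r
    · obtain ⟨r, o, hp, hon⟩ := hex
      have huniq : ∀ r' o', (i, r', o') ∈ ps → NodeOnWire w (i + 1) r' → r' = r ∧ o' = o := by
        intro r' o' h1 h2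
        have := vis_unique hnd h1 hp h2 hon rfl
        simpa using this
      have hc : cI ps i = sgn r o := by
        unfold cI
        unfold vis at hnd
        rw [sum_key ps _ _ _ (i + 1) hnd _ hp (by simpa using hon) rfl]
        · simp
        · rintro ⟨i', r', o'⟩ hx (h1 | h1)
          · simp only [decide_eq_true_eq] at h1
            rcases (hv _ hx).2 with ⟨h2, -⟩ | ⟨h2, -⟩
            · simp only at h2; subst h2; simp [sgn]
            · exact absurd h2 h1
          · simp only [ne_eq, Nat.add_right_cancel_iff] at h1
            simp [h1]
      have e1 : ∀ x, NodeOnWire w (i + 1) x → ((∃ o, (i, x, o) ∈ ps) ↔ x = r) := by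
        intro x hx
        constructor
        · rintro ⟨o', h'⟩; exact (huniq x o' h' hx).1
        · rintro rfl; exact ⟨o, hp⟩
      have e2 : ∀ x, NodeOnWire w (i + 1) x → ((∃ r, (i, r, x) ∈ ps) ↔ x = o) := by
        intro x hx
        constructor
        · rintro ⟨r', h'⟩; exact (huniq r' x h' ((hv _ h').2.on_iff.2 hx)).2
        · rintro rfl; exact ⟨r, hp⟩
      rw [e1 _ honX, e1 _ honY, e2 _ honX, e2 _ honY, hc]
      have hvp := (hv _ hp).2
      simp only [VP, hon, true_implies, true_and] at hvp
      unfold Forbidden at hvp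
      unfold LocP sgn
      rcases hon with rfl | rfl
      · rw [oX] at hvp
        generalize wireX w (i + 1) = a at *
        generalize wireY w (i + 1) = b at *
        rcases hvp with ⟨rfl, h⟩ | rfl
        · simp [hab.ne']; omega
        · simp [hab, hab.ne, hab.ne']
      · rw [oY] at hvp
        generalize wireX w (i + 1) = a at *
        generalize wireY w (i + 1) = b at *
        rcases hvp with ⟨rfl, h⟩ | rfl
        · simp [hab.ne]; omega
        · simp [hab, hab.ne, hab.ne', hab.not_gt]
    · push Not at hex
      left
      have hx : ∀ r x, (i, r, x) ∈ ps → ¬ NodeOnWire w (i + 1) x := fun r x h hx =>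
        hex r x h ((hv _ h).2.on_iff.2 hx)
      refine ⟨fun ⟨o, h⟩ => hex _ _ h honX, fun ⟨o, h⟩ => hex _ _ h honY,
        fun ⟨o, h⟩ => hx _ _ h honX, fun ⟨o, h⟩ => hx _ _ h honY, ?_⟩
      unfold cI
      apply List.sum_eq_zero
      intro z hz
      obtain ⟨⟨i', r, o⟩, hu, rfl⟩ := List.mem_map.1 hz
      simp only
      split_ifs with h
      · subst h
        rcases (hv _ hu).2 with ⟨h2, -⟩ | ⟨h2, -⟩
        · simp only at h2; subst h2; simp [sgn]
        · exact absurd h2 (hex _ _ hu)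
      · rfl

/-! ### From trails to rigorous paths -/

lemma otherX {w : List ℕ} {i : ℕ} : otherWire w i (wireX w i) = wireY w i := by simp [otherWire]

lemma otherY {w : List ℕ} {i : ℕ} (h : wireX w i ≠ wireY w i) :
    otherWire w i (wireY w i) = wireX w i := by
  simp only [otherWire]; rw [if_neg h]

lemma Loc.nxt {n : ℕ} {w : List ℕ} (hw : IsReduced n w) {k : ℕ} {E : ℕ → ℕ → Prop} {i : ℕ} {d : ℤ}
    (hi : i < w.length) (h : Loc w k E i d) {r : ℕ} (hr : E r (ent k i r)) :
    ∃ o, E o (ext k i o) ∧ VP w k i r o := by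
  have hab := wXY hw hi
  by_cases hon : NodeOnWire w (i + 1) r
  · have h2 := h.2
    unfold VP Forbidden
    simp only [hon, true_implies, true_and]
    unfold LocP at h2
    rcases hon with rfl | rfl
    · rw [otherX]
      rcases h2 with h2 | h2 | h2 | h2 | h2
      · exact absurd hr h2.1
      · exact ⟨_, h2.2.2.1, Or.inl ⟨rfl, by omega⟩⟩
      · exact absurd hr h2.2.1
      · exact ⟨_, h2.2.2.1, Or.inr rfl⟩
      · exact absurd hr h2.2.1
    · rw [otherY hab.ne]
      rcases h2 with h2 | h2 | h2 | h2 | h2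
      · exact absurd hr h2.2.1
      · exact absurd hr h2.2.1
      · exact ⟨_, h2.2.2.1, Or.inl ⟨rfl, by omega⟩⟩
      · exact absurd hr h2.2.1
      · exact ⟨_, h2.2.2.1, Or.inr rfl⟩
  · refine ⟨r, ?_, Or.inl ⟨rfl, fun h => absurd h hon⟩⟩
    have := h.1 r hon
    unfold ent at hr
    unfold ext
    split_ifs at * <;> tauto

lemma Loc.ent_unique {w : List ℕ} {k : ℕ} {E : ℕ → ℕ → Prop} {i : ℕ} {d : ℤ}
    (h : Loc w k E i d) {r r' : ℕ} (hr : NodeOnWire w (i + 1) r) (hr' : NodeOnWire w (i + 1) r')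
    (h1 : E r (ent k i r)) (h2 : E r' (ent k i r')) : r = r' := by
  have h3 := h.2
  unfold LocP at h3
  rcases hr with rfl | rfl <;> rcases hr' with rfl | rfl
  · rfl
  · tauto
  · tauto
  · rfl

lemma Loc.uniq {w : List ℕ} {k : ℕ} {E : ℕ → ℕ → Prop} {i : ℕ} {d : ℤ}
    (h : Loc w k E i d) {r r' o : ℕ} (hr : VP w k i r o) (hr' : VP w k i r' o)
    (h1 : E r (ent k i r)) (h2 : E r' (ent k i r')) : r = r' := by
  have a1 := hr.on_iff
  have a2 := hr'.on_iff
  by_cases hon : NodeOnWire w (i + 1) o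
  · exact h.ent_unique (a1.2 hon) (a2.2 hon) h1 h2
  · rcases hr with ⟨e1, -⟩ | ⟨e1, -⟩
    · rcases hr' with ⟨e2, -⟩ | ⟨e2, -⟩
      · rw [← e1, e2]
      · exact absurd (a2.1 e2) hon
    · exact absurd (a1.1 e1) hon

lemma on_le {n : ℕ} {w : List ℕ} (hw : IsReduced n w) {i r : ℕ} (hi : i < w.length)
    (h : NodeOnWire w (i + 1) r) : r ≤ n + 1 := by
  have h1 : ∀ b ∈ w.take i, 1 ≤ b ∧ b ≤ n := fun b hb => hw.2.1 b (List.mem_of_mem_take hb)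
  have h2 := hw.letter hi
  rcases h with h | h
  · rw [wX] at h
    have := wordProd_range h1 (x := lt w i) (by omega)
    unfold St at h; omega
  · rw [wY] at h
    have := wordProd_range h1 (x := lt w i + 1) (by omega)
    unfold St at h; omega

lemma E_le {n : ℕ} {w : List ℕ} (hw : IsReduced n w) {k : ℕ} {E : ℕ → ℕ → Prop} {d : ℕ → ℤ}
    (hL : ∀ i < w.length, Loc w k E i (d i)) (hE0 : ∀ r, ¬ E r 0) {r : ℕ} (hr : n + 1 < r) :
    ∀ h ≤ w.length, ¬ E r h := by
  intro h
  induction h with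
  | zero => intro _; exact hE0 r
  | succ h ih =>
    intro hh
    rw [← (hL h hh).1 r (fun ho => by have := on_le hw hh ho; omega)]
    exact ih (by omega)

lemma walk {n : ℕ} {w : List ℕ} (hw : IsReduced n w) {k : ℕ} {E : ℕ → ℕ → Prop} {d : ℕ → ℤ}
    (hL : ∀ i < w.length, Loc w k E i (d i)) (hE0 : ∀ r, ¬ E r 0)
    (hEN : ∀ r, E r w.length ↔ r = k ∨ r = k + 1) (m : ℕ) :
    ∀ (V : Finset (ℕ × ℕ)) (r h : ℕ),
      ((Finset.range (n + 2) ×ˢ Finset.range (w.length + 1)) \ V).card ≤ m →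
      h ≤ w.length → E r h → (r, h) ∉ V → (∀ x ∈ V, E x.1 x.2) →
      (∀ x g, ((x, g) ∈ V ∨ (x, g) = (r, h)) → (x, g) = (k, w.length) ∨
        ∃ i r', i < w.length ∧ g = ext k i x ∧ (r', ent k i r') ∈ V ∧ VP w k i r' x) →
      ∃ ms ps, WK w k r h ms ps ∧ (∀ p ∈ ps, E (enE k p).1 (enE k p).2 ∧ enE k p ∉ V) ∧
        (ps.map (enE k)).Nodup := by
  induction m with
  | zero =>
    intro V r h hc hh hE hV hVE hcl
    exfalso
    rw [Nat.le_zero, Finset.card_eq_zero] at hc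
    have : (r, h) ∈ (Finset.range (n + 2) ×ˢ Finset.range (w.length + 1)) \ V := by
      rw [Finset.mem_sdiff, Finset.mem_product, Finset.mem_range, Finset.mem_range]
      refine ⟨⟨?_, by simp only; omega⟩, hV⟩
      by_contra hr
      exact E_le hw hL hE0 (by simp only at hr; omega) h hh hE
    rw [hc] at this
    simp at this
  | succ m ih =>
    intro V r h hc hh hE hV hVE hcl
    by_cases hend : (r, h) = (k + 1, w.length)
    · rw [Prod.mk.injEq] at hend
      obtain ⟨rfl, rfl⟩ := hend
      exact ⟨[], [], WK.fin, by simp, by simp⟩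
    obtain ⟨i, hi, rfl⟩ : ∃ i, i < w.length ∧ h = ent k i r := by
      by_cases hr : r ≤ k
      · refine ⟨h - 1, ?_, ?_⟩
        · have : h ≠ 0 := by rintro rfl; exact hE0 r hE
          omega
        · have : h ≠ 0 := by rintro rfl; exact hE0 r hE
          simp [ent, hr]; omega
      · refine ⟨h, ?_, by simp [ent, hr]⟩
        rcases Nat.lt_or_ge h w.length with h' | h'
        · exact h'
        · obtain rfl : h = w.length := by omega
          rw [hEN] at hE
          exfalso
          apply hend
          rw [Prod.mk.injEq]; omega
    obtain ⟨o, ho, hvp⟩ := (hL i hi).nxt hw hi hE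
    have hx : ext k i o ≤ w.length := by unfold ext; split_ifs <;> omega
    have hnew : (o, ext k i o) ∉ insert (r, ent k i r) V := by
      intro hmem
      rw [Finset.mem_insert] at hmem
      rcases hcl o (ext k i o) hmem.symm with h1 | ⟨i', r', hi', e1, h2, h3⟩
      · rw [Prod.mk.injEq] at h1
        obtain ⟨rfl, h1⟩ := h1
        simp [ext] at h1; omega
      · obtain rfl := ext_inj e1
        have := (hL i hi).uniq hvp h3 hE (hVE _ h2)
        subst this
        exact hV h2
    have hin : (r, ent k i r) ∈ (Finset.range (n + 2) ×ˢ Finset.range (w.length + 1)) \ V := by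
      rw [Finset.mem_sdiff, Finset.mem_product, Finset.mem_range, Finset.mem_range]
      refine ⟨⟨?_, by simp only; omega⟩, hV⟩
      by_contra hr
      exact E_le hw hL hE0 (by simp only at hr; omega) _ hh hE
    obtain ⟨ms, ps, g1, g2, g3⟩ := ih (insert (r, ent k i r) V) o (ext k i o)
      (by
        have hss : (Finset.range (n + 2) ×ˢ Finset.range (w.length + 1)) \ insert (r, ent k i r) V ⊂
            (Finset.range (n + 2) ×ˢ Finset.range (w.length + 1)) \ V := by
          rw [Finset.ssubset_iff_of_subset
            (Finset.sdiff_subset_sdiff le_rfl (Finset.subset_insert _ _))]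
          exact ⟨_, hin, by simp⟩
        have := Finset.card_lt_card hss
        omega) hx ho hnew
      (by
        intro x hx
        rcases Finset.mem_insert.1 hx with rfl | hx
        · exact hE
        · exact hVE x hx)
      (by
        intro x g hxg
        rcases hxg with hxg | hxg
        · rcases hcl x g (Finset.mem_insert.1 hxg).symm with h1 | ⟨i', r', a1, a2, a3, a4⟩
          · exact Or.inl h1
          · exact Or.inr ⟨i', r', a1, a2, Finset.mem_insert_of_mem a3, a4⟩
        · rw [Prod.mk.injEq] at hxg
          obtain ⟨rfl, rfl⟩ := hxg
          exact Or.inr ⟨i, r, hi, rfl, Finset.mem_insert_self _ _, hvp⟩)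
    have fin2 : ∀ {ms'}, WK w k r (ent k i r) ms' ((i, r, o) :: ps) →
        ∃ ms ps, WK w k r (ent k i r) ms ps ∧
          (∀ p ∈ ps, E (enE k p).1 (enE k p).2 ∧ enE k p ∉ V) ∧ (ps.map (enE k)).Nodup := by
      intro ms' hwk
      refine ⟨ms', _, hwk, ?_, ?_⟩
      · intro p hp
        rcases List.mem_cons.1 hp with rfl | hp
        · exact ⟨hE, hV⟩
        · exact ⟨(g2 p hp).1, fun hh => (g2 p hp).2 (Finset.mem_insert_of_mem hh)⟩
      · rw [List.map_cons, List.nodup_cons]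
        refine ⟨?_, g3⟩
        intro hmem
        obtain ⟨p, hp, he⟩ := List.mem_map.1 hmem
        apply (g2 p hp).2
        rw [he]
        exact Finset.mem_insert_self _ _
    rcases hvp with ⟨rfl, hf⟩ | ⟨hon, rfl⟩
    · exact fin2 (WK.go hi hf g1)
    · exact fin2 (WK.sw hi hon g1)

lemma vis_nodup {w : List ℕ} {k : ℕ} {E : ℕ → ℕ → Prop} {d : ℕ → ℤ}
    (hL : ∀ i < w.length, Loc w k E i (d i)) {ps : List (ℕ × ℕ × ℕ)}
    (hv : ∀ p ∈ ps, p.1 < w.length) (hE : ∀ p ∈ ps, E (enE k p).1 (enE k p).2)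
    (hnd : (ps.map (enE k)).Nodup) : (vis w ps).Nodup := by
  unfold vis
  apply List.Nodup.map_on
  · rintro ⟨i, r, o⟩ hp ⟨i', r', o'⟩ hq h
    rw [List.mem_filter] at hp hq
    simp only [Nat.add_right_cancel_iff] at h
    subst h
    have h1 := hE _ hp.1
    have h2 := hE _ hq.1
    have h3 := (hL i (hv _ hp.1)).ent_unique (r := r) (r' := r') (by simpa using hp.2) (by simpa using hq.2) h1 h2
    subst h3
    exact List.inj_on_of_nodup_map hnd hp.1 hq.1 rfl
  · exact (List.Nodup.of_map _ hnd).filter _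

/-- sets of edges of trails -/
lemma trail_path {n : ℕ} {w : List ℕ} (hw : IsReduced n w) (hN : 0 < w.length)
    {Fs : ℕ → Set ℕ} {d : ℕ → ℤ} {k : ℕ}
    (hk1 : 1 ≤ k) (hk2 : k ≤ n)
    (h : HT w Fs d) (h0 : Fs 0 = Set.Iic k) (h1 : Fs w.length = EndS k) :
    ∃ ms ps, WK w k k w.length ms ps ∧ (vis w ps).Nodup ∧ ∀ i < w.length, cI ps i = d i := by
  set E : ℕ → ℕ → Prop := fun r h => ¬(r ∈ Fs h ↔ r ≤ k) with hE
  have hL : ∀ i < w.length, Loc w k E i (d i) := fun i hi => loc_of_HT hw hk1 hk2 h h0 h1 hi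
  have hE0 : ∀ r, ¬ E r 0 := by intro r; simp [hE, h0]
  have hEN : ∀ r, E r w.length ↔ r = k ∨ r = k + 1 := by
    intro r; simp only [hE, h1, mem_EndS]; omega
  obtain ⟨ms, ps, g1, g2, g3⟩ := walk hw hL hE0 hEN _ ∅ k w.length le_rfl le_rfl
    ((hEN k).2 (Or.inl rfl)) (by simp) (by simp) (by
      intro x g hx
      rcases hx with hx | hx
      · simp at hx
      · exact Or.inl hx)
  have hv := g1.valid
  have hnd := vis_nodup hL (fun p hp => (hv p hp).1) (fun p hp => (g2 p hp).1) g3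
  refine ⟨ms, ps, g1, hnd, ?_⟩
  have hP : ∀ r h, h ≤ w.length → EP w k ps r h → E r h := by
    intro r h _ hp
    unfold EP at hp
    rw [List.mem_append, List.mem_map, List.mem_singleton] at hp
    rcases hp with ⟨p, hp, he⟩ | he
    · have := (g2 p hp).1
      rwa [he] at this
    · rw [Prod.mk.injEq] at he
      rw [he.1, he.2, hEN]; simp
  have hD : ∀ i < w.length, Loc w k (fun r h => E r h ∧ ¬ EP w k ps r h) i (d i - cI ps i) :=
    fun i hi => (hL i hi).sub (g1.loc hw hnd hi) hP hi
  set D : ℕ → ℕ → Prop := fun r h => E r h ∧ ¬ EP w k ps r h with hDdef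
  have hHT : HT w (FE k D) (fun i => d i - cI ps i) := fun i hi => (hD i hi).step hw hi
  have b0 : FE k D 0 = Set.Iic k := by
    ext r
    rw [mem_FE, Set.mem_Iic]
    have := hE0 r
    simp [hDdef, this]
  have b1 : FE k D w.length = Set.Iic k := by
    ext r
    rw [mem_FE, Set.mem_Iic]
    have : ¬ D r w.length := by
      simp only [hDdef, hEN, g1.last]; tauto
    simp [this]
  have hb : ∀ j ≤ w.length, ∀ r, ¬ D r j := by
    intro j hj r
    have := hHT.base hw b0 b1 hj
    have h2 : r ∈ FE k D j ↔ r ∈ Set.Iic k := by rw [this]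
    rw [mem_FE, Set.mem_Iic] at h2
    tauto
  intro i hi
  have h2 := (hD i hi).2
  have h3 := hb (ent k i (wireX w (i + 1))) (by unfold ent; split_ifs <;> omega) (wireX w (i + 1))
  have h4 := hb (ent k i (wireY w (i + 1))) (by unfold ent; split_ifs <;> omega) (wireY w (i + 1))
  unfold LocP at h2
  simp only [h3, h4, false_and, or_false, not_false_eq_true, true_and] at h2
  omega

lemma path_trail {n : ℕ} {w : List ℕ} (hw : IsReduced n w) (hN : 0 < w.length) {k : ℕ}
    {ms : List ℕ} {ps : List (ℕ × ℕ × ℕ)} (H : WK w k k w.length ms ps) (hnd : (vis w ps).Nodup) :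
    ∃ Fs : ℕ → Set ℕ, Fs 0 = Set.Iic k ∧ Fs w.length = EndS k ∧ HT w Fs (cI ps) := by
  refine ⟨FE k (EP w k ps), ?_, ?_, fun i hi => (H.loc hw hnd hi).step hw hi⟩
  · ext r
    rw [mem_FE, Set.mem_Iic]
    have := H.zero hN r
    simp [this]
  · ext r
    rw [mem_FE, H.last, mem_EndS]
    omega

lemma normals_eq {n : ℕ} {w : List ℕ} (hw : IsReduced n w) (hN : 0 < w.length) :
    normalVec n w '' GP n w = vec (Dim n) '' DL n w := by
  have hlen : w.length = Dim n := hw.1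
  apply Set.Subset.antisymm
  · rintro _ ⟨⟨k, ms⟩, hp, rfl⟩
    obtain ⟨hk1, hk2, ps, H, hnd⟩ := GP_iff.1 hp
    obtain ⟨Fs, f0, f1, f2⟩ := path_trail hw hN H hnd
    refine ⟨(List.range w.length).map (cI ps), ?_, ?_⟩
    · rw [DL_iff]
      refine ⟨k, hk1, hk2, Fs, f0, f1, by simp, ?_⟩
      intro h hh
      have := f2 h hh
      simpa [List.getD_eq_getElem?_getD, hh] using this
    · funext j
      have hj : (j : ℕ) < w.length := by rw [hlen]; exact j.2
      simp only [vec, normalVec]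
      rw [H.coeff hw]
      simp [List.getD_eq_getElem?_getD, hj]
  · rintro _ ⟨ds, hds, rfl⟩
    obtain ⟨k, hk1, hk2, Fs, f0, f1, f2, f3⟩ := DL_iff.1 hds
    obtain ⟨ms, ps, H, hnd, hc⟩ := trail_path hw hN hk1 hk2 f3 f0 f1
    refine ⟨(k, ms), GP_iff.2 ⟨hk1, hk2, ps, H, hnd⟩, ?_⟩
    funext j
    have hj : (j : ℕ) < w.length := by rw [hlen]; exact j.2
    simp only [vec, normalVec]
    rw [H.coeff hw, hc _ hj]

lemma stringCone_eq {n : ℕ} {w : List ℕ} (hw : IsReduced n w) (hN : 0 < w.length) :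
    stringCone n w = coneOf (vec (Dim n) '' DL n w) := by
  rw [← normals_eq hw hN]
  ext t
  simp only [stringCone, coneOf, Set.mem_ofPred_eq, Set.forall_mem_image]
  rfl

/-! ### Simplicial cones -/

lemma functional_dt {m : ℕ} (Ψ : (Fin m → ℝ) →ₗ[ℝ] ℝ) : ∃ t : Fin m → ℝ, ∀ v, Ψ v = dt v t := by
  refine ⟨fun i => Ψ (fun j => if i = j then 1 else 0), fun v => ?_⟩
  rw [LinearMap.pi_apply_eq_sum_univ Ψ v]
  rfl

lemma stringCone_facets {n : ℕ} {w : List ℕ} (hw : IsReduced n w) (hN : 0 < w.length) :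
    (interior (stringCone n w)).Nonempty ∧ numFacets (stringCone n w) = (DL n w).ncard := by
  have hfin : (vec (Dim n) '' DL n w).Finite := (DL_finite n w).image _
  have hlen : w.length = Dim n := hw.1
  have hinj : Set.InjOn (vec (Dim n)) (DL n w) := fun a ha b hb h =>
    vec_inj ((DL_length ha).trans hlen) ((DL_length hb).trans hlen) h
  have h1 : ∃ t, ∀ v ∈ vec (Dim n) '' DL n w, 0 < dt v t := by
    obtain ⟨Ψ, hΨ⟩ := sep_star hw hlen
    obtain ⟨t, ht⟩ := functional_dt Ψ
    refine ⟨t, ?_⟩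
    rintro _ ⟨ds, hds, rfl⟩
    rw [← ht]
    exact hΨ ds hds
  have h2 : ∀ v0 ∈ vec (Dim n) '' DL n w, ∃ t, dt v0 t = 0 ∧
      ∀ v ∈ vec (Dim n) '' DL n w, v ≠ v0 → 0 < dt v t := by
    rintro _ ⟨ds0, hds0, rfl⟩
    obtain ⟨Ψ, hΨ0, hΨ⟩ := sep_zero hw hlen hds0
    obtain ⟨t, ht⟩ := functional_dt Ψ
    refine ⟨t, by rw [← ht]; exact hΨ0, ?_⟩
    rintro _ ⟨ds, hds, rfl⟩ hne
    rw [← ht]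
    exact hΨ ds hds (fun h => hne (by rw [h]))
  have h3 : (vec (Dim n) '' DL n w).Nonempty := by
    apply Set.Nonempty.image
    apply Set.nonempty_of_ncard_ne_zero
    have := DL_ncard_ge hw
    omega
  rw [stringCone_eq hw hN]
  exact ⟨coneOf_interior hfin h1, by rw [coneOf_numFacets hfin h3 h1 h2, hinj.ncard_image]⟩

/-- cone defined by the rows of a matrix -/
def mcone {m : ℕ} (R : Matrix (Fin m) (Fin m) ℝ) : Set (Fin m → ℝ) :=
  {t | ∀ i, 0 ≤ Matrix.mulVec R t i}

lemma mcone_img {m : ℕ} {B M Q : Matrix (Fin m) (Fin m) ℝ} (hQ : IsUnit Q.det) (h : B * Q = M) :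
    mcone B = (fun x => Matrix.mulVec Q x) '' mcone M := by
  subst h
  ext t
  constructor
  · intro ht
    refine ⟨Matrix.mulVec Q⁻¹ t, ?_, ?_⟩
    · intro i
      rw [Matrix.mulVec_mulVec, Matrix.mul_nonsing_inv_cancel_right _ _ hQ]
      exact ht i
    · simp only
      rw [Matrix.mulVec_mulVec, Matrix.mul_nonsing_inv _ hQ, Matrix.one_mulVec]
  · rintro ⟨x, hx, rfl⟩ i
    have := hx i
    simpa only [Matrix.mulVec_mulVec] using this

lemma mcone_coneOf {m : ℕ} (R : Matrix (Fin m) (Fin m) ℝ) :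
    mcone R = coneOf (Set.range fun i => R i) := by
  ext t
  simp only [mcone, coneOf, Set.mem_ofPred_eq, Set.forall_mem_range]
  rfl

lemma mcone_facets {m : ℕ} (hm : 0 < m) {R : Matrix (Fin m) (Fin m) ℝ} (hR : IsUnit R.det) :
    (interior (mcone R)).Nonempty ∧ numFacets (mcone R) = m := by
  have key : ∀ y : Fin m → ℝ, ∀ i, dt (R i) (Matrix.mulVec R⁻¹ y) = y i := by
    intro y i
    have : Matrix.mulVec R (Matrix.mulVec R⁻¹ y) = y := by
      rw [Matrix.mulVec_mulVec, Matrix.mul_nonsing_inv _ hR, Matrix.one_mulVec]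
    exact congrFun this i
  have hfin : (Set.range fun i => R i).Finite := Set.finite_range _
  have h1 : ∃ t, ∀ v ∈ (Set.range fun i => R i), 0 < dt v t := by
    refine ⟨Matrix.mulVec R⁻¹ (fun _ => 1), ?_⟩
    rintro _ ⟨i, rfl⟩
    simp only
    rw [key]; norm_num
  have h2 : ∀ v0 ∈ (Set.range fun i => R i), ∃ t, dt v0 t = 0 ∧
      ∀ v ∈ (Set.range fun i => R i), v ≠ v0 → 0 < dt v t := by
    rintro _ ⟨i0, rfl⟩
    refine ⟨Matrix.mulVec R⁻¹ (fun i => if i = i0 then 0 else 1), by simp only; rw [key]; simp, ?_⟩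
    rintro _ ⟨i, rfl⟩ hne
    simp only
    rw [key, if_neg (fun h => hne (by rw [h]))]
    norm_num
  have hinj : Function.Injective fun i => R i := by
    intro i j h
    simp only at h
    have e1 := key (fun x => if x = i then 1 else 0) i
    have e2 := key (fun x => if x = i then 1 else 0) j
    rw [h, e2] at e1
    by_contra hne
    rw [if_pos rfl, if_neg (fun h => hne h.symm)] at e1
    norm_num at e1
  rw [mcone_coneOf]
  refine ⟨coneOf_interior hfin h1, ?_⟩
  rw [coneOf_numFacets hfin ⟨_, ⟨⟨0, hm⟩, rfl⟩⟩ h1 h2, ← Set.image_univ, hinj.injOn.ncard_image,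
    Set.ncard_univ, Nat.card_fin]

lemma mcone_of_affine {m : ℕ} {V : Set (Fin m → ℝ)} {B A : Matrix (Fin m) (Fin m) ℝ}
    {v : Fin m → ℝ} (hA : IsUnit A.det)
    (h : mcone B = (fun x => Matrix.mulVec A x + v) '' coneOf V) : coneOf V = mcone (B * A) := by
  have h0 : (0 : Fin m → ℝ) ∈ coneOf V := by intro u _; simp [dt]
  have hv : ∀ i, 0 ≤ Matrix.mulVec B v i := by
    have : v ∈ mcone B := by rw [h]; exact ⟨0, h0, by simp⟩
    exact this
  ext x
  constructor
  · intro hx i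
    by_contra hneg
    push Not at hneg
    set z := Matrix.mulVec (B * A) x i with hz
    have hs : ∀ s : ℝ, 0 ≤ s → 0 ≤ s * z + Matrix.mulVec B v i := by
      intro s hs
      have h1 : s • x ∈ coneOf V := by
        intro u hu; rw [dt_smul]; exact mul_nonneg hs (hx u hu)
      have h2 : Matrix.mulVec A (s • x) + v ∈ mcone B := by rw [h]; exact ⟨_, h1, rfl⟩
      have h3 := h2 i
      rw [Matrix.mulVec_add, Matrix.mulVec_mulVec, Matrix.mulVec_smul, Pi.add_apply,
        Pi.smul_apply, smul_eq_mul] at h3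
      exact h3
    have h4 := hs ((Matrix.mulVec B v i + 1) / (-z)) (by
      apply div_nonneg
      · have := hv i; linarith
      · linarith)
    have h5 : (Matrix.mulVec B v i + 1) / (-z) * z = -(Matrix.mulVec B v i + 1) := by
      have : z ≠ 0 := hneg.ne
      field_simp
    rw [h5] at h4
    linarith
  · intro hx
    have h2 : Matrix.mulVec A x + v ∈ mcone B := by
      intro i
      rw [Matrix.mulVec_add, Matrix.mulVec_mulVec, Pi.add_apply]
      exact add_nonneg (hx i) (hv i)
    rw [h] at h2
    obtain ⟨x', hx', he⟩ := h2
    have he2 : Matrix.mulVec A x' = Matrix.mulVec A x := by simpa using he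
    have he3 : x' = x := by
      have := congrArg (Matrix.mulVec A⁻¹) he2
      rwa [Matrix.mulVec_mulVec, Matrix.mulVec_mulVec, Matrix.nonsing_inv_mul _ hA,
        Matrix.one_mulVec, Matrix.one_mulVec] at this
    rwa [← he3]

/-! ### The chain cone -/

lemma tri_succ (k : ℕ) : (k + 1) * (k + 1 - 1) / 2 = k * (k - 1) / 2 + k := by
  have : (k + 1) * (k + 1 - 1) = k * (k - 1) + k * 2 := by
    rcases k with _ | k
    · rfl
    · simp only [Nat.add_sub_cancel]; ring
  rw [this, Nat.add_mul_div_right _ _ (by norm_num)]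

lemma Dim_eq (n : ℕ) : Dim n = n * (n - 1) / 2 + n := by
  rw [← tri_succ]; unfold Dim; rw [Nat.add_sub_cancel, mul_comm]

lemma tri_mono {a b : ℕ} (h : a ≤ b) : a * (a - 1) / 2 ≤ b * (b - 1) / 2 :=
  Nat.div_le_div_right (Nat.mul_le_mul h (by omega))

lemma tri_exists (n e : ℕ) (h : e < n * (n - 1) / 2 + n) :
    ∃ k j, 1 ≤ k ∧ k ≤ n ∧ 1 ≤ j ∧ j ≤ k ∧ e = k * (k - 1) / 2 + (j - 1) := by
  induction n with
  | zero => simp at h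
  | succ n ih =>
    rcases Nat.lt_or_ge e (n * (n - 1) / 2 + n) with h1 | h1
    · obtain ⟨k, j, h2, h3, h4⟩ := ih h1
      exact ⟨k, j, h2, by omega, h4⟩
    · rw [tri_succ] at h
      refine ⟨n + 1, e - (n * (n - 1) / 2 + n) + 1, by omega, le_rfl, by omega, by omega, ?_⟩
      rw [tri_succ]; omega

/-- last index of a chain -/
def IsEnd (e : ℕ) : Prop := ∃ k, 1 ≤ k ∧ e + 1 = k * (k - 1) / 2 + k

lemma isEnd_iff {k j : ℕ} (hj1 : 1 ≤ j) (hj2 : j ≤ k) :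
    IsEnd (k * (k - 1) / 2 + (j - 1)) ↔ j = k := by
  constructor
  · rintro ⟨k', h1, h2⟩
    rcases Nat.lt_trichotomy k' k with h | rfl | h
    · have := tri_mono (show k' + 1 ≤ k from h)
      rw [tri_succ] at this; omega
    · omega
    · have := tri_mono (show k + 1 ≤ k' from h)
      rw [tri_succ] at this; omega
  · rintro rfl
    exact ⟨j, hj1, by omega⟩

/-- matrix of the chain cone -/
def Bch (n : ℕ) : Matrix (Fin (Dim n)) (Fin (Dim n)) ℤ := fun e e' =>
  if e' = e then 1 else if (e' : ℕ) = e + 1 ∧ ¬ IsEnd e then -1 else 0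

lemma Bch_det (n : ℕ) : (Bch n).det = 1 := by
  rw [Matrix.det_of_upperTriangular]
  · simp [Bch]
  · intro i j h
    simp only [id] at h
    unfold Bch
    rw [if_neg (by rintro rfl; exact lt_irrefl _ h), if_neg]
    have : (j : ℕ) < i := h
    omega

lemma Bch_mulVec (n : ℕ) (t : Fin (Dim n) → ℝ) (e : Fin (Dim n)) :
    Matrix.mulVec ((Bch n).map (Int.cast : ℤ → ℝ)) t e =
      t e - (if IsEnd e then 0 else entry n t (e + 1)) := by
  have h1 : ∀ e' : Fin (Dim n), ((Bch n e e' : ℤ) : ℝ) * t e' =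
      (if e' = e then t e else 0) +
      (if (e' : ℕ) = e + 1 ∧ ¬ IsEnd e then - t e' else 0) := by
    intro e'
    unfold Bch
    by_cases h : e' = e
    · subst h; simp
    · by_cases h2 : (e' : ℕ) = e + 1 ∧ ¬ IsEnd e
      · simp [h, h2]
      · simp [h, h2]
  have : Matrix.mulVec ((Bch n).map (Int.cast : ℤ → ℝ)) t e =
      ∑ e', ((Bch n e e' : ℤ) : ℝ) * t e' := rfl
  rw [this, Finset.sum_congr rfl (fun e' _ => h1 e'), Finset.sum_add_distrib,
    Finset.sum_ite_eq' Finset.univ e (fun _ => t e)]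
  rw [if_pos (Finset.mem_univ _), sub_eq_add_neg]
  congr 1
  by_cases hE : IsEnd e
  · simp [hE]
  · simp only [hE, not_false_eq_true, and_true, if_false]
    unfold entry
    split_ifs with h
    · rw [Finset.sum_eq_single ⟨(e : ℕ) + 1, h⟩]
      · simp
      · intro b _ hb
        rw [if_neg]
        intro h'
        exact hb (Fin.ext h')
      · simp
    · rw [neg_zero]
      apply Finset.sum_eq_zero
      intro b _
      rw [if_neg]
      have := b.2
      omega

lemma chainCone_eq (n : ℕ) : chainCone n = mcone ((Bch n).map (Int.cast : ℤ → ℝ)) := by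
  ext t
  simp only [chainCone, mcone, Set.mem_ofPred_eq]
  constructor
  · intro h e
    rw [Bch_mulVec]
    obtain ⟨k, j, h1, h2, h3, h4, h5⟩ := tri_exists n e (by rw [← Dim_eq]; exact e.2)
    have h6 := h k j h1 h2 h3 h4
    have h7 := isEnd_iff h3 h4
    rw [← h5] at h6 h7
    have h8 : k * (k - 1) / 2 + j = e + 1 := by omega
    rw [h8] at h6
    have h9 : entry n t e = t e := by simp [entry]
    rw [h9] at h6
    simp only [h7]
    linarith
  · intro h k j h1 h2 h3 h4
    have hlt : k * (k - 1) / 2 + (j - 1) < Dim n := by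
      have := tri_mono h2
      rw [Dim_eq]; omega
    have h6 := h ⟨_, hlt⟩
    rw [Bch_mulVec] at h6
    simp only [isEnd_iff h3 h4] at h6
    have h8 : k * (k - 1) / 2 + (j - 1) + 1 = k * (k - 1) / 2 + j := by omega
    rw [h8] at h6
    have h9 : entry n t (k * (k - 1) / 2 + (j - 1)) = t ⟨_, hlt⟩ := by
      simp only [entry]; rw [dif_pos hlt]
    rw [h9]
    linarith

lemma map_det_unit {m : ℕ} {M : Matrix (Fin m) (Fin m) ℤ} (h : IsUnit M.det) :
    IsUnit (M.map (Int.cast : ℤ → ℝ)).det := by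
  have : (M.map (Int.cast : ℤ → ℝ)).det = ((M.det : ℤ) : ℝ) := by
    rw [Int.cast_det]
  rw [this]
  exact h.map (Int.castRingHom ℝ)

lemma unimod_of_mcone {n : ℕ} {S : Set (Fin (Dim n) → ℝ)}
    {M : Matrix (Fin (Dim n)) (Fin (Dim n)) ℤ}
    (hM : M.det = 1) (hS : S = mcone (M.map (Int.cast : ℤ → ℝ))) :
    UnimodEquiv S (chainCone n) := by
  have hB : IsUnit (Bch n).det := by rw [Bch_det]; exact isUnit_one
  have hBQ : Bch n * ((Bch n)⁻¹ * M) = M := Matrix.mul_nonsing_inv_cancel_left _ _ hB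
  have hQ : IsUnit ((Bch n)⁻¹ * M).det := by
    rw [Matrix.det_mul, hM, mul_one]
    exact Matrix.isUnit_nonsing_inv_det _ hB
  refine ⟨(Bch n)⁻¹ * M, 0, hQ, ?_⟩
  rw [chainCone_eq, hS]
  have := mcone_img (B := (Bch n).map (Int.cast : ℤ → ℝ)) (M := M.map (Int.cast : ℤ → ℝ))
    (map_det_unit hQ) (by
      have e := Matrix.map_mul (L := Bch n) (M := (Bch n)⁻¹ * M) (f := Int.castRingHom ℝ)
      rw [hBQ] at e
      exact e.symm)
  rw [this]
  congr 1
  funext x i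
  simp only [Pi.zero_apply, Int.cast_zero, add_zero]
  rfl

lemma stringCone_mcone {n : ℕ} {w : List ℕ} (hw : IsReduced n w) (hN : 0 < w.length)
    (hc : (DL n w).ncard = w.length) :
    ∃ M : Matrix (Fin (Dim n)) (Fin (Dim n)) ℤ, M.det = 1 ∧
      stringCone n w = mcone (M.map (Int.cast : ℤ → ℝ)) := by
  obtain ⟨f, hf, hf'⟩ := exists_can hw
  have hlen : w.length = Dim n := hw.1
  have hr := DL_eq_range hc hf hf'
  refine ⟨Matrix.of (fun i j => (f (Fin.cast hlen.symm i)).getD j 0), ?_, ?_⟩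
  · rw [Matrix.det_of_upperTriangular]
    · apply Finset.prod_eq_one
      intro i _
      obtain ⟨e, he⟩ := (hf' (Fin.cast hlen.symm i)).2
      rw [Matrix.of_apply, he]
      simp [List.getD_eq_getElem?_getD]
    · intro i j h
      have h' : (j : ℕ) < i := h
      obtain ⟨e, he⟩ := (hf' (Fin.cast hlen.symm i)).2
      rw [Matrix.of_apply, he]
      simp [List.getD_eq_getElem?_getD, List.getElem?_append, h', List.getElem?_replicate]
  · rw [stringCone_eq hw hN, mcone_coneOf]
    congr 1
    rw [hr]
    ext v
    constructor
    · rintro ⟨_, ⟨j, rfl⟩, rfl⟩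
      exact ⟨Fin.cast hlen j, rfl⟩
    · rintro ⟨i, rfl⟩
      exact ⟨_, ⟨Fin.cast hlen.symm i, rfl⟩, rfl⟩

/-- Theorem: simplicial string cones.
For `i ∈ Σ_{n+1}` the following are equivalent:
(1) the string cone `C_i` is simplicial (full-dimensional with exactly `N` facets);
(2) there is `(σ_1,…,σ_n) ∈ {A,D}^n` with `ind_{σ_k}(C_{σ_{k+1}} ∘ ⋯ ∘ C_{σ_n}(i)) = 0`
for all `k`;
(3) `C_i` is unimodularly equivalent to the product of the cones
`t_{k(k-1)/2+1} ≥ ⋯ ≥ t_{k(k-1)/2+k} ≥ 0`, `k = 1, …, n`. -/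
theorem statement14 (n : ℕ) (hn : 1 ≤ n) (i : List ℕ) (hi : IsReduced n i) :
    (((interior (stringCone n i)).Nonempty ∧ numFacets (stringCone n i) = Dim n) ↔
      SimplicialWord n i) ∧
    (((interior (stringCone n i)).Nonempty ∧ numFacets (stringCone n i) = Dim n) ↔
      UnimodEquiv (stringCone n i) (chainCone n)) := by
  have hlen : i.length = Dim n := hi.1
  have hD : 0 < Dim n := by
    unfold Dim
    apply Nat.div_pos _ (by norm_num)
    nlinarith
  have hN : 0 < i.length := by omega
  obtain ⟨h1, h2⟩ := stringCone_facets hi hN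
  refine ⟨⟨fun h => simplicial_of_ncard hi (by rw [← h2, h.2, hlen]), fun h => ⟨h1, ?_⟩⟩, ?_, ?_⟩
  · have ha := simplicial_ncard hi h
    have hb := DL_ncard_ge hi
    have hc : n * (n + 1) / 2 = Dim n := rfl
    omega
  · intro h
    obtain ⟨M, hM, hS⟩ := stringCone_mcone hi hN (by rw [← h2, h.2, hlen])
    exact unimod_of_mcone hM hS
  · rintro ⟨M, v, hM, hQ⟩
    rw [chainCone_eq, stringCone_eq hi hN] at hQ
    have hA := map_det_unit hM
    have h := mcone_of_affine (v := fun i => (v i : ℝ)) hA hQ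
    rw [stringCone_eq hi hN, h]
    apply mcone_facets hD
    rw [Matrix.det_mul]
    exact (map_det_unit (by rw [Bch_det]; exact isUnit_one)).mul hA

end StringPolytope
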